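/- arXiv:1006.3786 — 5 statements merged into one kernel-verified Lean document; each statement's English description precedes it below -/
import Mathlib

section
/- Fix an integer k ≥ 2 and let ψ_n(α) := (1/n)·E[log Z(F(n,α)) | Z(F(n,α)) ≥ 1]. Then for every α < α*, the sequence ψ_n(α) converges as n → ∞ to a limit φ_s(α). -/
open Filter
open scoped Classical Topology BigOperators

noncomputable section

/-- A `k`-clause on `n` Boolean variables: a set of `k` literals (variable–sign pairs)
over `k` distinct variables.  There are `C(n,k) * 2^k` such clauses. -/
def Clause (n k : ℕ) : Type :=
  {L : Finset (Fin n × Bool) // L.card = k ∧ (L.image Prod.fst).card = k}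

instance (n k : ℕ) : Fintype (Clause n k) := Subtype.fintype _

/-- A truth assignment satisfies a clause iff some literal of the clause evaluates to true. -/
def sat {n k : ℕ} (x : Fin n → Bool) (c : Clause n k) : Prop :=
  ∃ l ∈ c.1, x l.1 = l.2

/-- The number of satisfying assignments of the formula given by conjoining the clauses in `F`. -/
def Z {n k : ℕ} (F : Finset (Clause n k)) : ℕ :=
  (Finset.univ.filter fun x : Fin n → Bool => ∀ c ∈ F, sat x c).card

/-- The probability, under the binomial model in which every clause of `C_k(n)` is selected
independently with probability `p = α n / N`, of drawing precisely the formula `F`. -/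
def wt (n k : ℕ) (α : ℝ) (F : Finset (Clause n k)) : ℝ :=
  (α * n / (Fintype.card (Clause n k) : ℝ)) ^ F.card *
    (1 - α * n / (Fintype.card (Clause n k) : ℝ)) ^ (Fintype.card (Clause n k) - F.card)

/-- `P_n(α, φ) = ℙ{Z(F(n,α)) < 2^{nφ}}`. -/
def Pn (k n : ℕ) (α φ : ℝ) : ℝ :=
  ∑ F : Finset (Clause n k),
    if (Z F : ℝ) < (2 : ℝ) ^ ((n : ℝ) * φ) then wt n k α F else 0

/-- `α* = sup{α : P_n(α,0) = O(1/(log n)^{1+ε}) for some ε > 0}`. -/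
def alphaStar (k : ℕ) : ℝ :=
  sSup {α : ℝ | ∃ ε : ℝ, 0 < ε ∧ ∃ C : ℝ,
    ∀ᶠ (n : ℕ) in atTop, Pn k n α 0 ≤ C / Real.log n ^ (1 + ε)}


/-- `ψ_n(α) = (1/n) E[log Z(F(n,α)) | Z(F(n,α)) ≥ 1]`. -/
def psin (k n : ℕ) (α : ℝ) : ℝ :=
  (1 / (n : ℝ)) *
    ((∑ F : Finset (Clause n k), if 1 ≤ Z F then wt n k α F * Real.log (Z F) else 0) /
      (∑ F : Finset (Clause n k), if 1 ≤ Z F then wt n k α F else 0))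

/-! ### Product Bernoulli measures on the subsets of a finite type -/

section ProductMeasure

variable {ι κ : Type*} [Fintype ι] [DecidableEq ι] [Fintype κ] [DecidableEq κ]

/-- The weight of `F` when every `c` is selected independently with probability `p c`. -/
def prodWt (p : ι → ℝ) (F : Finset ι) : ℝ := ∏ c, if c ∈ F then p c else 1 - p c

/-- The expectation of `f` when every `c` is selected independently with probability `p c`. -/
def prodExp (p : ι → ℝ) (f : Finset ι → ℝ) : ℝ := ∑ F, prodWt p F * f F

lemma prodWt_nonneg {p : ι → ℝ} (h0 : ∀ c, 0 ≤ p c) (h1 : ∀ c, p c ≤ 1) (F : Finset ι) :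
    0 ≤ prodWt p F := by
  refine Finset.prod_nonneg fun c _ => ?_
  split_ifs
  · exact h0 c
  · linarith [h1 c]

lemma sum_prodWt (p : ι → ℝ) : ∑ F, prodWt p F = 1 := by
  have h := Finset.prod_add p (fun c => 1 - p c) Finset.univ
  simp only [add_sub_cancel, Finset.prod_const_one, Finset.powerset_univ] at h
  rw [h]
  refine Finset.sum_congr rfl fun F _ => ?_
  rw [prodWt, Finset.prod_ite]
  congr 2
  · ext; simp
  · ext; simp

lemma prodWt_const (p : ℝ) (F : Finset ι) :
    prodWt (fun _ => p) F = p ^ F.card * (1 - p) ^ (Fintype.card ι - F.card) := by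
  rw [prodWt, Finset.prod_ite, Finset.prod_const, Finset.prod_const, ← Finset.card_compl]
  congr 3
  · ext; simp
  · ext; simp

lemma prodWt_zero (F : Finset ι) : prodWt (fun _ => 0) F = if F = ∅ then 1 else 0 := by
  rw [prodWt_const]
  split_ifs with h
  · simp [h]
  · simp [Finset.card_ne_zero.2 (Finset.nonempty_iff_ne_empty.2 h)]

lemma prodExp_elim (p : ι → ℝ) (q : κ → ℝ) (f : Finset (ι ⊕ κ) → ℝ) :
    prodExp (Sum.elim p q) f = prodExp p fun A => prodExp q fun B => f (A.disjSum B) := by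
  simp only [prodExp, Finset.mul_sum]
  rw [← Finset.sum_product', Finset.univ_product_univ]
  refine Fintype.sum_equiv Finset.sumEquiv.toEquiv _ _ fun F => ?_
  simp [prodWt, Finset.toLeft_disjSum_toRight, mul_assoc]

lemma prodExp_zero (f : Finset ι → ℝ) : prodExp (fun _ => 0) f = f ∅ := by
  simp [prodExp, prodWt_zero]

lemma prodExp_const (p : ι → ℝ) (a : ℝ) : prodExp p (fun _ => a) = a := by
  simp [prodExp, ← Finset.sum_mul, sum_prodWt]

lemma prodExp_add (p : ι → ℝ) (f g : Finset ι → ℝ) :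
    prodExp p (fun F => f F + g F) = prodExp p f + prodExp p g := by
  simp [prodExp, mul_add, Finset.sum_add_distrib]

lemma prodExp_const_mul (p : ι → ℝ) (a : ℝ) (f : Finset ι → ℝ) :
    prodExp p (fun F => a * f F) = a * prodExp p f := by
  simp only [prodExp, Finset.mul_sum]
  exact Finset.sum_congr rfl fun F _ => by ring

lemma prodExp_mono {p : ι → ℝ} (h0 : ∀ c, 0 ≤ p c) (h1 : ∀ c, p c ≤ 1) {f g : Finset ι → ℝ}
    (h : ∀ F, f F ≤ g F) : prodExp p f ≤ prodExp p g :=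
  Finset.sum_le_sum fun F _ => mul_le_mul_of_nonneg_left (h F) (prodWt_nonneg h0 h1 F)

lemma sum_mem_eq_sum_not_mem_insert {R : Finset ι → ℝ} {c : ι}
    (hR : ∀ F, R (insert c F) = R F) (f : Finset ι → ℝ) :
    ∑ F with c ∈ F, R F * f F = ∑ F with c ∉ F, R F * f (insert c F) := by
  refine Finset.sum_nbij' (fun F => F.erase c) (fun F => insert c F) ?_ ?_ ?_ ?_ ?_
  · simp
  · simp
  · intro F hF
    exact Finset.insert_erase (Finset.mem_filter.1 hF).2
  · intro F hF
    exact Finset.erase_insert (Finset.mem_filter.1 hF).2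
  · intro F hF
    rw [← hR (F.erase c), Finset.insert_erase (Finset.mem_filter.1 hF).2]

/-- Russo's formula along a line of Poisson intensities. -/
lemma hasDerivAt_prodExp (u v : ι → ℝ) (f : Finset ι → ℝ) (t : ℝ) :
    HasDerivAt (fun t : ℝ => prodExp (fun c => 1 - Real.exp (-(u c + t * v c))) f)
      (prodExp (fun c => 1 - Real.exp (-(u c + t * v c)))
        fun F => ∑ c, v c * (f (insert c F) - f F)) t := by
  set φ : ι → Finset ι → ℝ := fun c F =>
    if c ∈ F then 1 - Real.exp (-(u c + t * v c)) else 1 - (1 - Real.exp (-(u c + t * v c))) with hφ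
  have key : ∀ F : Finset ι, HasDerivAt
      (fun t : ℝ => prodWt (fun c => 1 - Real.exp (-(u c + t * v c))) F)
      (∑ c, (∏ j ∈ Finset.univ.erase c, φ j F) *
        ((if c ∈ F then 1 else -1) * (v c * Real.exp (-(u c + t * v c))))) t := by
    intro F
    have hexp : ∀ c, HasDerivAt (fun t : ℝ => Real.exp (-(u c + t * v c)))
        (-(v c * Real.exp (-(u c + t * v c)))) t := by
      intro c
      have h1 : HasDerivAt (fun t : ℝ => -(u c + t * v c)) (-(v c)) t := by
        simpa using (((hasDerivAt_id t).mul_const (v c)).const_add (u c)).fun_neg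
      convert h1.exp using 1
      ring
    have h := HasDerivAt.fun_finsetProd (u := Finset.univ)
      (f := fun c (t : ℝ) => if c ∈ F then 1 - Real.exp (-(u c + t * v c))
        else 1 - (1 - Real.exp (-(u c + t * v c))))
      (f' := fun c => (if c ∈ F then 1 else -1) * (v c * Real.exp (-(u c + t * v c))))
      (x := t) (fun c _ => by
        split_ifs
        · simpa using (hexp c).const_sub 1
        · simpa using ((hexp c).const_sub 1).const_sub 1)
    simpa only [prodWt, hφ, smul_eq_mul] using h
  have h := HasDerivAt.fun_sum (u := Finset.univ) fun F _ => (key F).mul_const (f F)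
  unfold prodExp
  refine h.congr_deriv (Eq.symm ?_)
  simp only [Finset.mul_sum, Finset.sum_mul]
  rw [Finset.sum_comm, Finset.sum_comm (s := Finset.univ (α := Finset ι))]
  refine Finset.sum_congr rfl fun c _ => ?_
  have hw : ∀ F : Finset ι, prodWt (fun c => 1 - Real.exp (-(u c + t * v c))) F =
      φ c F * ∏ j ∈ Finset.univ.erase c, φ j F := fun F =>
    (Finset.mul_prod_erase Finset.univ (fun j => φ j F) (Finset.mem_univ c)).symm
  rw [← Finset.sum_filter_add_sum_filter_not Finset.univ (fun F => c ∈ F),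
    ← Finset.sum_filter_add_sum_filter_not Finset.univ (fun F => c ∈ F)
      (fun F => (∏ j ∈ Finset.univ.erase c, φ j F) *
        ((if c ∈ F then 1 else -1) * (v c * Real.exp (-(u c + t * v c)))) * f F)]
  have e1 : ∑ F with c ∈ F, prodWt (fun c => 1 - Real.exp (-(u c + t * v c))) F *
      (v c * (f (insert c F) - f F)) = 0 :=
    Finset.sum_eq_zero fun F hF => by
      rw [Finset.insert_eq_of_mem (Finset.mem_filter.1 hF).2]; ring
  have e2 : ∑ F with c ∈ F, (∏ j ∈ Finset.univ.erase c, φ j F) *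
        ((if c ∈ F then 1 else -1) * (v c * Real.exp (-(u c + t * v c)))) * f F =
      (v c * Real.exp (-(u c + t * v c))) *
        ∑ F with c ∉ F, (∏ j ∈ Finset.univ.erase c, φ j F) * f (insert c F) := by
    rw [← sum_mem_eq_sum_not_mem_insert fun F => Finset.prod_congr rfl fun j hj => by
      simp [hφ, (Finset.mem_erase.1 hj).1], Finset.mul_sum]
    refine Finset.sum_congr rfl fun F hF => ?_
    rw [if_pos (Finset.mem_filter.1 hF).2]; ring
  rw [e1, e2, zero_add, Finset.mul_sum, ← Finset.sum_add_distrib]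
  refine Finset.sum_congr rfl fun F hF => ?_
  have hc : c ∉ F := (Finset.mem_filter.1 hF).2
  rw [hw, if_neg hc, show φ c F = Real.exp (-(u c + t * v c)) by simp [hφ, hc]]
  ring

/-- Moving the intensities from `u` to `u + v` lowers the expectation of `f` by at most `e`
if the corresponding drift of `f` is everywhere at least `-e`. -/
lemma prodExp_interpolate {u v : ι → ℝ} {f : Finset ι → ℝ} {e : ℝ}
    (hu : ∀ c, 0 ≤ u c) (huv : ∀ c, 0 ≤ u c + v c)
    (h : ∀ F, -e ≤ ∑ c, v c * (f (insert c F) - f F)) :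
    prodExp (fun c => 1 - Real.exp (-u c)) f - e ≤
      prodExp (fun c => 1 - Real.exp (-(u c + v c))) f := by
  set g : ℝ → ℝ := fun t => prodExp (fun c => 1 - Real.exp (-(u c + t * v c))) f with hg
  have hd : ∀ t, HasDerivAt g _ t := hasDerivAt_prodExp u v f
  have hdiff : Differentiable ℝ g := fun t => (hd t).differentiableAt
  have := (convex_Icc (0 : ℝ) 1).mul_sub_le_image_sub_of_le_deriv (f := g) (C := -e)
    hdiff.continuous.continuousOn hdiff.differentiableOn (by
      intro t ht
      rw [interior_Icc] at ht
      rw [(hd t).deriv]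
      have hpos : ∀ c, 0 ≤ u c + t * v c := fun c => by
        nlinarith [hu c, huv c, ht.1, ht.2]
      calc -e = prodExp (fun c => 1 - Real.exp (-(u c + t * v c))) (fun _ => -e) :=
            (prodExp_const _ _).symm
        _ ≤ _ := prodExp_mono
            (fun c => by linarith [Real.exp_le_one_iff.2 (neg_nonpos.2 (hpos c))])
            (fun c => by linarith [Real.exp_pos (-(u c + t * v c))]) h)
    0 (by simp) 1 (by simp) zero_le_one
  simp only [hg, zero_mul, add_zero, one_mul] at this
  linarith

end ProductMeasure

/-! ### Replica bound for general constraint satisfaction problems -/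

section Replica

variable {ι X : Type*} [DecidableEq ι] [Fintype X]

/-- The number of `x` satisfying all the constraints indexed by `F`. -/
def solCount (s : ι → X → Prop) (F : Finset ι) : ℕ :=
  (Finset.univ.filter fun x : X => ∀ c ∈ F, s c x).card

lemma solCount_insert_add (s : ι → X → Prop) (F : Finset ι) (c : ι) :
    solCount s (insert c F) +
      (Finset.univ.filter fun x : X => (∀ d ∈ F, s d x) ∧ ¬ s c x).card = solCount s F := by
  rw [solCount, solCount, ← Finset.card_filter_add_card_filter_not (s := Finset.univ.filter
    fun x : X => ∀ d ∈ F, s d x) (fun x => s c x), Finset.filter_filter, Finset.filter_filter]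
  congr 2
  ext x
  simp [and_comm]

lemma card_filter_pow (A B : X → Prop) [DecidablePred A] [DecidablePred B] (r : ℕ) :
    ((Finset.univ.filter fun x : X => A x ∧ B x).card : ℝ) ^ r =
      ∑ xs ∈ Fintype.piFinset (fun _ : Fin r => Finset.univ.filter A),
        if ∀ j, B (xs j) then 1 else 0 := by
  rw [Finset.sum_boole, ← Nat.cast_pow, ← Fintype.card_piFinset_const]
  congr 2
  ext xs
  simp [Fintype.mem_piFinset, forall_and]

variable [Fintype ι]

/-- If the signed mass of the constraints violated by any tuple of assignments is at most `e`,
then the corresponding drift of `log (1 + Z)` is bounded below. -/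
lemma drift_log_one_add_solCount {s : ι → X → Prop} {v : ι → ℝ} {e : ℝ}
    (h : ∀ (r : ℕ) (xs : Fin (r + 1) → X), (∑ c, v c * if ∀ j, ¬ s c (xs j) then 1 else 0) ≤ e)
    (F : Finset ι) :
    -(e * Real.log (1 + solCount s F)) ≤ ∑ c, v c *
      (Real.log (1 + solCount s (insert c F)) - Real.log (1 + solCount s F)) := by
  set z : ℝ := (solCount s F : ℝ) with hz
  have hz0 : 0 ≤ z := Nat.cast_nonneg _
  set b : ι → ℝ := fun c =>
    ((Finset.univ.filter fun x : X => (∀ d ∈ F, s d x) ∧ ¬ s c x).card : ℝ) with hb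
  have hins : ∀ c, (solCount s (insert c F) : ℝ) + b c = z := fun c => by
    rw [hz, ← solCount_insert_add s F c, Nat.cast_add]
    simp only [hb]
    congr!
  have hb0 : ∀ c, 0 ≤ b c := fun c => Nat.cast_nonneg _
  have hbz : ∀ c, b c ≤ z := fun c => by
    linarith [hins c, (Nat.cast_nonneg (solCount s (insert c F)) : (0 : ℝ) ≤ _)]
  have hser : ∀ y : ℝ, 0 ≤ y → y ≤ z →
      HasSum (fun r : ℕ => (y / (1 + z)) ^ (r + 1) / (r + 1)) (-Real.log (1 - y / (1 + z))) := by
    intro y h0 h1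
    refine Real.hasSum_pow_div_log_of_abs_lt_one ?_
    rw [abs_of_nonneg (by positivity), div_lt_one (by positivity)]
    linarith
  have hlog : ∀ c, Real.log (1 + solCount s (insert c F)) - Real.log (1 + z) =
      Real.log (1 - b c / (1 + z)) := by
    intro c
    rw [← Real.log_div (by positivity) (by positivity)]
    congr 1
    field_simp
    linarith [hins c]
  have hL : HasSum (fun r : ℕ => ∑ c, v c * ((b c / (1 + z)) ^ (r + 1) / (r + 1)))
      (∑ c, v c * -Real.log (1 - b c / (1 + z))) :=
    hasSum_sum fun c _ => (hser (b c) (hb0 c) (hbz c)).mul_left (v c)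
  have hR := (hser z hz0 le_rfl).mul_left e
  have hlogz : -Real.log (1 - z / (1 + z)) = Real.log (1 + z) := by
    rw [← Real.log_inv]
    congr 1
    field_simp
    ring
  have key := hasSum_le (fun r => ?_) hL hR
  · simp only [mul_neg, Finset.sum_neg_distrib] at key
    simp only [hlog]
    rw [← mul_neg, hlogz] at key
    linarith
  · have hpow : ∑ c, v c * b c ^ (r + 1) ≤ e * z ^ (r + 1) := by
      have hzp : z ^ (r + 1) = ((Fintype.piFinset (fun _ : Fin (r + 1) =>
          Finset.univ.filter fun x : X => ∀ d ∈ F, s d x)).card : ℝ) := by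
        rw [Fintype.card_piFinset_const, hz, solCount, Nat.cast_pow]
        congr!
      have hbp : ∀ c, b c ^ (r + 1) = _ := fun c =>
        card_filter_pow (fun x => ∀ d ∈ F, s d x) (fun x => ¬ s c x) (r + 1)
      simp only [hbp, Finset.mul_sum]
      rw [Finset.sum_comm, hzp, mul_comm, ← nsmul_eq_mul]
      exact Finset.sum_le_card_nsmul _ _ _ fun xs _ => h r xs
    have e1 : ∑ c, v c * ((b c / (1 + z)) ^ (r + 1) / ((r : ℝ) + 1)) =
        (∑ c, v c * b c ^ (r + 1)) * (((1 + z) ^ (r + 1))⁻¹ * ((r : ℝ) + 1)⁻¹) := by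
      rw [Finset.sum_mul]
      refine Finset.sum_congr rfl fun c _ => ?_
      rw [div_pow]; ring
    rw [e1, div_pow]
    calc _ ≤ e * z ^ (r + 1) * (((1 + z) ^ (r + 1))⁻¹ * ((r : ℝ) + 1)⁻¹) :=
          mul_le_mul_of_nonneg_right hpow (by positivity)
      _ = _ := by ring

end Replica

section Comparison

variable {ι : Type*} [Fintype ι] [DecidableEq ι]

lemma one_sub_exp_neg_log {p : ℝ} (hp : p < 1) : 1 - Real.exp (-(-Real.log (1 - p))) = p := by
  rw [neg_neg, Real.exp_log (by linarith)]; ring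

/-- Expectations of increasing functions increase with the selection probability. -/
lemma prodExp_const_mono {p q : ℝ} (hp : 0 ≤ p) (hpq : p ≤ q) (hq : q < 1) {f : Finset ι → ℝ}
    (hf : ∀ c F, f F ≤ f (insert c F)) :
    prodExp (fun _ => p) f ≤ prodExp (fun _ => q) f := by
  have hlog : Real.log (1 - q) ≤ Real.log (1 - p) :=
    Real.log_le_log (by linarith) (by linarith)
  have hlogp : Real.log (1 - p) ≤ 0 := Real.log_nonpos (by linarith) (by linarith)
  have h := prodExp_interpolate (u := fun _ : ι => -Real.log (1 - p))
    (v := fun _ => Real.log (1 - p) - Real.log (1 - q)) (f := f) (e := 0)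
    (fun _ => by linarith) (fun _ => by linarith)
    (fun F => by
      rw [neg_zero]
      exact Finset.sum_nonneg fun c _ => mul_nonneg (by linarith) (by linarith [hf c F]))
  have e : -Real.log (1 - p) + (Real.log (1 - p) - Real.log (1 - q)) = -Real.log (1 - q) := by ring
  simpa only [e, one_sub_exp_neg_log hq, one_sub_exp_neg_log (hpq.trans_lt hq), sub_zero] using h

/-- A bounded function has nearly the same expectation under nearby selection probabilities. -/
lemma abs_prodExp_const_sub_le {p q B : ℝ} (hp : 0 < p) (hp1 : p < 1) {f : Finset ι → ℝ}
    (hf : ∀ F, |f F| ≤ B) :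
    |prodExp (fun _ => q) f - prodExp (fun _ => p) f| ≤
      B * √(Real.exp (Fintype.card ι * ((q - p) ^ 2 / (p * (1 - p)))) - 1) := by
  have hB : 0 ≤ B := (abs_nonneg _).trans (hf ∅)
  have hp1' : 0 < 1 - p := by linarith
  set w : ℝ → Finset ι → ℝ := fun p F => prodWt (fun _ => p) F with hw
  have hwp : ∀ F, 0 < w p F := fun F => by rw [hw]; simp only [prodWt_const]; positivity
  have h1 : |prodExp (fun _ => q) f - prodExp (fun _ => p) f| ≤ B * ∑ F, |w q F - w p F| := by
    rw [prodExp, prodExp, ← Finset.sum_sub_distrib, Finset.mul_sum]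
    refine (Finset.abs_sum_le_sum_abs _ _).trans (Finset.sum_le_sum fun F _ => ?_)
    rw [← sub_mul, abs_mul, mul_comm]
    exact mul_le_mul_of_nonneg_right (hf F) (abs_nonneg _)
  have hsq : ∑ F, w q F ^ 2 / w p F = (1 + (q - p) ^ 2 / (p * (1 - p))) ^ Fintype.card ι := by
    have : ∀ F : Finset ι, w q F ^ 2 / w p F =
        (q ^ 2 / p) ^ F.card * ((1 - q) ^ 2 / (1 - p)) ^ (Fintype.card ι - F.card) := fun F => by
      simp only [hw, prodWt_const, div_pow, mul_pow]
      rw [← pow_mul, ← pow_mul, ← pow_mul, ← pow_mul]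
      field_simp
      ring
    simp only [this]
    rw [Fintype.sum_pow_mul_eq_add_pow]
    congr 1
    field_simp
    ring
  have hchi : ∑ F, (w q F - w p F) ^ 2 / w p F =
      (1 + (q - p) ^ 2 / (p * (1 - p))) ^ Fintype.card ι - 1 := by
    have : ∀ F : Finset ι, (w q F - w p F) ^ 2 / w p F =
        w q F ^ 2 / w p F - 2 * w q F + w p F := fun F => by
      have := (hwp F).ne'
      field_simp
      ring
    simp only [this, Finset.sum_add_distrib, Finset.sum_sub_distrib, hsq, ← Finset.mul_sum]
    simp only [hw, sum_prodWt]
    ring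
  have hcs : (∑ F, |w q F - w p F|) ^ 2 ≤
      (∑ F, (w q F - w p F) ^ 2 / w p F) * ∑ F, w p F := by
    refine Finset.sum_sq_le_sum_mul_sum_of_sq_le_mul _
      (fun F _ => div_nonneg (sq_nonneg _) (hwp F).le) (fun F _ => (hwp F).le) fun F _ => ?_
    rw [div_mul_cancel₀ _ (hwp F).ne', sq_abs]
  rw [show ∑ F, w p F = 1 from sum_prodWt _, mul_one, hchi] at hcs
  refine h1.trans (mul_le_mul_of_nonneg_left (Real.le_sqrt_of_sq_le (hcs.trans ?_)) hB)
  gcongr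
  rw [Real.exp_nat_mul]
  gcongr
  linarith [Real.add_one_le_exp ((q - p) ^ 2 / (p * (1 - p)))]

end Comparison

/-! ### Counting clauses -/

section Counting

variable {n k : ℕ}

/-- The clause on the variables of `S` with signs given by `ε`. -/
def signedClause (S : Finset (Fin n)) (ε : Fin n → Bool) (hS : S.card = k) : Clause n k :=
  ⟨S.image fun i => (i, ε i), by
    have h1 : (S.image fun i => (i, ε i)).card = k := by
      rw [Finset.card_image_of_injective _ fun i j h => (Prod.mk.inj h).1, hS]
    refine ⟨h1, ?_⟩
    simp [Finset.image_image, Function.comp_def, hS]⟩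

lemma Clause.eq_of_mem (c : Clause n k) {i : Fin n} {a b : Bool} (ha : (i, a) ∈ c.1)
    (hb : (i, b) ∈ c.1) : a = b := by
  have hinj : Set.InjOn Prod.fst (c.1 : Set (Fin n × Bool)) :=
    Finset.card_image_iff.1 (c.2.2.trans c.2.1.symm)
  exact (Prod.mk.inj (hinj ha hb rfl)).2

lemma signedClause_image_fst (c : Clause n k) (ε : Fin n → Bool)
    (h : ∀ l ∈ c.1, ε l.1 = l.2) : signedClause (c.1.image Prod.fst) ε c.2.2 = c := by
  refine Subtype.ext ?_
  simp only [signedClause, Finset.image_image]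
  conv_rhs => rw [← Finset.image_id (s := c.1)]
  refine Finset.image_congr fun l hl => ?_
  simp [h l hl]

lemma card_clause (n k : ℕ) : Fintype.card (Clause n k) = n.choose k * 2 ^ k := by
  have h : ((Finset.powersetCard k (Finset.univ : Finset (Fin n))).sigma
      fun S => S.powerset).card = n.choose k * 2 ^ k := by
    rw [Finset.card_sigma, Finset.sum_const_nat (m := 2 ^ k)]
    · simp
    · intro S hS
      rw [Finset.card_powerset, (Finset.mem_powersetCard.1 hS).2]
  rw [← h, ← Finset.card_univ]
  symm
  refine Finset.card_bij'
    (fun p hp => signedClause p.1 (fun i => decide (i ∈ p.2))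
      (Finset.mem_powersetCard.1 (Finset.mem_sigma.1 hp).1).2)
    (fun c _ => ⟨c.1.image Prod.fst, Finset.univ.filter fun i => (i, true) ∈ c.1⟩) ?_ ?_ ?_ ?_
  · simp
  · intro c _
    simp only [Finset.mem_sigma, Finset.mem_powersetCard, Finset.subset_univ, true_and,
      Finset.mem_powerset]
    exact ⟨c.2.2, fun i hi => Finset.mem_image.2 ⟨(i, true), by simpa using hi, rfl⟩⟩
  · rintro ⟨S, T⟩ hp
    have hT : T ⊆ S := Finset.mem_powerset.1 (Finset.mem_sigma.1 hp).2
    have e1 : (signedClause S (fun i => decide (i ∈ T))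
        (Finset.mem_powersetCard.1 (Finset.mem_sigma.1 hp).1).2).1.image Prod.fst = S := by
      simp [signedClause, Finset.image_image, Function.comp_def]
    have e2 : (Finset.univ.filter fun i => (i, true) ∈ (signedClause S (fun i => decide (i ∈ T))
        (Finset.mem_powersetCard.1 (Finset.mem_sigma.1 hp).1).2).1) = T := by
      ext i
      simpa [signedClause] using fun h => hT h
    simp only [e1, e2]
  · intro c _
    refine signedClause_image_fst c _ fun l hl => ?_
    obtain ⟨i, b⟩ := l
    cases b
    · have : (i, true) ∉ c.1 := fun h => Bool.noConfusion (c.eq_of_mem hl h)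
      simpa using this
    · simpa using hl

lemma not_sat_iff (x : Fin n → Bool) (c : Clause n k) :
    ¬ sat x c ↔ ∀ l ∈ c.1, (!x l.1) = l.2 := by
  simp only [sat, not_exists, not_and]
  refine forall₂_congr fun l _ => ?_
  cases x l.1 <;> cases l.2 <;> simp

/-- The clauses violated by all of a tuple of assignments correspond to the `k`-subsets of the
variables on which they all agree. -/
lemma card_violated {r : ℕ} (xs : Fin (r + 1) → Fin n → Bool) :
    (Finset.univ.filter fun c : Clause n k => ∀ j, ¬ sat (xs j) c).card =
      (Finset.univ.filter fun i => ∀ j, xs j i = xs 0 i).card.choose k := by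
  rw [← Finset.card_powersetCard]
  symm
  refine Finset.card_bij'
    (fun S hS => signedClause S (fun i => !xs 0 i) (Finset.mem_powersetCard.1 hS).2)
    (fun c _ => c.1.image Prod.fst) ?_ ?_ ?_ ?_
  · intro S hS
    simp only [Finset.mem_filter, Finset.mem_univ, true_and, not_sat_iff]
    intro j l hl
    obtain ⟨i, hi, rfl⟩ := Finset.mem_image.1 hl
    have := (Finset.mem_filter.1 ((Finset.mem_powersetCard.1 hS).1 hi)).2 j
    simp [this]
  · intro c hc
    have hc := fun j => (not_sat_iff _ _).1 ((Finset.mem_filter.1 hc).2 j)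
    refine Finset.mem_powersetCard.2 ⟨fun i hi => ?_, c.2.2⟩
    obtain ⟨l, hl, rfl⟩ := Finset.mem_image.1 hi
    refine Finset.mem_filter.2 ⟨Finset.mem_univ _, fun j => ?_⟩
    exact Bool.not_inj ((hc j l hl).trans (hc 0 l hl).symm)
  · intro S hS
    simp [signedClause, Finset.image_image, Function.comp_def]
  · intro c hc
    exact signedClause_image_fst c _ ((not_sat_iff _ _).1 ((Finset.mem_filter.1 hc).2 0))

lemma sum_violated {r : ℕ} (xs : Fin (r + 1) → Fin n → Bool) (a : ℝ) :
    (∑ c : Clause n k, a * if ∀ j, ¬ sat (xs j) c then 1 else 0) =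
      a * ((Finset.univ.filter fun i => ∀ j, xs j i = xs 0 i).card.choose k : ℝ) := by
  rw [← Finset.mul_sum, Finset.sum_boole, card_violated]

end Counting

/-! ### Binomial estimates -/

section Estimates

variable {k : ℕ}

lemma choose_div_choose_eq {b m : ℕ} (hkm : k ≤ m) :
    (b.choose k : ℝ) / m.choose k = b.descFactorial k / m.descFactorial k := by
  rw [Nat.descFactorial_eq_factorial_mul_choose, Nat.descFactorial_eq_factorial_mul_choose]
  have h1 : (m.choose k : ℝ) ≠ 0 := by exact_mod_cast (Nat.choose_pos hkm).ne'
  have h2 : (k.factorial : ℝ) ≠ 0 := by exact_mod_cast k.factorial_ne_zero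
  push_cast
  field_simp

lemma choose_div_choose_le {b m : ℕ} (hbm : b ≤ m) (hkm : k ≤ m) :
    (b.choose k : ℝ) / m.choose k ≤ ((b : ℝ) / m) ^ k := by
  rw [choose_div_choose_eq hkm]
  induction k with
  | zero => simp
  | succ j ih =>
    have hjm : j < m := hkm
    rw [Nat.descFactorial_succ, Nat.descFactorial_succ, pow_succ', Nat.cast_mul, Nat.cast_mul,
      mul_div_mul_comm]
    refine mul_le_mul ?_ (ih hjm.le) (by positivity) (by positivity)
    rcases le_total b j with h | h
    · rw [Nat.sub_eq_zero_of_le h]; simp; positivity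
    · have hm : (0 : ℝ) < (m - j : ℕ) := by exact_mod_cast Nat.sub_pos_of_lt hjm
      have hm' : (0 : ℝ) < m := by exact_mod_cast (Nat.zero_le j).trans_lt hjm
      rw [div_le_div_iff₀ hm hm', Nat.cast_sub h, Nat.cast_sub hjm.le]
      have : (b : ℝ) ≤ m := by exact_mod_cast hbm
      nlinarith [(Nat.cast_nonneg j : (0 : ℝ) ≤ j)]

lemma pow_sub_le_choose_div_choose {b m : ℕ} (hk : 1 ≤ k) (hkm : k ≤ m) :
    ((b : ℝ) ^ k - k ^ 2 * (b : ℝ) ^ (k - 1)) / (m : ℝ) ^ k ≤ (b.choose k : ℝ) / m.choose k := by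
  have hm : (0 : ℝ) < m := by exact_mod_cast (by omega : 0 < m)
  have hdm : (0 : ℝ) < m.descFactorial k := by exact_mod_cast Nat.descFactorial_pos.2 hkm
  have hdm' : (m.descFactorial k : ℝ) ≤ (m : ℝ) ^ k := by
    exact_mod_cast Nat.descFactorial_le_pow m k
  have hnum : (b : ℝ) ^ k - k ^ 2 * (b : ℝ) ^ (k - 1) ≤ b.descFactorial k := by
    obtain ⟨j, rfl⟩ : ∃ j, k = j + 1 := ⟨k - 1, by omega⟩
    rcases lt_or_ge b (j + 1) with hb | hb
    · have hb' : (b : ℝ) ≤ (j + 1 : ℕ) := by exact_mod_cast hb.le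
      have h1 : (1 : ℝ) ≤ (j + 1 : ℕ) := by exact_mod_cast hk
      calc (b : ℝ) ^ (j + 1) - ((j + 1 : ℕ) : ℝ) ^ 2 * (b : ℝ) ^ (j + 1 - 1)
          = (b : ℝ) ^ j * (b - ((j + 1 : ℕ) : ℝ) ^ 2) := by rw [Nat.add_sub_cancel]; ring
        _ ≤ 0 := mul_nonpos_of_nonneg_of_nonpos (by positivity) (by nlinarith)
        _ ≤ _ := Nat.cast_nonneg _
    · have hb0 : (0 : ℝ) < b := by exact_mod_cast (by omega : 0 < b)
      have hb' : ((j + 1 : ℕ) : ℝ) ≤ b := by exact_mod_cast hb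
      have h1 : ((b : ℝ) - (j + 1 : ℕ)) ^ (j + 1) ≤ b.descFactorial (j + 1) := by
        rw [← Nat.cast_sub hb]
        exact_mod_cast (Nat.pow_le_pow_left (by omega) _).trans
          (Nat.pow_sub_le_descFactorial b (j + 1))
      refine le_trans ?_ h1
      have h2 := one_add_mul_le_pow (a := -((j + 1 : ℕ) : ℝ) / b)
        (by rw [le_div_iff₀ hb0]; linarith) (j + 1)
      calc (b : ℝ) ^ (j + 1) - ((j + 1 : ℕ) : ℝ) ^ 2 * (b : ℝ) ^ (j + 1 - 1)
          = (b : ℝ) ^ (j + 1) * (1 + ((j + 1 : ℕ) : ℝ) * (-((j + 1 : ℕ) : ℝ) / b)) := by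
            rw [Nat.add_sub_cancel]; field_simp; ring
        _ ≤ (b : ℝ) ^ (j + 1) * (1 + -((j + 1 : ℕ) : ℝ) / b) ^ (j + 1) := by gcongr
        _ = _ := by rw [← mul_pow]; congr 1; field_simp; ring
  rw [choose_div_choose_eq hkm]
  calc _ ≤ (b.descFactorial k : ℝ) / (m : ℝ) ^ k := by gcongr
    _ ≤ _ := by gcongr

lemma pow_le_choose_div_choose_add {b m : ℕ} (hbm : b ≤ m) (hk : 2 ≤ k) (hkm : k ≤ m) {δ : ℝ}
    (hδ : 0 < δ) (hδ1 : δ ≤ 1) :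
    (1 + δ / 2) * ((b : ℝ) / m) ^ k ≤
      (1 + δ) * ((b.choose k : ℝ) / m.choose k) + 8 * (k : ℝ) ^ 4 / (δ * (m : ℝ) ^ 2) := by
  have hm : (0 : ℝ) < m := by exact_mod_cast (by omega : 0 < m)
  have hbm' : (b : ℝ) ≤ m := by exact_mod_cast hbm
  have hb0 : (0 : ℝ) ≤ b := Nat.cast_nonneg b
  have h := pow_sub_le_choose_div_choose (b := b) (by omega : 1 ≤ k) hkm
  have h' := mul_le_mul_of_nonneg_left h (by linarith : 0 ≤ 1 + δ)
  refine le_trans ?_ (add_le_add_left h' _)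
  obtain ⟨j, rfl⟩ : ∃ j, k = j + 2 := ⟨k - 2, by omega⟩
  set K : ℝ := ((j + 2 : ℕ) : ℝ) with hK
  set y : ℝ := (b : ℝ) / m with hy
  have hy0 : 0 ≤ y := by positivity
  have hy1 : y ≤ 1 := (div_le_one hm).2 hbm'
  have e : ((b : ℝ) ^ (j + 2) - K ^ 2 * (b : ℝ) ^ (j + 2 - 1)) / (m : ℝ) ^ (j + 2) =
      y ^ j * (y ^ 2 - K ^ 2 * (y / m)) := by
    rw [hy, show j + 2 - 1 = j + 1 by omega, div_pow, div_pow, pow_add (m : ℝ)]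
    field_simp
    ring
  rw [e]
  have hyj0 : 0 ≤ y ^ j := by positivity
  have hyj1 : y ^ j ≤ 1 := pow_le_one₀ hy0 hy1
  have hin : (1 + δ / 2) * y ^ 2 - (1 + δ) * (y ^ 2 - K ^ 2 * (y / m)) ≤
      8 * K ^ 4 / (δ * (m : ℝ) ^ 2) := by
    have e2 : y ^ 2 = (b : ℝ) ^ 2 / (m : ℝ) ^ 2 := by rw [hy, div_pow]
    have e3 : y / m = (b : ℝ) / (m : ℝ) ^ 2 := by rw [hy]; field_simp
    rw [e2, e3, show 8 * K ^ 4 / (δ * (m : ℝ) ^ 2) = 8 * K ^ 4 / δ / (m : ℝ) ^ 2 by field_simp]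
    rw [show (1 + δ / 2) * ((b : ℝ) ^ 2 / (m : ℝ) ^ 2) -
        (1 + δ) * ((b : ℝ) ^ 2 / (m : ℝ) ^ 2 - K ^ 2 * ((b : ℝ) / (m : ℝ) ^ 2)) =
        ((1 + δ) * K ^ 2 * b - δ / 2 * (b : ℝ) ^ 2) / (m : ℝ) ^ 2 by ring]
    gcongr
    rw [le_div_iff₀ hδ]
    have h2 : (1 + δ) * K ^ 2 * b * δ ≤ 2 * K ^ 2 * b * δ := by gcongr; linarith
    nlinarith [sq_nonneg (δ * b - 2 * K ^ 2), sq_nonneg (K ^ 2)]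
  have hpos : 0 ≤ 8 * K ^ 4 / (δ * (m : ℝ) ^ 2) := by positivity
  have := mul_le_mul_of_nonneg_left hin hyj0
  have h3 := mul_le_mul_of_nonneg_right hyj1 hpos
  rw [pow_add]
  nlinarith

lemma pow_div_add_le {n₁ n₂ a₁ a₂ : ℝ} (h₁ : 0 < n₁) (h₂ : 0 < n₂) (ha₁ : 0 ≤ a₁) (ha₂ : 0 ≤ a₂)
    (k : ℕ) : (n₁ + n₂) * ((a₁ + a₂) / (n₁ + n₂)) ^ k ≤
      n₁ * (a₁ / n₁) ^ k + n₂ * (a₂ / n₂) ^ k := by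
  have hy₁ : a₁ / n₁ ∈ Set.Ici (0 : ℝ) := Set.mem_Ici.2 (by positivity)
  have hy₂ : a₂ / n₂ ∈ Set.Ici (0 : ℝ) := Set.mem_Ici.2 (by positivity)
  have h := (convexOn_pow k).2 hy₁ hy₂ (show 0 ≤ n₁ / (n₁ + n₂) by positivity)
    (show 0 ≤ n₂ / (n₁ + n₂) by positivity) (by field_simp)
  simp only [smul_eq_mul] at h
  have e : n₁ / (n₁ + n₂) * (a₁ / n₁) + n₂ / (n₁ + n₂) * (a₂ / n₂) = (a₁ + a₂) / (n₁ + n₂) := by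
    field_simp
  rw [e] at h
  calc _ ≤ (n₁ + n₂) * (n₁ / (n₁ + n₂) * (a₁ / n₁) ^ k + n₂ / (n₁ + n₂) * (a₂ / n₂) ^ k) := by
        gcongr
    _ = _ := by field_simp

end Estimates

/-! ### Interpolation between a formula and two independent formulas -/

section Interpolation

variable {k n n₁ n₂ : ℕ}

/-- The probability with which each clause is selected. -/
def clauseProb (k n : ℕ) (α : ℝ) : ℝ := α * n / (Fintype.card (Clause n k) : ℝ)

/-- The expectation of `log (1 + Z)`. -/
def expLog (k n : ℕ) (α : ℝ) : ℝ :=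
  prodExp (fun _ : Clause n k => clauseProb k n α) fun F => Real.log (1 + Z F)

lemma wt_eq_prodWt (α : ℝ) (F : Finset (Clause n k)) :
    wt n k α F = prodWt (fun _ => clauseProb k n α) F :=
  (prodWt_const _ F).symm

lemma Pn_zero_eq (α : ℝ) :
    Pn k n α 0 = prodExp (fun _ : Clause n k => clauseProb k n α)
      fun F => if Z F = 0 then 1 else 0 := by
  refine Finset.sum_congr rfl fun F _ => ?_
  rw [wt_eq_prodWt, mul_zero, Real.rpow_zero]
  simp [Nat.cast_lt_one]

lemma Z_le (F : Finset (Clause n k)) : Z F ≤ 2 ^ n := by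
  refine (Finset.card_le_univ _).trans ?_
  simp

lemma log_one_add_le {z : ℝ} (h0 : 0 ≤ z) (h : z ≤ 2 ^ n) :
    Real.log (1 + z) ≤ (n + 1) * Real.log 2 := by
  have h1 : (1 : ℝ) ≤ 2 ^ n := one_le_pow₀ (by norm_num)
  have h2 : 1 + z ≤ 2 ^ (n + 1) := by rw [pow_succ]; linarith
  calc Real.log (1 + z) ≤ Real.log (2 ^ (n + 1)) := Real.log_le_log (by linarith) h2
    _ = _ := by rw [Real.log_pow]; push_cast; ring

lemma log_one_add_Z_le (F : Finset (Clause n k)) :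
    Real.log (1 + Z F) ≤ (n + 1) * Real.log 2 :=
  log_one_add_le (Nat.cast_nonneg _) (by exact_mod_cast Z_le F)

lemma log_one_add_Z_nonneg (F : Finset (Clause n k)) : 0 ≤ Real.log (1 + Z F) :=
  Real.log_nonneg (by linarith [(Nat.cast_nonneg (Z F) : (0 : ℝ) ≤ _)])

/-- Satisfaction of a clause on all variables, on the first block, or on the second block. -/
def blockSat (k n₁ n₂ : ℕ) : Clause (n₁ + n₂) k ⊕ (Clause n₁ k ⊕ Clause n₂ k) →
    (Fin (n₁ + n₂) → Bool) → Prop :=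
  Sum.elim (fun c x => sat x c) (Sum.elim (fun c x => sat (fun i => x (Fin.castAdd n₂ i)) c)
    fun c x => sat (fun i => x (Fin.natAdd n₁ i)) c)

lemma solCount_blockSat_left (F : Finset (Clause (n₁ + n₂) k)) :
    solCount (blockSat k n₁ n₂) (F.disjSum ∅) = Z F := by
  unfold solCount Z
  congr 1
  ext x
  simp [blockSat]

lemma solCount_blockSat_right (F₁ : Finset (Clause n₁ k)) (F₂ : Finset (Clause n₂ k)) :
    solCount (blockSat k n₁ n₂) (Finset.disjSum ∅ (F₁.disjSum F₂)) = Z F₁ * Z F₂ := by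
  unfold solCount Z
  rw [← Finset.card_product]
  symm
  refine Finset.card_equiv (Fin.appendEquiv n₁ n₂) fun x => ?_
  simp [blockSat, Fin.appendEquiv]

lemma card_agree_add {r : ℕ} (xs : Fin (r + 1) → Fin (n₁ + n₂) → Bool) :
    (Finset.univ.filter fun i => ∀ j, xs j i = xs 0 i).card =
      (Finset.univ.filter fun i : Fin n₁ =>
        ∀ j, xs j (Fin.castAdd n₂ i) = xs 0 (Fin.castAdd n₂ i)).card +
      (Finset.univ.filter fun i : Fin n₂ =>
        ∀ j, xs j (Fin.natAdd n₁ i) = xs 0 (Fin.natAdd n₁ i)).card := by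
  simp only [Finset.card_filter]
  rw [Fin.sum_univ_add]

lemma expLog_interpolate {p p₁ p₂ e : ℝ} (hp : 0 ≤ p) (hp₁ : 0 ≤ p₁) (hp₂ : 0 ≤ p₂)
    (hp' : p < 1) (hp₁' : p₁ < 1) (hp₂' : p₂ < 1) (he : 0 ≤ e)
    (h : ∀ a₁ a₂ : ℕ, a₁ ≤ n₁ → a₂ ≤ n₂ → -Real.log (1 - p) * ((a₁ + a₂).choose k : ℝ) ≤
      -Real.log (1 - p₁) * (a₁.choose k : ℝ) + -Real.log (1 - p₂) * (a₂.choose k : ℝ) + e) :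
    (prodExp (fun _ : Clause n₁ k => p₁) fun F₁ => prodExp (fun _ : Clause n₂ k => p₂) fun F₂ =>
        Real.log (1 + Z F₁ * Z F₂)) - e * (((n₁ + n₂ : ℕ) + 1) * Real.log 2) ≤
      prodExp (fun _ : Clause (n₁ + n₂) k => p) fun F => Real.log (1 + Z F) := by
  have hl : ∀ {q : ℝ}, 0 ≤ q → q < 1 → 0 ≤ -Real.log (1 - q) := fun h0 h1 =>
    neg_nonneg.2 (Real.log_nonpos (by linarith) (by linarith))
  have hl0 := hl hp hp'
  have hl1 := hl hp₁ hp₁'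
  have hl2 := hl hp₂ hp₂'
  set l := -Real.log (1 - p) with hl_def
  set l₁ := -Real.log (1 - p₁) with hl₁_def
  set l₂ := -Real.log (1 - p₂) with hl₂_def
  set u : Clause (n₁ + n₂) k ⊕ (Clause n₁ k ⊕ Clause n₂ k) → ℝ :=
    Sum.elim (fun _ => 0) (Sum.elim (fun _ => l₁) fun _ => l₂) with hu
  set v : Clause (n₁ + n₂) k ⊕ (Clause n₁ k ⊕ Clause n₂ k) → ℝ :=
    Sum.elim (fun _ => l) (Sum.elim (fun _ => -l₁) fun _ => -l₂) with hv
  have hdrift := drift_log_one_add_solCount (s := blockSat k n₁ n₂) (v := v) (e := e)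
    (fun r xs => by
      have s1 : ∑ c : Clause (n₁ + n₂) k, v (Sum.inl c) *
          (if ∀ j, ¬ blockSat k n₁ n₂ (Sum.inl c) (xs j) then (1 : ℝ) else 0) = _ :=
        (Finset.sum_congr rfl fun c _ => by congr).trans (sum_violated xs l)
      have s2 : ∑ c : Clause n₁ k, v (Sum.inr (Sum.inl c)) *
          (if ∀ j, ¬ blockSat k n₁ n₂ (Sum.inr (Sum.inl c)) (xs j) then (1 : ℝ) else 0) = _ :=
        (Finset.sum_congr rfl fun c _ => by congr).trans
          (sum_violated (fun j i => xs j (Fin.castAdd n₂ i)) (-l₁))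
      have s3 : ∑ c : Clause n₂ k, v (Sum.inr (Sum.inr c)) *
          (if ∀ j, ¬ blockSat k n₁ n₂ (Sum.inr (Sum.inr c)) (xs j) then (1 : ℝ) else 0) = _ :=
        (Finset.sum_congr rfl fun c _ => by congr).trans
          (sum_violated (fun j i => xs j (Fin.natAdd n₁ i)) (-l₂))
      rw [Fintype.sum_sum_type, Fintype.sum_sum_type, s1, s2, s3, card_agree_add]
      have := h _ _
        ((Finset.card_le_univ (Finset.univ.filter fun i : Fin n₁ =>
          ∀ j, xs j (Fin.castAdd n₂ i) = xs 0 (Fin.castAdd n₂ i))).trans_eq (Fintype.card_fin _))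
        ((Finset.card_le_univ (Finset.univ.filter fun i : Fin n₂ =>
          ∀ j, xs j (Fin.natAdd n₁ i) = xs 0 (Fin.natAdd n₁ i))).trans_eq (Fintype.card_fin _))
      linarith)
  have hmain := prodExp_interpolate (u := u) (v := v)
    (f := fun F => Real.log (1 + solCount (blockSat k n₁ n₂) F))
    (e := e * (((n₁ + n₂ : ℕ) + 1) * Real.log 2))
    (by rintro (c | c | c) <;> simp [hu, hl1, hl2])
    (by rintro (c | c | c) <;> simp [hu, hv, hl0])
    (fun F => by
      refine le_trans (neg_le_neg (mul_le_mul_of_nonneg_left ?_ he)) (hdrift F)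
      refine log_one_add_le (Nat.cast_nonneg _) ?_
      have : solCount (blockSat k n₁ n₂) F ≤ 2 ^ (n₁ + n₂) :=
        (Finset.card_le_univ _).trans (by simp)
      exact_mod_cast this)
  have e1 : (fun c => 1 - Real.exp (-u c)) =
      Sum.elim (fun _ => 0) (Sum.elim (fun _ => p₁) fun _ => p₂) := by
    funext c
    rcases c with c | c | c
    · simp [hu]
    · exact one_sub_exp_neg_log hp₁'
    · exact one_sub_exp_neg_log hp₂'
  have e2 : (fun c => 1 - Real.exp (-(u c + v c))) =
      Sum.elim (fun _ => p) (Sum.elim (fun _ => 0) fun _ => 0) := by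
    funext c
    rcases c with c | c | c
    · simp only [hu, hv, Sum.elim_inl, zero_add]
      exact one_sub_exp_neg_log hp'
    · simp [hu, hv]
    · simp [hu, hv]
  rw [e1, e2] at hmain
  simp only [prodExp_elim, prodExp_zero, solCount_blockSat_right] at hmain
  have e3 : ((∅ : Finset (Clause n₁ k)).disjSum (∅ : Finset (Clause n₂ k))) = ∅ := by simp
  simpa only [e3, solCount_blockSat_left, Nat.cast_mul] using hmain

lemma clauseProb_nonneg {α : ℝ} (hα : 0 ≤ α) : 0 ≤ clauseProb k n α := by
  unfold clauseProb; positivity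

lemma clauseProb_mono {α β : ℝ} (h : α ≤ β) : clauseProb k n α ≤ clauseProb k n β := by
  unfold clauseProb; gcongr

lemma clauseProb_le {α : ℝ} (hα : 0 ≤ α) (hk : 2 ≤ k) (hkn : k ≤ n) :
    clauseProb k n α ≤ α * k ^ 2 / n := by
  have hn : (0 : ℝ) < n := by exact_mod_cast (by omega : 0 < n)
  have hc : (0 : ℝ) < n.choose k := by exact_mod_cast Nat.choose_pos hkn
  have h := choose_div_choose_le hkn hkn
  rw [Nat.choose_self, Nat.cast_one] at h
  have hkn' : (k : ℝ) / n ≤ 1 := (div_le_one hn).2 (by exact_mod_cast hkn)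
  have h1 : (1 : ℝ) / n.choose k ≤ ((k : ℝ) / n) ^ 2 :=
    h.trans (pow_le_pow_of_le_one (by positivity) hkn' hk)
  have h2 : (1 : ℝ) ≤ 2 ^ k := one_le_pow₀ (by norm_num)
  rw [clauseProb, card_clause]
  push_cast
  calc α * n / (n.choose k * 2 ^ k) = α * n * (1 / n.choose k) / 2 ^ k := by field_simp
    _ ≤ α * n * (1 / n.choose k) := div_le_self (by positivity) h2
    _ ≤ α * n * ((k : ℝ) / n) ^ 2 := by gcongr
    _ = _ := by field_simp

lemma neg_log_one_sub_le {p δ : ℝ} (hp : 0 ≤ p) (hδ : 0 ≤ δ) (hδ1 : δ ≤ 1) (hpδ : p ≤ δ / 4) :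
    -Real.log (1 - p) ≤ (1 + δ / 2) * p := by
  have hp1 : 0 < 1 - p := by linarith
  rw [← Real.log_inv]
  have h := Real.log_le_sub_one_of_pos (inv_pos.2 hp1)
  refine h.trans ?_
  have : (1 - p)⁻¹ - 1 = p / (1 - p) := by field_simp; ring
  rw [this, div_le_iff₀ hp1, mul_right_comm]
  exact le_mul_of_one_le_left hp (by nlinarith)

lemma le_neg_log_one_sub {p : ℝ} (hp : p < 1) : p ≤ -Real.log (1 - p) := by
  linarith [Real.log_le_sub_one_of_pos (show 0 < 1 - p by linarith)]

lemma intensity_convexity {α δ : ℝ} (hα : 0 ≤ α) (hδ : 0 < δ) (hδ1 : δ ≤ 1) (hk : 2 ≤ k)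
    (hn₁ : k ≤ n₁) (hn₂ : k ≤ n₂) (hp : clauseProb k (n₁ + n₂) α ≤ δ / 4)
    (hp₁ : clauseProb k n₁ (α * (1 + δ)) < 1) (hp₂ : clauseProb k n₂ (α * (1 + δ)) < 1)
    {a₁ a₂ : ℕ} (ha₁ : a₁ ≤ n₁) (ha₂ : a₂ ≤ n₂) :
    -Real.log (1 - clauseProb k (n₁ + n₂) α) * ((a₁ + a₂).choose k : ℝ) ≤
      -Real.log (1 - clauseProb k n₁ (α * (1 + δ))) * (a₁.choose k : ℝ) +
      -Real.log (1 - clauseProb k n₂ (α * (1 + δ))) * (a₂.choose k : ℝ) +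
      8 * α * k ^ 4 / δ * (1 / n₁ + 1 / n₂) := by
  have hN₁ : (0 : ℝ) < n₁ := by exact_mod_cast (by omega : 0 < n₁)
  have hN₂ : (0 : ℝ) < n₂ := by exact_mod_cast (by omega : 0 < n₂)
  have hκ0 : 0 ≤ α / 2 ^ k := by positivity
  have hκ1 : α / 2 ^ k ≤ α := div_le_self hα (one_le_pow₀ (by norm_num))
  have hprob : ∀ (m a : ℕ) (β : ℝ), clauseProb k m β * (a.choose k : ℝ) =
      β / 2 ^ k * (m * ((a.choose k : ℝ) / m.choose k)) := by
    intro m a β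
    rw [clauseProb, card_clause]
    push_cast
    ring
  have hpart : ∀ {m a : ℕ}, k ≤ m → (0 : ℝ) < m → a ≤ m →
      clauseProb k m (α * (1 + δ)) < 1 →
      α / 2 ^ k * ((1 + δ / 2) * (m * ((a : ℝ) / m) ^ k)) ≤
        -Real.log (1 - clauseProb k m (α * (1 + δ))) * (a.choose k : ℝ) +
          8 * α * k ^ 4 / δ * (1 / m) := by
    intro m a hm hm0 ha hpm
    have h1 := mul_le_mul_of_nonneg_right (le_neg_log_one_sub hpm)
      (Nat.cast_nonneg (a.choose k) : (0 : ℝ) ≤ _)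
    rw [hprob] at h1
    have h2 := mul_le_mul_of_nonneg_left (pow_le_choose_div_choose_add ha hk hm hδ hδ1)
      (by positivity : 0 ≤ α / 2 ^ k * m)
    have h3 : α / 2 ^ k * m * (8 * (k : ℝ) ^ 4 / (δ * (m : ℝ) ^ 2)) ≤
        8 * α * k ^ 4 / δ * (1 / m) := by
      calc _ = α / 2 ^ k * (8 * (k : ℝ) ^ 4 / δ * (1 / m)) := by field_simp
        _ ≤ α * (8 * (k : ℝ) ^ 4 / δ * (1 / m)) := by gcongr
        _ = _ := by ring
    calc _ = α / 2 ^ k * m * ((1 + δ / 2) * ((a : ℝ) / m) ^ k) := by ring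
      _ ≤ _ := h2
      _ = α * (1 + δ) / 2 ^ k * (m * ((a.choose k : ℝ) / m.choose k)) +
          α / 2 ^ k * m * (8 * (k : ℝ) ^ 4 / (δ * (m : ℝ) ^ 2)) := by ring
      _ ≤ _ := add_le_add h1 h3
  have hA : (a₁ + a₂).choose k / ((n₁ + n₂).choose k : ℝ) ≤
      (((a₁ + a₂ : ℕ) : ℝ) / ((n₁ + n₂ : ℕ) : ℝ)) ^ k :=
    choose_div_choose_le (by omega) (by omega)
  calc _ ≤ (1 + δ / 2) * clauseProb k (n₁ + n₂) α * ((a₁ + a₂).choose k : ℝ) := by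
        gcongr
        exact neg_log_one_sub_le (clauseProb_nonneg hα) hδ.le hδ1 hp
    _ = α / 2 ^ k * ((1 + δ / 2) * (((n₁ + n₂ : ℕ) : ℝ) *
          ((a₁ + a₂).choose k / ((n₁ + n₂).choose k : ℝ)))) := by
        rw [mul_assoc, hprob]; ring
    _ ≤ α / 2 ^ k * ((1 + δ / 2) * (((n₁ + n₂ : ℕ) : ℝ) *
          (((a₁ + a₂ : ℕ) : ℝ) / ((n₁ + n₂ : ℕ) : ℝ)) ^ k)) := by gcongr
    _ ≤ α / 2 ^ k * ((1 + δ / 2) * (n₁ * ((a₁ : ℝ) / n₁) ^ k + n₂ * ((a₂ : ℝ) / n₂) ^ k)) := by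
        push_cast
        gcongr
        exact pow_div_add_le hN₁ hN₂ (Nat.cast_nonneg _) (Nat.cast_nonneg _) k
    _ ≤ _ := by
        linarith [hpart hn₁ hN₁ ha₁ hp₁, hpart hn₂ hN₂ ha₂ hp₂]

lemma log_one_add_mul_ge {z₁ z₂ : ℕ} (h₁ : z₁ ≤ 2 ^ n₁) (h₂ : z₂ ≤ 2 ^ n₂) :
    Real.log (1 + z₁) + Real.log (1 + z₂) + (-(2 * Real.log 2) +
      (-((n₁ + 1) * Real.log 2) * (if z₂ = 0 then 1 else 0) +
        -((n₂ + 1) * Real.log 2) * (if z₁ = 0 then 1 else 0))) ≤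
      Real.log (1 + (z₁ : ℝ) * z₂) := by
  have hl2 : 0 < Real.log 2 := Real.log_pos (by norm_num)
  have b₁ : Real.log (1 + (z₁ : ℝ)) ≤ (n₁ + 1) * Real.log 2 :=
    log_one_add_le (Nat.cast_nonneg _) (by exact_mod_cast h₁)
  have b₂ : Real.log (1 + (z₂ : ℝ)) ≤ (n₂ + 1) * Real.log 2 :=
    log_one_add_le (Nat.cast_nonneg _) (by exact_mod_cast h₂)
  have c₁ : 0 ≤ ((n₁ : ℝ) + 1) * Real.log 2 := by positivity
  have c₂ : 0 ≤ ((n₂ : ℝ) + 1) * Real.log 2 := by positivity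
  rcases Nat.eq_zero_or_pos z₁ with rfl | hz₁
  · simp only [Nat.cast_zero, add_zero, Real.log_one, zero_mul, zero_add, if_true, mul_one]
    split_ifs <;> linarith
  rcases Nat.eq_zero_or_pos z₂ with rfl | hz₂
  · simp only [Nat.cast_zero, add_zero, Real.log_one, mul_zero, if_true, mul_one, hz₁.ne',
      if_false]
    linarith
  rw [if_neg hz₁.ne', if_neg hz₂.ne']
  have d₁ : (1 : ℝ) ≤ z₁ := by exact_mod_cast hz₁
  have d₂ : (1 : ℝ) ≤ z₂ := by exact_mod_cast hz₂
  have h4 : (1 + (z₁ : ℝ)) * (1 + z₂) ≤ 2 ^ 2 * (1 + (z₁ : ℝ) * z₂) := by nlinarith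
  have := Real.log_le_log (by positivity) h4
  rw [Real.log_mul (by positivity) (by positivity), Real.log_mul (by positivity) (by positivity),
    Real.log_pow] at this
  push_cast at this
  linarith

lemma expLog_add_le {α δ : ℝ} (hα : 0 ≤ α) (hδ : 0 < δ) (hδ1 : δ ≤ 1) (hk : 2 ≤ k)
    (hn₁ : k ≤ n₁) (hn₂ : k ≤ n₂) (hp : clauseProb k (n₁ + n₂) α ≤ δ / 4)
    (hp₁ : clauseProb k n₁ (α * (1 + δ)) < 1) (hp₂ : clauseProb k n₂ (α * (1 + δ)) < 1) :
    expLog k n₁ (α * (1 + δ)) + expLog k n₂ (α * (1 + δ)) - 2 * Real.log 2 -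
      (n₁ + 1) * Real.log 2 * Pn k n₂ (α * (1 + δ)) 0 -
      (n₂ + 1) * Real.log 2 * Pn k n₁ (α * (1 + δ)) 0 -
      8 * α * k ^ 4 / δ * (1 / n₁ + 1 / n₂) * ((n₁ + n₂ + 1) * Real.log 2) ≤
      expLog k (n₁ + n₂) α := by
  have hβ : 0 ≤ α * (1 + δ) := by positivity
  have hinterp := expLog_interpolate (k := k) (n₁ := n₁) (n₂ := n₂) (clauseProb_nonneg hα)
    (clauseProb_nonneg hβ) (clauseProb_nonneg hβ) (by linarith) hp₁ hp₂ (by positivity)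
    (fun a₁ a₂ ha₁ ha₂ => intensity_convexity hα hδ hδ1 hk hn₁ hn₂ hp hp₁ hp₂ ha₁ ha₂)
  have hlow := prodExp_mono (p := fun _ : Clause n₁ k => clauseProb k n₁ (α * (1 + δ)))
    (fun _ => clauseProb_nonneg hβ) (fun _ => hp₁.le) fun F₁ =>
      prodExp_mono (p := fun _ : Clause n₂ k => clauseProb k n₂ (α * (1 + δ)))
        (fun _ => clauseProb_nonneg hβ) (fun _ => hp₂.le) fun F₂ =>
          log_one_add_mul_ge (Z_le F₁) (Z_le F₂)
  simp only [prodExp_add, prodExp_const_mul, prodExp_const] at hlow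
  rw [← Pn_zero_eq, ← Pn_zero_eq] at hlow
  have e₁ : (prodExp (fun _ : Clause n₁ k => clauseProb k n₁ (α * (1 + δ)))
    fun F => Real.log (1 + Z F)) = expLog k n₁ (α * (1 + δ)) := rfl
  have e₂ : (prodExp (fun _ : Clause n₂ k => clauseProb k n₂ (α * (1 + δ)))
    fun F => Real.log (1 + Z F)) = expLog k n₂ (α * (1 + δ)) := rfl
  rw [e₁, e₂] at hlow
  have e₃ : (prodExp (fun _ : Clause (n₁ + n₂) k => clauseProb k (n₁ + n₂) α)
    fun F => Real.log (1 + Z F)) = expLog k (n₁ + n₂) α := rfl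
  rw [e₃] at hinterp
  push_cast at hinterp
  linarith

end Interpolation

/-! ### Dependence on the density -/

section Density

variable {k n : ℕ}

lemma Z_insert_le (c : Clause n k) (F : Finset (Clause n k)) : Z (insert c F) ≤ Z F := by
  refine Finset.card_le_card fun x hx => ?_
  simp only [Finset.mem_filter, Finset.mem_univ, true_and, Finset.mem_insert] at hx ⊢
  exact fun d hd => hx d (Or.inr hd)

lemma Pn_zero_nonneg {α : ℝ} (hα : 0 ≤ α) (hp : clauseProb k n α ≤ 1) : 0 ≤ Pn k n α 0 := by
  have h := prodExp_mono (p := fun _ : Clause n k => clauseProb k n α) (f := fun _ => 0)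
    (g := fun F => if Z F = 0 then 1 else 0)
    (fun _ => clauseProb_nonneg hα) (fun _ => hp) fun F => by positivity
  rwa [prodExp_const, ← Pn_zero_eq] at h

lemma Pn_zero_mono {α β : ℝ} (hα : 0 ≤ α) (hαβ : α ≤ β) (hp : clauseProb k n β < 1) :
    Pn k n α 0 ≤ Pn k n β 0 := by
  rw [Pn_zero_eq, Pn_zero_eq]
  refine prodExp_const_mono (clauseProb_nonneg hα) (clauseProb_mono hαβ) hp fun c F => ?_
  have h := Z_insert_le c F
  by_cases h0 : Z F = 0
  · rw [if_pos h0, if_pos (by omega)]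
  · rw [if_neg h0]; positivity

lemma expLog_nonneg {α : ℝ} (hα : 0 ≤ α) (hp : clauseProb k n α ≤ 1) : 0 ≤ expLog k n α := by
  have h := prodExp_mono (p := fun _ : Clause n k => clauseProb k n α) (f := fun _ => 0)
    (fun _ => clauseProb_nonneg hα) (fun _ => hp) log_one_add_Z_nonneg
  rwa [prodExp_const] at h

lemma expLog_le {α : ℝ} (hα : 0 ≤ α) (hp : clauseProb k n α ≤ 1) :
    expLog k n α ≤ (n + 1) * Real.log 2 := by
  have h := prodExp_mono (p := fun _ : Clause n k => clauseProb k n α)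
    (g := fun _ => (n + 1) * Real.log 2)
    (fun _ => clauseProb_nonneg hα) (fun _ => hp) log_one_add_Z_le
  rwa [prodExp_const] at h

lemma abs_expLog_sub_le {α δ : ℝ} (hα : 0 ≤ α) (hδ : 0 ≤ δ) (hk : 2 ≤ k) (hkn : k ≤ n)
    (hp : clauseProb k n α ≤ 1 / 2) (hx : 2 * α * n * δ ^ 2 ≤ 1) :
    |expLog k n (α * (1 + δ)) - expLog k n α| ≤
      (n + 1) * Real.log 2 * (2 * δ * (√α * √n)) := by
  rcases hα.eq_or_lt with rfl | hα
  · simp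
  have hn : (0 : ℝ) < n := by exact_mod_cast (by omega : 0 < n)
  have hN : (0 : ℝ) < Fintype.card (Clause n k) := by
    rw [card_clause]
    exact_mod_cast Nat.mul_pos (Nat.choose_pos hkn) (by positivity)
  have hp0 : 0 < clauseProb k n α := by unfold clauseProb; positivity
  have hq : clauseProb k n (α * (1 + δ)) = clauseProb k n α * (1 + δ) := by
    unfold clauseProb; ring
  have h := abs_prodExp_const_sub_le (q := clauseProb k n (α * (1 + δ))) hp0 (by linarith)
    (f := fun F : Finset (Clause n k) => Real.log (1 + Z F)) fun F => by
      rw [abs_of_nonneg (log_one_add_Z_nonneg F)]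
      exact log_one_add_Z_le F
  refine h.trans (mul_le_mul_of_nonneg_left ?_ (by positivity))
  rw [← Real.sqrt_mul hα.le]
  refine Real.sqrt_le_iff.2 ⟨by positivity, ?_⟩
  rw [mul_pow, Real.sq_sqrt (by positivity)]
  set p := clauseProb k n α with hp_def
  have hNp : Fintype.card (Clause n k) * p = α * n := by
    rw [hp_def, clauseProb]; field_simp
  set x := Fintype.card (Clause n k) * ((clauseProb k n (α * (1 + δ)) - p) ^ 2 / (p * (1 - p)))
    with hx_def
  have hx0 : 0 ≤ x := by
    have : 0 < 1 - p := by linarith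
    positivity
  have hx1 : x ≤ 2 * α * n * δ ^ 2 := by
    have h1 : 0 < 1 - p := by linarith
    have e : x = Fintype.card (Clause n k) * p * δ ^ 2 / (1 - p) := by
      rw [hx_def, hq]
      field_simp
      ring
    rw [e, hNp, div_le_iff₀ h1]
    have : 0 ≤ α * n * δ ^ 2 := by positivity
    nlinarith
  have h2 := Real.abs_exp_sub_one_le (x := x) (by rw [abs_of_nonneg hx0]; linarith)
  rw [abs_of_nonneg hx0] at h2
  have h3 := (le_abs_self _).trans h2
  linarith

end Density

/-! ### Almost superadditive sequences -/

section Superadditive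

variable {a : ℕ → ℝ}

/-- Superadditivity for comparable indices propagates to multiples of a fixed index. -/
lemma superadditive_mul_add {n₀ : ℕ}
    (h : ∀ m n, n₀ ≤ m → n₀ ≤ n → m ≤ 2 * n → n ≤ 2 * m → a m + a n ≤ a (m + n))
    {m : ℕ} (hm : n₀ ≤ m) (q r : ℕ) (hr : r ≤ m) :
    q * a m + a (m + r) ≤ a ((q + 1) * m + r) := by
  induction q using Nat.strong_induction_on generalizing r with
  | _ q ih =>
    rcases Nat.eq_zero_or_pos q with rfl | hq
    · simp
    obtain ⟨s, t, rfl, hst, hts⟩ : ∃ s t, q = s + t + 1 ∧ s ≤ t ∧ t ≤ s + 1 :=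
      ⟨(q - 1) / 2, (q - 1) - (q - 1) / 2, by omega, by omega, by omega⟩
    have h1 := ih s (by omega) r hr
    have h2 := ih t (by omega) 0 (Nat.zero_le _)
    have h3 := h ((s + 1) * m + r) ((t + 1) * m + 0) (by nlinarith) (by nlinarith) (by nlinarith)
      (by nlinarith)
    have e : (s + 1) * m + r + ((t + 1) * m + 0) = (s + t + 1 + 1) * m + r := by ring
    rw [e] at h3
    simp only [add_zero] at h2 h3
    push_cast
    linarith

/-- Fekete's lemma for sequences that are superadditive on comparable indices. -/
lemma exists_tendsto_div_of_superadditive {n₀ : ℕ} (hn₀ : 0 < n₀) {B : ℝ}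
    (hB : ∀ n, n₀ ≤ n → |a n| ≤ B * n)
    (h : ∀ m n, n₀ ≤ m → n₀ ≤ n → m ≤ 2 * n → n ≤ 2 * m → a m + a n ≤ a (m + n)) :
    ∃ L, Tendsto (fun n : ℕ => a n / n) atTop (𝓝 L) := by
  have hpos : ∀ n : ℕ, n₀ ≤ n → (0 : ℝ) < n := fun n hn => by exact_mod_cast hn₀.trans_le hn
  have hB0 : 0 ≤ B := by
    have := (abs_nonneg _).trans (hB n₀ le_rfl)
    exact nonneg_of_mul_nonneg_left this (hpos n₀ le_rfl)
  set S : Set ℝ := (fun n : ℕ => a n / n) '' Set.Ici n₀ with hS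
  have hbdd : BddAbove S := by
    refine ⟨B, ?_⟩
    rintro _ ⟨n, hn, rfl⟩
    exact (div_le_iff₀ (hpos n hn)).2 ((le_abs_self _).trans (hB n hn))
  refine ⟨sSup S, tendsto_order.2 ⟨fun l hl => ?_, fun u hu => ?_⟩⟩
  · obtain ⟨_, ⟨m, hm, rfl⟩, hlm⟩ := exists_lt_of_lt_csSup (Set.nonempty_Ici.image _) hl
    have hm' : n₀ ≤ m := hm
    have hm0 := hpos m hm
    have key : ∀ n, m ≤ n → a m / m - 4 * B * m / n ≤ a n / n := by
      intro n hn
      obtain ⟨q, r, hr, rfl⟩ : ∃ q r, r ≤ m ∧ n = (q + 1) * m + r := by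
        have h1 : 0 < m := by omega
        have h2 : 1 ≤ n / m := (Nat.one_le_div_iff h1).2 hn
        refine ⟨n / m - 1, n % m, (Nat.mod_lt _ h1).le, ?_⟩
        rw [Nat.sub_add_cancel h2, Nat.div_add_mod']
      have h1 := superadditive_mul_add h hm q r hr
      have h2 := (abs_le.1 (hB (m + r) (by omega))).1
      have h3 := (abs_le.1 (hB m hm)).2
      have hn0 := hpos _ (hm'.trans hn)
      have hr' : (r : ℝ) ≤ m := by exact_mod_cast hr
      have hr0 : (0 : ℝ) ≤ r := Nat.cast_nonneg r
      rw [sub_le_iff_le_add, ← add_div, le_div_iff₀ hn0]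
      push_cast at h2 ⊢
      have h4 : a m / m * ((q + 1) * m + r) = (q + 1) * a m + a m / m * r := by
        field_simp
      have h5 : a m / m * r ≤ B * m := by
        refine (mul_le_mul_of_nonneg_right ((div_le_iff₀ hm0).2 h3) hr0).trans ?_
        gcongr
      have h6 : B * r ≤ B * m := by gcongr
      rw [h4]
      linarith
    have hlim : Tendsto (fun n : ℕ => a m / m - 4 * B * m / n) atTop (𝓝 (a m / m - 0)) :=
      tendsto_const_nhds.sub (tendsto_const_div_atTop_nhds_zero_nat _)
    rw [sub_zero] at hlim
    filter_upwards [hlim.eventually_const_lt hlm, eventually_ge_atTop m] with n h1 h2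
    exact h1.trans_le (key n h2)
  · filter_upwards [eventually_ge_atTop n₀] with n hn
    exact (le_csSup hbdd ⟨n, hn, rfl⟩).trans_lt hu

lemma rpow_neg_sub_rpow_neg_ge {x y ε : ℝ} (hx : 0 < x) (hxy : x ≤ y) (hε : 0 < ε) :
    ε * (y - x) / y ^ (1 + ε) ≤ 1 / x ^ ε - 1 / y ^ ε := by
  have hy := hx.trans_le hxy
  have h1 : 1 + ε * (1 - x / y) ≤ y ^ ε / x ^ ε := by
    rw [← Real.div_rpow hy.le hx.le, Real.rpow_def_of_pos (by positivity)]
    have h2 := Real.log_le_sub_one_of_pos (show 0 < x / y by positivity)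
    have h3 := Real.add_one_le_exp (Real.log (y / x) * ε)
    have h4 : Real.log (y / x) = -Real.log (x / y) := by rw [← Real.log_inv, inv_div]
    rw [h4] at h3 ⊢
    nlinarith
  have e1 : ε * (y - x) / y ^ (1 + ε) = ε * (1 - x / y) / y ^ ε := by
    rw [Real.rpow_add hy, Real.rpow_one]
    field_simp
  have e2 : 1 / x ^ ε - 1 / y ^ ε = (y ^ ε / x ^ ε - 1) / y ^ ε := by
    field_simp
  rw [e1, e2]
  gcongr
  linarith

/-- A sequence with linear growth whose superadditivity defect on comparable indices is
`O(n / (log n) ^ (1 + ε))` has a linear rate. -/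
lemma exists_tendsto_div_of_almost_superadditive {n₀ : ℕ} {B C ε : ℝ} (hε : 0 < ε) (hC : 0 ≤ C)
    (hB : ∀ n, n₀ ≤ n → |a n| ≤ B * n)
    (h : ∀ m n, n₀ ≤ m → m ≤ n → n ≤ 2 * m →
      a m + a n - C * ((m + n : ℕ) / Real.log (m + n : ℕ) ^ (1 + ε)) ≤ a (m + n)) :
    ∃ L, Tendsto (fun n : ℕ => a n / n) atTop (𝓝 L) := by
  have hc : 0 < Real.log (3 / 2) := Real.log_pos (by norm_num)
  set D : ℝ := C / (ε * Real.log (3 / 2)) with hD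
  have hD0 : 0 ≤ D := by positivity
  have hlog : ∀ n : ℕ, 3 ≤ n → 1 ≤ Real.log n := fun n hn => by
    rw [Real.le_log_iff_exp_le (by positivity)]
    have : (3 : ℝ) ≤ n := by exact_mod_cast hn
    linarith [Real.exp_one_lt_d9]
  set b : ℕ → ℝ := fun n => a n - n * (D * (1 / Real.log n ^ ε)) with hb
  have hκ : ∀ m n : ℕ, 3 ≤ m → 3 * m ≤ 2 * n →
      C / Real.log n ^ (1 + ε) ≤ D * (1 / Real.log m ^ ε) - D * (1 / Real.log n ^ ε) := by
    intro m n hm hmn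
    have hm0 : (0 : ℝ) < m := by positivity
    have hmn' : (3 : ℝ) * m ≤ 2 * n := by exact_mod_cast hmn
    have hlm := hlog m hm
    have hln := hlog n (by omega)
    have h1 : Real.log (3 / 2) ≤ Real.log n - Real.log m := by
      rw [le_sub_iff_add_le, ← Real.log_mul (by norm_num) hm0.ne']
      exact Real.log_le_log (by positivity) (by linarith)
    have h2 := rpow_neg_sub_rpow_neg_ge (x := Real.log m) (y := Real.log n) (by linarith)
      (by linarith) hε
    rw [← mul_sub]
    refine le_trans ?_ (mul_le_mul_of_nonneg_left h2 hD0)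
    have : C = D * (ε * Real.log (3 / 2)) := by rw [hD]; field_simp
    rw [← mul_div_assoc]
    refine div_le_div_of_nonneg_right ?_ (Real.rpow_nonneg (by linarith) _)
    calc C = D * (ε * Real.log (3 / 2)) := this
      _ ≤ _ := by gcongr
  have hsup : ∀ m n, max n₀ 3 ≤ m → m ≤ n → n ≤ 2 * m → b m + b n ≤ b (m + n) := by
    intro m n hm hmn hnm
    have hm' := max_le_iff.1 hm
    have h1 := h m n hm'.1 hmn hnm
    have h2 := hκ m (m + n) hm'.2 (by omega)
    have h3 := hκ n (m + n) (by omega) (by omega)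
    have h4 := mul_le_mul_of_nonneg_left h2 (Nat.cast_nonneg (α := ℝ) m)
    have h5 := mul_le_mul_of_nonneg_left h3 (Nat.cast_nonneg (α := ℝ) n)
    have e : C * ((m + n : ℕ) / Real.log (m + n : ℕ) ^ (1 + ε)) =
        m * (C / Real.log (m + n : ℕ) ^ (1 + ε)) + n * (C / Real.log (m + n : ℕ) ^ (1 + ε)) := by
      push_cast; ring
    rw [e] at h1
    simp only [hb]
    have e2 : ((m + n : ℕ) : ℝ) * (D * (1 / Real.log (m + n : ℕ) ^ ε)) =
      m * (D * (1 / Real.log (m + n : ℕ) ^ ε)) + n * (D * (1 / Real.log (m + n : ℕ) ^ ε)) := by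
      push_cast; ring
    rw [e2]
    linarith
  have hbB : ∀ n, max n₀ 3 ≤ n → |b n| ≤ (B + D) * n := by
    intro n hn
    have hn' := max_le_iff.1 hn
    have h1 : 1 ≤ Real.log n ^ ε := Real.one_le_rpow (hlog n hn'.2) hε.le
    have h2 : 1 / Real.log n ^ ε ≤ 1 := by rw [div_le_one (by linarith)]; exact h1
    have h3 : 0 ≤ 1 / Real.log n ^ ε := by positivity
    refine (abs_sub _ _).trans ?_
    rw [abs_of_nonneg (by positivity : 0 ≤ (n : ℝ) * (D * (1 / Real.log n ^ ε)))]
    have h4 := hB n hn'.1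
    have h5 : (n : ℝ) * (D * (1 / Real.log n ^ ε)) ≤ n * (D * 1) := by gcongr
    linarith
  obtain ⟨L, hL⟩ := exists_tendsto_div_of_superadditive (a := b) (n₀ := max n₀ 3) (by simp) hbB
    (fun m n hm hn h1 h2 => by
      rcases le_total m n with hmn | hmn
      · exact hsup m n hm hmn h2
      · rw [add_comm (b m), add_comm m]
        exact hsup n m hn hmn h1)
  refine ⟨L, ?_⟩
  have hlim : Tendsto (fun n : ℕ => D * (1 / Real.log n ^ ε)) atTop (𝓝 (D * 0)) := by
    refine Tendsto.const_mul _ ?_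
    simp only [one_div]
    exact ((tendsto_rpow_atTop hε).comp
      (Real.tendsto_log_atTop.comp tendsto_natCast_atTop_atTop)).inv_tendsto_atTop
  have := hL.add hlim
  rw [mul_zero, add_zero] at this
  refine this.congr' ?_
  filter_upwards [eventually_gt_atTop 0] with n hn
  have hn0 : (n : ℝ) ≠ 0 := by positivity
  simp only [hb]
  field_simp
  ring

end Superadditive

/-! ### Almost superadditivity below the threshold -/

section Threshold

variable {k : ℕ}

lemma eventually_clauseProb_le (hk : 2 ≤ k) {α c : ℝ} (hα : 0 ≤ α) (hc : 0 < c) :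
    ∀ᶠ n : ℕ in atTop, clauseProb k n α ≤ c := by
  filter_upwards [(tendsto_const_div_atTop_nhds_zero_nat (α * k ^ 2)).eventually_lt_const hc,
    eventually_ge_atTop k] with n h1 h2
  exact (clauseProb_le hα hk h2).trans h1.le

lemma expLog_sub_le_of_root {j : ℕ} {α r : ℝ} (hα : 0 ≤ α) (hk : 2 ≤ k) (hkj : k ≤ j)
    (hr : 1 ≤ r) (hα2 : 2 * α ≤ r ^ 2) (hj : (j : ℝ) + 1 ≤ r ^ 4)
    (hp : clauseProb k j (α * (1 + 1 / r ^ 3)) ≤ 1 / 2) :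
    expLog k j α - 2 * √α * r ^ 3 ≤ expLog k j (α * (1 + 1 / r ^ 3)) := by
  have hr0 : 0 < r := by linarith
  have hδ : 0 ≤ 1 / r ^ 3 := by positivity
  have hj4 : (j : ℝ) ≤ r ^ 4 := by linarith
  have hp' : clauseProb k j α ≤ 1 / 2 := (clauseProb_mono (by nlinarith)).trans hp
  have hsmall : 2 * α * j * (1 / r ^ 3) ^ 2 ≤ 1 := by
    rw [div_pow, one_pow, mul_one_div, div_le_one (by positivity)]
    calc 2 * α * j ≤ r ^ 2 * r ^ 4 := by gcongr
      _ = (r ^ 3) ^ 2 := by ring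
  have h1 := abs_expLog_sub_le hα hδ hk hkj hp' hsmall
  have h2 : √(j : ℝ) ≤ r ^ 2 :=
    Real.sqrt_le_iff.2 ⟨by positivity, hj4.trans_eq (by ring)⟩
  have hlog : Real.log 2 ≤ 1 := by linarith [Real.log_two_lt_d9]
  have h3 : (j + 1) * Real.log 2 * (2 * (1 / r ^ 3) * (√α * √j)) ≤ 2 * √α * r ^ 3 :=
    calc (j + 1) * Real.log 2 * (2 * (1 / r ^ 3) * (√α * √j))
        ≤ r ^ 4 * 1 * (2 * (1 / r ^ 3) * (√α * r ^ 2)) := by gcongr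
      _ = 2 * √α * r ^ 3 := by field_simp
  linarith [(abs_le.1 (h1.trans h3)).1]

lemma interpolation_error_le {x y r ℓ α C s K P Q : ℝ} (hx1 : 1 ≤ x) (hxy : x ≤ y)
    (hyx : y ≤ 2 * x) (hr : 1 ≤ r) (hℓ : 0 < ℓ)
    (hℓr : r ^ 3 ≤ (x + y) / ℓ) (hα : 0 ≤ α) (hC : 0 ≤ C) (hs : 0 ≤ s) (hK : 0 ≤ K)
    (hP : P ≤ C / ℓ) (hQ : Q ≤ C / ℓ) :
    2 * Real.log 2 + (x + 1) * Real.log 2 * Q + (y + 1) * Real.log 2 * P +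
      8 * α * K / (1 / r ^ 3) * (1 / x + 1 / y) * ((x + y + 1) * Real.log 2) + 4 * s * r ^ 3 ≤
      (2 + 2 * C + 96 * α * K + 4 * s) * ((x + y) / ℓ) := by
  have hr0 : 0 < r := by linarith
  have hx : 0 < x := by linarith
  have hy : 0 < y := by linarith
  have hlog0 : 0 < Real.log 2 := Real.log_pos (by norm_num)
  have hlog1 : Real.log 2 ≤ 1 := by linarith [Real.log_two_lt_d9]
  have hr3 : 1 ≤ r ^ 3 := one_le_pow₀ hr
  have hunsat : ∀ z R : ℝ, 0 ≤ z → z + 1 ≤ x + y → R ≤ C / ℓ →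
      (z + 1) * Real.log 2 * R ≤ C * ((x + y) / ℓ) := by
    intro z R hz hzN hR
    calc (z + 1) * Real.log 2 * R ≤ (z + 1) * Real.log 2 * (C / ℓ) := by gcongr
      _ ≤ (x + y) * 1 * (C / ℓ) := by gcongr
      _ = C * ((x + y) / ℓ) := by ring
  have h1 := hunsat x Q hx.le (by linarith) hQ
  have h2 := hunsat y P hy.le (by linarith) hP
  have hinv : 1 / x + 1 / y ≤ 6 / (x + y) := by
    rw [div_add_div _ _ hx.ne' hy.ne', div_le_div_iff₀ (by positivity) (by positivity)]
    nlinarith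
  have h3 : 8 * α * K / (1 / r ^ 3) * (1 / x + 1 / y) * ((x + y + 1) * Real.log 2) ≤
      96 * α * K * r ^ 3 :=
    calc 8 * α * K / (1 / r ^ 3) * (1 / x + 1 / y) * ((x + y + 1) * Real.log 2)
        ≤ 8 * α * K / (1 / r ^ 3) * (6 / (x + y)) * (2 * (x + y) * 1) := by
          gcongr
          linarith
      _ = 96 * α * K * r ^ 3 := by field_simp; ring
  have h4 : (2 + 96 * α * K + 4 * s) * r ^ 3 ≤ (2 + 96 * α * K + 4 * s) * ((x + y) / ℓ) := by
    gcongr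
  linarith

/-- The comparison of `expLog` for one formula and for two formulas at the same density, for a
given margin `r⁻³`, where `r` is the fourth root of the number of variables. -/
lemma expLog_add_le_of_root {m n : ℕ} {α C r ℓ : ℝ} (hα : 0 ≤ α) (hk : 2 ≤ k) (hC : 0 ≤ C)
    (hkm : k ≤ m) (hmn : m ≤ n) (hnm : n ≤ 2 * m) (hr : 1 ≤ r) (hr4 : r ^ 4 = (m + n : ℕ))
    (hαr : 4 * α * k ^ 2 ≤ r) (hα2 : 2 * α ≤ r ^ 2) (hℓ : 0 < ℓ) (hℓr : r ^ 3 ≤ (m + n : ℕ) / ℓ)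
    (hpm : clauseProb k m (α * (1 + 1 / r ^ 3)) ≤ 1 / 2)
    (hpn : clauseProb k n (α * (1 + 1 / r ^ 3)) ≤ 1 / 2)
    (hPm : Pn k m (α * (1 + 1 / r ^ 3)) 0 ≤ C / ℓ)
    (hPn : Pn k n (α * (1 + 1 / r ^ 3)) 0 ≤ C / ℓ) :
    expLog k m α + expLog k n α -
      (2 + 2 * C + 96 * α * k ^ 4 + 4 * √α) * ((m + n : ℕ) / ℓ) ≤ expLog k (m + n) α := by
  have hr0 : 0 < r := by linarith only [hr]
  have hδ1 : 1 / r ^ 3 ≤ 1 := by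
    rw [div_le_one (by positivity)]
    exact one_le_pow₀ hr
  have hmn' : (m : ℝ) ≤ n := by exact_mod_cast hmn
  have hnm' : (n : ℝ) ≤ 2 * m := by exact_mod_cast hnm
  have hm1 : (1 : ℝ) ≤ m := by exact_mod_cast (by omega : 1 ≤ m)
  have hp : clauseProb k (m + n) α ≤ 1 / r ^ 3 / 4 := by
    refine (clauseProb_le hα hk (by omega)).trans ?_
    rw [← hr4, div_div, div_le_div_iff₀ (by positivity) (by positivity)]
    have : 4 * α * k ^ 2 * r ^ 3 ≤ r * r ^ 3 := by gcongr
    linarith only [this]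
  rw [Nat.cast_add] at hr4 hℓr ⊢
  have hadd := expLog_add_le hα (by positivity) hδ1 hk hkm (hkm.trans hmn) hp
    (hpm.trans_lt (by norm_num)) (hpn.trans_lt (by norm_num))
  have hlm := expLog_sub_le_of_root hα hk hkm hr hα2 (by linarith only [hr4, hmn', hm1]) hpm
  have hln := expLog_sub_le_of_root hα hk (hkm.trans hmn) hr hα2 (by linarith only [hr4, hm1]) hpn
  have herr := interpolation_error_le (K := k ^ 4) hm1 hmn' hnm' hr hℓ hℓr hα hC
    (Real.sqrt_nonneg α) (by positivity) hPm hPn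
  linarith only [hadd, hlm, hln, herr]

lemma exists_expLog_almost_superadditive {α β C ε : ℝ} (hk : 2 ≤ k) (hα : 0 ≤ α) (hαβ : α < β)
    (hC : 0 ≤ C) (hε : 0 < ε)
    (hP : ∀ᶠ n : ℕ in atTop, Pn k n β 0 ≤ C / Real.log n ^ (1 + ε)) :
    ∃ D : ℝ, 0 ≤ D ∧ ∀ᶠ n₀ : ℕ in atTop, ∀ m n : ℕ, n₀ ≤ m → m ≤ n → n ≤ 2 * m →
      expLog k m α + expLog k n α - D * ((m + n : ℕ) / Real.log (m + n : ℕ) ^ (1 + ε)) ≤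
        expLog k (m + n) α := by
  have hroot : Tendsto (fun n : ℕ => (n : ℝ) ^ (1 / 4 : ℝ)) atTop atTop :=
    (tendsto_rpow_atTop (by norm_num)).comp tendsto_natCast_atTop_atTop
  have hmargin : ∀ᶠ r : ℝ in atTop, α * (1 + 1 / r ^ 3) < β := by
    have h : Tendsto (fun r : ℝ => α * (1 + 1 / r ^ 3)) atTop (𝓝 (α * (1 + 0))) := by
      refine (tendsto_const_nhds.add ?_).const_mul _
      simp only [one_div]
      exact (tendsto_pow_atTop (by norm_num)).inv_tendsto_atTop
    rw [add_zero, mul_one] at h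
    exact h.eventually_lt_const hαβ
  have hlog : ∀ᶠ n : ℕ in atTop, Real.log n ^ (1 + ε) ≤ (n : ℝ) ^ (1 / 4 : ℝ) := by
    have h := (isLittleO_log_rpow_rpow_atTop (1 + ε) (show (0 : ℝ) < 1 / 4 by norm_num)).bound
      one_pos
    filter_upwards [tendsto_natCast_atTop_atTop.eventually h] with n hn
    rw [one_mul] at hn
    exact (Real.le_norm_self _).trans (hn.trans_eq (Real.norm_of_nonneg (by positivity)))
  have hev := eventually_forall_ge_atTop.2 (((eventually_clauseProb_le hk (hα.trans hαβ.le)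
    (show (0 : ℝ) < 1 / 2 by norm_num)).and hP).and (hlog.and ((hroot.eventually hmargin).and
      ((hroot.eventually_ge_atTop (max 1 (max (4 * α * k ^ 2) (2 * α)))).and
        (eventually_ge_atTop (max k 9))))))
  refine ⟨2 + 2 * (C * 2 ^ (1 + ε)) + 96 * α * k ^ 4 + 4 * √α, by positivity, ?_⟩
  filter_upwards [hev] with n₀ h m n hm hmn hnm
  obtain ⟨⟨hpm, hPm⟩, -, -, -, hkm⟩ := h m hm
  obtain ⟨⟨hpn, hPn⟩, -, -, -, -⟩ := h n (hm.trans hmn)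
  obtain ⟨-, hlogN, hmarg, hr, -⟩ := h (m + n) (by omega)
  obtain ⟨hr1, hr'⟩ := max_le_iff.1 hr
  obtain ⟨hr2, hr3⟩ := max_le_iff.1 hr'
  obtain ⟨hkm, hm9⟩ := max_le_iff.1 hkm
  set r := ((m + n : ℕ) : ℝ) ^ (1 / 4 : ℝ) with hr_def
  have hr4 : r ^ 4 = (m + n : ℕ) := by
    rw [hr_def, ← Real.rpow_natCast, ← Real.rpow_mul (by positivity)]
    norm_num
  have hr0 : 0 < r := by linarith
  set ℓ := Real.log (m + n : ℕ) ^ (1 + ε) with hℓ_def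
  have hlogpos : 0 < Real.log (m + n : ℕ) := Real.log_pos (by exact_mod_cast (by omega : 1 < m + n))
  have hℓ : 0 < ℓ := Real.rpow_pos_of_pos hlogpos _
  have hαδ : 0 ≤ α * (1 + 1 / r ^ 3) := by positivity
  have hunsat : ∀ j : ℕ, 9 ≤ j → m + n ≤ 3 * j → clauseProb k j β ≤ 1 / 2 →
      Pn k j β 0 ≤ C / Real.log j ^ (1 + ε) →
      Pn k j (α * (1 + 1 / r ^ 3)) 0 ≤ C * 2 ^ (1 + ε) / ℓ := by
    intro j hj hmnj hpj hPj
    refine (Pn_zero_mono hαδ hmarg.le (by linarith)).trans (hPj.trans ?_)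
    have hj0 : (0 : ℝ) < j := by positivity
    have hlj : 0 < Real.log j := Real.log_pos (by exact_mod_cast (by omega : 1 < j))
    have h1 : Real.log (m + n : ℕ) ≤ 2 * Real.log j := by
      have : ((m + n : ℕ) : ℝ) ≤ (j : ℝ) ^ 2 := by exact_mod_cast (by nlinarith : m + n ≤ j ^ 2)
      have := Real.log_le_log (by positivity) this
      rwa [Real.log_pow] at this
    have h2 : ℓ ≤ 2 ^ (1 + ε) * Real.log j ^ (1 + ε) := by
      rw [← Real.mul_rpow (by norm_num) hlj.le]
      exact Real.rpow_le_rpow hlogpos.le h1 (by positivity)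
    rw [div_le_div_iff₀ (Real.rpow_pos_of_pos hlj _) hℓ, mul_assoc]
    gcongr
  have hpr : ∀ j : ℕ, clauseProb k j β ≤ 1 / 2 →
      clauseProb k j (α * (1 + 1 / r ^ 3)) ≤ 1 / 2 :=
    fun j hj => (clauseProb_mono hmarg.le).trans hj
  refine expLog_add_le_of_root hα hk (by positivity) hkm hmn hnm hr1 hr4 hr2
    (hr3.trans (le_self_pow₀ hr1 (by norm_num))) hℓ ?_ (hpr m hpm) (hpr n hpn)
    (hunsat m hm9 (by omega) hpm hPm) (hunsat n (by omega) (by omega) hpn hPn)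
  rw [le_div_iff₀ hℓ, ← hr4]
  calc r ^ 3 * ℓ ≤ r ^ 3 * r := by gcongr
    _ = r ^ 4 := by ring

/-- Below the threshold, the regularized expected log-number of solutions has a linear rate. -/
lemma exists_tendsto_expLog_div {α β C ε : ℝ} (hk : 2 ≤ k) (hα : 0 ≤ α) (hαβ : α < β)
    (hC : 0 ≤ C) (hε : 0 < ε)
    (hP : ∀ᶠ n : ℕ in atTop, Pn k n β 0 ≤ C / Real.log n ^ (1 + ε)) :
    ∃ L, Tendsto (fun n : ℕ => expLog k n α / n) atTop (𝓝 L) := by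
  obtain ⟨D, hD, h⟩ := exists_expLog_almost_superadditive hk hα hαβ hC hε hP
  obtain ⟨n₀, ⟨hadd, hp⟩, hn₀⟩ := ((h.and (eventually_forall_ge_atTop.2
    (eventually_clauseProb_le hk hα one_pos))).and (eventually_ge_atTop 1)).exists
  refine exists_tendsto_div_of_almost_superadditive (n₀ := n₀) (B := 2) hε hD (fun n hn => ?_) hadd
  have hn1 : (1 : ℝ) ≤ n := by exact_mod_cast hn₀.trans hn
  rw [abs_of_nonneg (expLog_nonneg hα (hp n hn))]
  refine (expLog_le hα (hp n hn)).trans ?_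
  nlinarith [Real.log_two_lt_d9]

/-- The conditional expectation of `log Z` is within `log 2` of that of `log (1 + Z)`. -/
lemma abs_sum_log_sub_expLog_le {n : ℕ} {α : ℝ} (hα : 0 ≤ α) (hp : clauseProb k n α ≤ 1) :
    |(∑ F : Finset (Clause n k), if 1 ≤ Z F then wt n k α F * Real.log (Z F) else 0) -
      expLog k n α| ≤ Real.log 2 := by
  have hw : ∀ F : Finset (Clause n k), 0 ≤ wt n k α F := fun F => by
    rw [wt_eq_prodWt]
    exact prodWt_nonneg (fun _ => clauseProb_nonneg hα) (fun _ => hp) F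
  have hsum : ∑ F : Finset (Clause n k), wt n k α F = 1 := by
    simp only [wt_eq_prodWt]
    exact sum_prodWt _
  have hlog : 0 ≤ Real.log 2 := Real.log_nonneg (by norm_num)
  rw [expLog, prodExp, ← Finset.sum_sub_distrib]
  refine (Finset.abs_sum_le_sum_abs _ _).trans ?_
  refine le_trans (Finset.sum_le_sum (g := fun F => wt n k α F * Real.log 2) fun F _ => ?_)
    (by rw [← Finset.sum_mul, hsum, one_mul])
  rw [← wt_eq_prodWt]
  split_ifs with h
  · have h1 : (1 : ℝ) ≤ Z F := by exact_mod_cast h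
    rw [← mul_sub, abs_mul, abs_of_nonneg (hw F)]
    refine mul_le_mul_of_nonneg_left ?_ (hw F)
    have h2 : Real.log (Z F) ≤ Real.log (1 + Z F) := Real.log_le_log (by linarith) (by linarith)
    have h3 : Real.log (1 + Z F) ≤ Real.log 2 + Real.log (Z F) := by
      rw [← Real.log_mul (by norm_num) (by positivity)]
      exact Real.log_le_log (by linarith) (by linarith)
    rw [abs_sub_comm, abs_of_nonneg (by linarith)]
    linarith
  · have h0 : Z F = 0 := by omega
    simp only [h0, Nat.cast_zero, add_zero, Real.log_one, mul_zero, sub_zero, abs_zero]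
    exact mul_nonneg (hw F) hlog

lemma sum_satisfiable_eq {n : ℕ} (α : ℝ) :
    (∑ F : Finset (Clause n k), if 1 ≤ Z F then wt n k α F else 0) = 1 - Pn k n α 0 := by
  rw [Pn_zero_eq, prodExp, eq_sub_iff_add_eq, ← Finset.sum_add_distrib]
  refine Eq.trans ?_ (sum_prodWt fun _ : Clause n k => clauseProb k n α)
  refine Finset.sum_congr rfl fun F _ => ?_
  rw [wt_eq_prodWt]
  by_cases h : Z F = 0
  · simp [h]
  · rw [if_pos (Nat.one_le_iff_ne_zero.2 h), if_neg h, mul_zero, add_zero]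

lemma tendsto_Pn_zero {α β C ε : ℝ} (hk : 2 ≤ k) (hα : 0 ≤ α) (hαβ : α ≤ β) (hε : 0 < ε)
    (hP : ∀ᶠ n : ℕ in atTop, Pn k n β 0 ≤ C / Real.log n ^ (1 + ε)) :
    Tendsto (fun n : ℕ => Pn k n α 0) atTop (𝓝 0) := by
  have hlim : Tendsto (fun n : ℕ => C / Real.log n ^ (1 + ε)) atTop (𝓝 0) :=
    ((tendsto_rpow_atTop (by linarith)).comp
      (Real.tendsto_log_atTop.comp tendsto_natCast_atTop_atTop)).const_div_atTop C
  have hp := eventually_clauseProb_le hk (hα.trans hαβ) (show (0 : ℝ) < 1 / 2 by norm_num)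
  refine tendsto_of_tendsto_of_tendsto_of_le_of_le' tendsto_const_nhds hlim ?_ ?_
  · filter_upwards [hp] with n h
    exact Pn_zero_nonneg hα ((clauseProb_mono hαβ).trans (by linarith))
  · filter_upwards [hp, hP] with n h h'
    exact (Pn_zero_mono hα hαβ (by linarith)).trans h'

end Threshold

/-- **Convergence of the expected log-number of solutions.**
For every `α ∈ [0, α*)`, the sequence `ψ_n(α) = (1/n) E[log Z(F(n,α)) | Z(F(n,α)) ≥ 1]`
converges as `n → ∞` to a limit `φ_s(α)`. -/
theorem psin_converges (k : ℕ) (hk : 2 ≤ k) (α : ℝ) (hα0 : 0 ≤ α) (hα : α < alphaStar k) :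
    ∃ φs : ℝ, Tendsto (fun n : ℕ => psin k n α) atTop (𝓝 φs) := by
  have hne : {α : ℝ | ∃ ε : ℝ, 0 < ε ∧ ∃ C : ℝ,
      ∀ᶠ (n : ℕ) in atTop, Pn k n α 0 ≤ C / Real.log n ^ (1 + ε)}.Nonempty := by
    rw [Set.nonempty_iff_ne_empty]
    intro h
    rw [alphaStar, h, Real.sSup_empty] at hα
    linarith
  obtain ⟨β, ⟨ε, hε, C, hP⟩, hαβ⟩ := exists_lt_of_lt_csSup hne hα
  have hP' : ∀ᶠ n : ℕ in atTop, Pn k n β 0 ≤ |C| / Real.log n ^ (1 + ε) := by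
    filter_upwards [hP] with n h
    refine h.trans (div_le_div_of_nonneg_right (le_abs_self C) ?_)
    exact Real.rpow_nonneg (Real.log_natCast_nonneg n) _
  obtain ⟨L, hL⟩ := exists_tendsto_expLog_div hk hα0 hαβ (abs_nonneg C) hε hP'
  have hdiff : Tendsto (fun n : ℕ => ((∑ F : Finset (Clause n k),
      if 1 ≤ Z F then wt n k α F * Real.log (Z F) else 0) - expLog k n α) / n) atTop (𝓝 0) := by
    refine squeeze_zero_norm' ?_ (tendsto_const_div_atTop_nhds_zero_nat (Real.log 2))
    filter_upwards [eventually_clauseProb_le hk hα0 one_pos] with n h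
    rw [norm_div, Real.norm_natCast]
    exact div_le_div_of_nonneg_right (abs_sum_log_sub_expLog_le hα0 h) (Nat.cast_nonneg n)
  have hsat : Tendsto (fun n : ℕ => 1 - Pn k n α 0) atTop (𝓝 (1 - 0)) :=
    tendsto_const_nhds.sub (tendsto_Pn_zero hk hα0 hαβ.le hε hP)
  refine ⟨(L + 0) / (1 - 0), ((hL.add hdiff).div hsat (by norm_num)).congr fun n => ?_⟩
  simp only [Pi.div_apply]
  rw [psin, sum_satisfiable_eq, ← add_div, add_sub_cancel, one_div, inv_mul_eq_div,
    div_right_comm]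
end
end

section
/- Fix an integer k ≥ 2 and α > 0, and let Z_n := Z(F(n,α)) denote the number of satisfying assignments of the random k-SAT formula F(n,α). Then for all integers n₁, n₂ ≥ k, with Z_{n₁} and Z_{n₂} independent, E[log(1 + Z_{n₁+n₂})] ≥ E[log(1 + Z_{n₁} Z_{n₂})]. -/
open Filter
open scoped Classical Topology BigOperators

noncomputable section

/-- A `k`-SAT clause in the Poisson model: `k` variable indices chosen in `Fin n`
together with a polarity for each of the `k` literals. -/
abbrev ClauseS (n k : ℕ) : Type := (Fin k → Fin n) × (Fin k → Bool)

/-- An assignment satisfies a clause iff one of its `k` literals evaluates to true. -/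
def satS {n k : ℕ} (x : Fin n → Bool) (c : ClauseS n k) : Prop :=
  ∃ j : Fin k, x (c.1 j) = c.2 j

/-- The number of assignments satisfying all the clauses `f 0, …, f (m-1)`. -/
def ZS {n k m : ℕ} (f : Fin m → ClauseS n k) : ℕ :=
  (Finset.univ.filter fun x : Fin n → Bool => ∀ a : Fin m, satS x (f a)).card

/-- `E[log(1 + Z(F(n,α)))]` for the random `k`-SAT formula `F(n,α)` with a
Poisson(αn) number of clauses, each clause drawn independently and uniformly. -/
def ElogZ (k n : ℕ) (α : ℝ) : ℝ :=
  ∑' m : ℕ, ProbabilityTheory.poissonPMFReal (Real.toNNReal (α * n)) m *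
    ((∑ f : Fin m → ClauseS n k, Real.log (1 + (ZS f : ℝ))) /
      (Fintype.card (ClauseS n k) : ℝ) ^ m)

/-- `E[log(1 + Z_{n₁} Z_{n₂})]` for two independent Poisson random `k`-SAT formulas on
disjoint sets of `n₁` and `n₂` variables, both with clause density `α`. -/
def ElogZprod (k n₁ n₂ : ℕ) (α : ℝ) : ℝ :=
  ∑' m₁ : ℕ, ∑' m₂ : ℕ,
    ProbabilityTheory.poissonPMFReal (Real.toNNReal (α * n₁)) m₁ *
      ProbabilityTheory.poissonPMFReal (Real.toNNReal (α * n₂)) m₂ *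
      ((∑ f₁ : Fin m₁ → ClauseS n₁ k, ∑ f₂ : Fin m₂ → ClauseS n₂ k,
          Real.log (1 + (ZS f₁ : ℝ) * (ZS f₂ : ℝ))) /
        ((Fintype.card (ClauseS n₁ k) : ℝ) ^ m₁ * (Fintype.card (ClauseS n₂ k) : ℝ) ^ m₂))

/-- The operator replacing a function `h` of a finite set by the average of `h` over the subsets
cut out by a uniformly random constraint. -/
def avgFilter {C X : Type*} [Fintype C] [Fintype X] (p : C → X → Prop) :
    (Finset X → ℝ) →L[ℝ] (Finset X → ℝ) :=
  LinearMap.toContinuousLinearMap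
    { toFun := fun h S => (∑ c, h (S.filter (p c))) / (Fintype.card C : ℝ)
      map_add' := fun g h => by
        ext S
        simp [Finset.sum_add_distrib, add_div]
      map_smul' := fun a h => by
        ext S
        simp [← Finset.mul_sum, mul_div_assoc] }

lemma avgFilter_apply {C X : Type*} [Fintype C] [Fintype X] (p : C → X → Prop)
    (h : Finset X → ℝ) (S : Finset X) :
    avgFilter p h S = (∑ c, h (S.filter (p c))) / (Fintype.card C : ℝ) := rfl

lemma avgFilter_commute {C D X : Type*} [Fintype C] [Fintype D] [Fintype X]
    (p : C → X → Prop) (q : D → X → Prop) : Commute (avgFilter p) (avgFilter q) := by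
  ext h S
  simp only [mul_apply_eq_comp, avgFilter_apply, ← Finset.sum_div, Finset.filter_filter]
  rw [Finset.sum_comm, div_right_comm]
  simp only [and_comm]

lemma avgFilter_nonneg {C X : Type*} [Fintype C] [Fintype X] (p : C → X → Prop)
    {h : Finset X → ℝ} (hh : 0 ≤ h) : 0 ≤ avgFilter p h := fun S => by
  rw [avgFilter_apply]
  exact div_nonneg (Finset.sum_nonneg fun c _ => hh _) (Nat.cast_nonneg _)

lemma avgFilter_pow_apply {C X : Type*} [Fintype C] [Fintype X] (p : C → X → Prop) (m : ℕ)
    (h : Finset X → ℝ) (S : Finset X) :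
    (avgFilter p ^ m) h S =
      (∑ f : Fin m → C, h (S.filter fun x => ∀ a, p (f a) x)) / (Fintype.card C : ℝ) ^ m := by
  induction m generalizing S with
  | zero => simp
  | succ m ih =>
    rw [pow_succ', mul_apply_eq_comp, avgFilter_apply,
      ← (Fin.consEquiv fun _ => C).sum_comp, Fintype.sum_prod_type]
    simp only [ih, ← Finset.sum_div, Finset.filter_filter, Fin.consEquiv_apply,
      Fin.forall_fin_succ, Fin.cons_zero, Fin.cons_succ]
    rw [div_div, pow_succ]

section Exponential

variable {ι : Type*} [Fintype ι]

lemma hasSum_exp_apply (A : (ι → ℝ) →L[ℝ] (ι → ℝ)) (h : ι → ℝ) :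
    HasSum (fun n : ℕ => (n.factorial : ℝ)⁻¹ • (A ^ n) h) (NormedSpace.exp A h) := by
  simpa using (NormedSpace.exp_series_hasSum_exp' (𝕂 := ℝ) A).mapL
    (ContinuousLinearMap.apply ℝ (ι → ℝ) h)

lemma exp_apply_le_of_commute {A B : (ι → ℝ) →L[ℝ] (ι → ℝ)} (hAB : Commute A B)
    (hA : ∀ h, 0 ≤ h → 0 ≤ A h) (hB : ∀ h, 0 ≤ h → 0 ≤ B h) {h : ι → ℝ} (hle : B h ≤ A h) :
    NormedSpace.exp B h ≤ NormedSpace.exp A h := by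
  have hApow : ∀ (n : ℕ) g, 0 ≤ g → 0 ≤ (A ^ n) g := by
    intro n
    induction n with
    | zero => intro g hg; simpa using hg
    | succ n ih =>
      intro g hg
      rw [pow_succ, mul_apply_eq_comp]
      exact ih _ (hA _ hg)
  have hpow : ∀ n : ℕ, (B ^ n) h ≤ (A ^ n) h := by
    intro n
    induction n with
    | zero => simp
    | succ n ih =>
      have h1 : B ((B ^ n) h) ≤ B ((A ^ n) h) := by
        have := hB _ (sub_nonneg.2 ih)
        rwa [map_sub, sub_nonneg] at this
      have h2 : (A ^ n) (B h) ≤ (A ^ n) (A h) := by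
        have := hApow n _ (sub_nonneg.2 hle)
        rwa [map_sub, sub_nonneg] at this
      have h3 : B ((A ^ n) h) = (A ^ n) (B h) := by
        rw [← mul_apply_eq_comp, ← mul_apply_eq_comp,
          (hAB.pow_left n).eq]
      rw [pow_succ' B, pow_succ A, mul_apply_eq_comp, mul_apply_eq_comp]
      exact h1.trans (h3.le.trans h2)
  intro i
  refine hasSum_le (fun n => ?_) (Pi.hasSum.1 (hasSum_exp_apply B h) i)
    (Pi.hasSum.1 (hasSum_exp_apply A h) i)
  exact mul_le_mul_of_nonneg_left (hpow n i) (by positivity)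

lemma hasSum_poissonPMFReal_smul_pow_apply (A : (ι → ℝ) →L[ℝ] (ι → ℝ)) {r : ℝ} (hr : 0 ≤ r)
    (h : ι → ℝ) :
    HasSum (fun m : ℕ => ProbabilityTheory.poissonPMFReal r.toNNReal m • (A ^ m) h)
      (Real.exp (-r) • NormedSpace.exp (r • A) h) := by
  convert (hasSum_exp_apply (r • A) h).const_smul (Real.exp (-r)) using 1
  ext m i
  simp only [ProbabilityTheory.poissonPMFReal, Real.coe_toNNReal r hr, smul_pow,
    smul_apply, Pi.smul_apply, smul_eq_mul]
  ring

lemma tsum_poissonPMFReal_mul_pow_apply (A : (ι → ℝ) →L[ℝ] (ι → ℝ)) {r : ℝ} (hr : 0 ≤ r)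
    (h : ι → ℝ) (i : ι) :
    ∑' m : ℕ, ProbabilityTheory.poissonPMFReal r.toNNReal m * (A ^ m) h i =
      Real.exp (-r) * NormedSpace.exp (r • A) h i :=
  (Pi.hasSum.1 (hasSum_poissonPMFReal_smul_pow_apply A hr h) i).tsum_eq

end Exponential

lemma card_clauseS (n k : ℕ) : (Fintype.card (ClauseS n k) : ℝ) = (2 * n) ^ k := by
  simp [mul_pow, mul_comm]

/-- The constraint on assignments to `V` imposed by a clause on `n` variables placed in `V`. -/
def satVia {V : Type*} {n k : ℕ} (e : Fin n → V) (c : ClauseS n k) (x : V → Bool) : Prop :=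
  satS (x ∘ e) c

/-- The weight of `v` for a tuple of assignments: the number of polarities
violated at `v` by all of them. -/
def disagreement {V : Type*} {r : ℕ} (y : Fin r → V → Bool) (v : V) : ℝ :=
  ∑ b : Bool, ∏ l, if y l v = b then 0 else 1

lemma disagreement_nonneg {V : Type*} {r : ℕ} (y : Fin r → V → Bool) (v : V) :
    0 ≤ disagreement y v :=
  Finset.sum_nonneg fun _ _ => Finset.prod_nonneg fun _ _ => by split_ifs <;> norm_num

lemma sum_card_not_satVia_pow {V : Type*} {n k : ℕ} (e : Fin n → V)
    (S : Finset (V → Bool)) (r : ℕ) :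
    ∑ c : ClauseS n k, ((S.filter fun x => ¬ satVia e c x).card : ℝ) ^ r =
      ∑ y ∈ Fintype.piFinset fun _ : Fin r => S, (∑ i, disagreement y (e i)) ^ k := by
  have hcard : ∀ c : ClauseS n k, ((S.filter fun x => ¬ satVia e c x).card : ℝ) =
      ∑ x ∈ S, ∏ j, if x (e (c.1 j)) = c.2 j then (0 : ℝ) else 1 := by
    intro c
    rw [Finset.card_filter]
    push_cast
    refine Finset.sum_congr rfl fun x _ => ?_
    by_cases hx : satVia e c x
    · obtain ⟨j, hj⟩ := id hx
      rw [if_neg (not_not.2 hx), Finset.prod_eq_zero (Finset.mem_univ j)]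
      exact if_pos hj
    · rw [if_pos hx, Finset.prod_eq_one]
      intro j _
      exact if_neg fun hj => hx ⟨j, hj⟩
  have hpow : ∀ c : ClauseS n k, ((S.filter fun x => ¬ satVia e c x).card : ℝ) ^ r =
      ∑ y ∈ Fintype.piFinset fun _ : Fin r => S,
        ∏ j, ∏ l, if y l (e (c.1 j)) = c.2 j then (0 : ℝ) else 1 := by
    intro c
    rw [hcard, Finset.sum_pow']
    exact Finset.sum_congr rfl fun y _ => Finset.prod_comm
  simp only [hpow]
  rw [Finset.sum_comm]
  refine Finset.sum_congr rfl fun y _ => ?_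
  simp only [disagreement]
  rw [← Fintype.sum_prod_type', Fintype.sum_pow,
    ← (Equiv.arrowProdEquivProdArrow (Fin k) (fun _ => Fin n) (fun _ => Bool)).sum_comp]
  rfl

lemma pow_convex_split {n₁ n₂ k : ℕ} (h₁ : 0 < n₁) (h₂ : 0 < n₂) {a b : ℝ}
    (ha : 0 ≤ a) (hb : 0 ≤ b) :
    ((n₁ + n₂ : ℕ) : ℝ) * ((a + b) ^ k / (2 * (n₁ + n₂ : ℕ) : ℝ) ^ k) ≤
      n₁ * (a ^ k / (2 * n₁) ^ k) + n₂ * (b ^ k / (2 * n₂) ^ k) := by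
  have p₁ : (0 : ℝ) < n₁ := by exact_mod_cast h₁
  have p₂ : (0 : ℝ) < n₂ := by exact_mod_cast h₂
  have key := (convexOn_pow (𝕜 := ℝ) k).2
    (Set.mem_Ici.2 (show 0 ≤ a / (2 * n₁) by positivity))
    (Set.mem_Ici.2 (show 0 ≤ b / (2 * n₂) by positivity))
    (show (0 : ℝ) ≤ n₁ / (n₁ + n₂) by positivity) (show (0 : ℝ) ≤ n₂ / (n₁ + n₂) by positivity)
    (by field_simp)
  have e1 : (n₁ / (n₁ + n₂) : ℝ) * (a / (2 * n₁)) + (n₂ / (n₁ + n₂) : ℝ) * (b / (2 * n₂)) =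
      (a + b) / (2 * (n₁ + n₂)) := by
    field_simp
  simp only [smul_eq_mul, e1] at key
  push_cast
  simp only [← div_pow]
  calc (n₁ + n₂ : ℝ) * ((a + b) / (2 * (n₁ + n₂))) ^ k
      ≤ (n₁ + n₂) * (n₁ / (n₁ + n₂) * (a / (2 * n₁)) ^ k
          + n₂ / (n₁ + n₂) * (b / (2 * n₂)) ^ k) := by gcongr
    _ = _ := by
      generalize (a / (2 * n₁)) ^ k = u
      generalize (b / (2 * n₂)) ^ k = v
      field_simp

lemma moment_not_satVia_le {n₁ n₂ k : ℕ} (h₁ : 0 < n₁) (h₂ : 0 < n₂)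
    (S : Finset (Fin (n₁ + n₂) → Bool)) (r : ℕ) :
    ((n₁ + n₂ : ℕ) : ℝ) * ((∑ c : ClauseS (n₁ + n₂) k,
        ((S.filter fun x => ¬ satVia id c x).card : ℝ) ^ r) / Fintype.card (ClauseS (n₁ + n₂) k)) ≤
      n₁ * ((∑ c : ClauseS n₁ k,
        ((S.filter fun x => ¬ satVia (Fin.castAdd n₂) c x).card : ℝ) ^ r)
          / Fintype.card (ClauseS n₁ k)) +
      n₂ * ((∑ c : ClauseS n₂ k,
        ((S.filter fun x => ¬ satVia (Fin.natAdd n₁) c x).card : ℝ) ^ r)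
          / Fintype.card (ClauseS n₂ k)) := by
  simp only [sum_card_not_satVia_pow, card_clauseS, Finset.sum_div, Finset.mul_sum,
    ← Finset.sum_add_distrib]
  refine Finset.sum_le_sum fun y _ => ?_
  simp only [id, Fin.sum_univ_add]
  exact pow_convex_split h₁ h₂ (Finset.sum_nonneg fun _ _ => disagreement_nonneg _ _)
    (Finset.sum_nonneg fun _ _ => disagreement_nonneg _ _)

/-- The function `S ↦ log (1 + |S|)` of a set of solutions. -/
def logCard {X : Type*} (S : Finset X) : ℝ := Real.log (1 + S.card)

lemma logCard_nonneg {X : Type*} (S : Finset X) : 0 ≤ logCard S :=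
  Real.log_nonneg (by simp)

lemma hasSum_avgFilter_logCard {C X : Type*} [Fintype C] [Nonempty C] [Fintype X]
    (p : C → X → Prop) (S : Finset X) :
    HasSum (fun r : ℕ => (((1 + S.card : ℝ) ^ (r + 1))⁻¹ / (r + 1)) *
      ((∑ c, ((S.filter fun x => ¬ p c x).card : ℝ) ^ (r + 1)) / Fintype.card C))
      (logCard S - avgFilter p logCard S) := by
  have hC : (Fintype.card C : ℝ) ≠ 0 := by exact_mod_cast Fintype.card_ne_zero
  have hpos : (0 : ℝ) < 1 + S.card := by positivity
  have hsum : ∀ c, HasSum (fun r : ℕ =>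
      (((S.filter fun x => ¬ p c x).card : ℝ) / (1 + S.card)) ^ (r + 1) / (r + 1))
      (logCard S - logCard (S.filter (p c))) := by
    intro c
    have hsplit : ((S.filter (p c)).card : ℝ) + (S.filter fun x => ¬ p c x).card = S.card := by
      exact_mod_cast Finset.card_filter_add_card_filter_not (s := S) (p c)
    have hlt : |((S.filter fun x => ¬ p c x).card : ℝ) / (1 + S.card)| < 1 := by
      rw [abs_of_nonneg (by positivity), div_lt_one hpos]
      have : (0 : ℝ) ≤ (S.filter (p c)).card := by positivity
      linarith
    convert Real.hasSum_pow_div_log_of_abs_lt_one hlt using 1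
    have : 1 - ((S.filter fun x => ¬ p c x).card : ℝ) / (1 + S.card) =
        (1 + (S.filter (p c)).card) / (1 + S.card) := by
      field_simp
      linarith
    rw [this, Real.log_div (by positivity) hpos.ne', logCard, logCard]
    ring
  have hterm : ∀ r : ℕ, (((1 + S.card : ℝ) ^ (r + 1))⁻¹ / (r + 1)) *
      ((∑ c, ((S.filter fun x => ¬ p c x).card : ℝ) ^ (r + 1)) / Fintype.card C) =
      (∑ c, (((S.filter fun x => ¬ p c x).card : ℝ) / (1 + S.card)) ^ (r + 1) / (r + 1)) /
        Fintype.card C := by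
    intro r
    generalize (1 + S.card : ℝ) = t
    simp only [div_eq_mul_inv, Finset.sum_mul, Finset.mul_sum]
    refine Finset.sum_congr rfl fun c _ => ?_
    ring
  have hval : logCard S - avgFilter p logCard S =
      (∑ c, (logCard S - logCard (S.filter (p c)))) / Fintype.card C := by
    rw [avgFilter_apply, Finset.sum_sub_distrib, sub_div]
    simp [hC]
  rw [funext hterm, hval]
  exact (hasSum_sum fun c _ => hsum c).div_const _

lemma avgFilter_logCard_le {n₁ n₂ : ℕ} (k : ℕ) (h₁ : 0 < n₁) (h₂ : 0 < n₂)
    (S : Finset (Fin (n₁ + n₂) → Bool)) :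
    n₁ * avgFilter (satVia (k := k) (Fin.castAdd n₂)) logCard S +
        n₂ * avgFilter (satVia (k := k) (Fin.natAdd n₁)) logCard S ≤
      ((n₁ + n₂ : ℕ) : ℝ) * avgFilter (satVia (k := k) id) logCard S := by
  have : Nonempty (Fin n₁) := ⟨⟨0, h₁⟩⟩
  have : Nonempty (Fin n₂) := ⟨⟨0, h₂⟩⟩
  have : Nonempty (Fin (n₁ + n₂)) := ⟨⟨0, by omega⟩⟩
  have hs := (hasSum_avgFilter_logCard (satVia (k := k) (id : Fin (n₁ + n₂) → _)) S).mul_left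
    (((n₁ + n₂ : ℕ) : ℝ))
  have hs₁ := (hasSum_avgFilter_logCard (satVia (k := k) (Fin.castAdd n₂ : Fin n₁ → _)) S).mul_left
    (n₁ : ℝ)
  have hs₂ := (hasSum_avgFilter_logCard (satVia (k := k) (Fin.natAdd n₁ : Fin n₂ → _)) S).mul_left
    (n₂ : ℝ)
  have := hasSum_le (fun r => ?_) hs (hs₁.add hs₂)
  · push_cast at this ⊢
    linarith
  · have := mul_le_mul_of_nonneg_left (moment_not_satVia_le (k := k) h₁ h₂ S (r + 1))
      (show (0 : ℝ) ≤ ((1 + S.card : ℝ) ^ (r + 1))⁻¹ / (r + 1) by positivity)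
    linarith

lemma ElogZ_eq {k n : ℕ} {α : ℝ} (hα : 0 ≤ α) :
    ElogZ k n α = Real.exp (-(α * n)) *
      NormedSpace.exp ((α * n) • avgFilter (satVia (k := k) (id : Fin n → Fin n)))
        logCard Finset.univ := by
  rw [← tsum_poissonPMFReal_mul_pow_apply _ (by positivity)]
  simp only [ElogZ, avgFilter_pow_apply]
  rfl

lemma card_filter_split {k n₁ n₂ m₁ m₂ : ℕ} (f₁ : Fin m₁ → ClauseS n₁ k)
    (f₂ : Fin m₂ → ClauseS n₂ k) :
    (((Finset.univ : Finset (Fin (n₁ + n₂) → Bool)).filter fun x =>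
      (∀ a, satVia (Fin.castAdd n₂) (f₁ a) x)).filter fun x =>
      (∀ a, satVia (Fin.natAdd n₁) (f₂ a) x)).card = ZS f₁ * ZS f₂ := by
  rw [ZS, ZS, ← Finset.card_product]
  symm
  refine Finset.card_equiv (Fin.appendEquiv n₁ n₂) fun x => ?_
  have e₁ : Fin.append x.1 x.2 ∘ Fin.castAdd n₂ = x.1 := by ext i; simp
  have e₂ : Fin.append x.1 x.2 ∘ Fin.natAdd n₁ = x.2 := by ext i; simp
  rw [Finset.mem_filter, Finset.mem_filter, Finset.mem_product, Finset.mem_filter,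
    Finset.mem_filter]
  change _ ↔ (_ ∧ ∀ a, satS (Fin.append x.1 x.2 ∘ Fin.castAdd n₂) (f₁ a)) ∧
    ∀ a, satS (Fin.append x.1 x.2 ∘ Fin.natAdd n₁) (f₂ a)
  rw [e₁, e₂]
  simp

lemma ElogZprod_eq {k n₁ n₂ : ℕ} {α : ℝ} (hα : 0 ≤ α) :
    ElogZprod k n₁ n₂ α = Real.exp (-(α * n₁)) * (Real.exp (-(α * n₂)) *
      NormedSpace.exp ((α * n₁) • avgFilter (satVia (k := k) (Fin.castAdd n₂ : Fin n₁ → _)))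
        (NormedSpace.exp ((α * n₂) • avgFilter (satVia (k := k) (Fin.natAdd n₁ : Fin n₂ → _)))
          logCard) Finset.univ) := by
  have hsum := hasSum_poissonPMFReal_smul_pow_apply
    (avgFilter (satVia (k := k) (Fin.natAdd n₁ : Fin n₂ → _)))
    (show 0 ≤ α * n₂ by positivity) logCard
  rw [← smul_eq_mul (Real.exp (-(α * n₂))), ← Pi.smul_apply, ← map_smul,
    ← tsum_poissonPMFReal_mul_pow_apply _ (by positivity), ElogZprod]
  congr 1
  ext m₁
  have hsum' := (Pi.hasSum.1 (hsum.mapL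
    (avgFilter (satVia (k := k) (Fin.castAdd n₂ : Fin n₁ → _)) ^ m₁)) Finset.univ).mul_left
      (ProbabilityTheory.poissonPMFReal (α * n₁).toNNReal m₁)
  rw [← hsum'.tsum_eq]
  congr 1
  ext m₂
  rw [map_smul, Pi.smul_apply, smul_eq_mul, ← mul_assoc, avgFilter_pow_apply]
  simp only [avgFilter_pow_apply, logCard, card_filter_split, Nat.cast_mul]
  rw [← Finset.sum_div, div_div, mul_comm ((Fintype.card (ClauseS n₂ k) : ℝ) ^ m₂)]

/-- **Pseudo-superadditivity of `E log(1+Z)` for random `k`-SAT** (interpolation lemma):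
for all `n₁, n₂ ≥ k`, `E[log(1 + Z_{n₁+n₂})] ≥ E[log(1 + Z_{n₁} Z_{n₂})]`. -/
theorem kSAT_interpolation (k : ℕ) (hk : 2 ≤ k) (α : ℝ) (hα : 0 < α)
    (n₁ n₂ : ℕ) (h₁ : k ≤ n₁) (h₂ : k ≤ n₂) :
    ElogZprod k n₁ n₂ α ≤ ElogZ k (n₁ + n₂) α := by
  have p₁ : 0 < n₁ := by omega
  have p₂ : 0 < n₂ := by omega
  let : NormedAlgebra ℚ ((Finset (Fin (n₁ + n₂) → Bool) → ℝ) →L[ℝ]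
      (Finset (Fin (n₁ + n₂) → Bool) → ℝ)) := NormedAlgebra.restrictScalars ℚ ℝ _
  rw [ElogZ_eq hα.le, ElogZprod_eq hα.le, ← mul_assoc, ← Real.exp_add,
    ← mul_apply_eq_comp, ← NormedSpace.exp_add_of_commute
      (((avgFilter_commute _ _).smul_left _).smul_right _)]
  have hE : -(α * n₁) + -(α * n₂) = -(α * (n₁ + n₂ : ℕ)) := by push_cast; ring
  rw [hE]
  refine mul_le_mul_of_nonneg_left (exp_apply_le_of_commute ?_ ?_ ?_ ?_ _) (Real.exp_nonneg _)
  · exact (((avgFilter_commute _ _).smul_left _).smul_right _).add_right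
      (((avgFilter_commute _ _).smul_left _).smul_right _)
  · intro h hh
    rw [smul_apply]
    exact smul_nonneg (by positivity) (avgFilter_nonneg _ hh)
  · intro h hh
    rw [add_apply, smul_apply, smul_apply]
    exact add_nonneg (smul_nonneg (by positivity) (avgFilter_nonneg _ hh))
      (smul_nonneg (by positivity) (avgFilter_nonneg _ hh))
  · intro S
    have := mul_le_mul_of_nonneg_left (avgFilter_logCard_le k p₁ p₂ S) hα.le
    simp only [add_apply, smul_apply, Pi.add_apply,
      Pi.smul_apply, smul_eq_mul]
    linarith
end
end

section
/- Let μ be a clause type distribution satisfying hypothesis H2 and fix α > 0. Let Z_n := Z(F(α,n,μ)) be the number of satisfying assignments of a random formula from the ensemble F(α,n,μ) (with Poisson(αn) many clauses). Then for all integers n₁, n₂ ≥ k, with Z_{n₁}, Z_{n₂} independent, E[log(1 + Z_{n₁+n₂})] ≥ E[log(1 + Z_{n₁} Z_{n₂})]. -/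
open Filter
open scoped Classical Topology BigOperators

noncomputable section

/-- A clause type on `k` Boolean variables: a Boolean function `{-1,+1}^k → {0,1}`
(we encode `{-1,+1}` by `Bool`, `true ↔ +1`, and `{0,1}` by `Bool`). -/
abbrev CT (k : ℕ) : Type := (Fin k → Bool) → Bool

/-- `μ` is a probability distribution on the finite type `ι`. -/
def IsPMF {ι : Type*} [Fintype ι] (μ : ι → ℝ) : Prop :=
  (∀ i, 0 ≤ μ i) ∧ ∑ i, μ i = 1

/-- A clause of a general CSP formula: `k` variable indices together with a clause type. -/
abbrev ClauseG (n k : ℕ) : Type := (Fin k → Fin n) × CT k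

/-- An assignment satisfies a clause iff the clause type evaluates to `1` on the
values of the chosen variables. -/
def satC {n k : ℕ} (x : Fin n → Bool) (c : ClauseG n k) : Prop :=
  c.2 (fun j => x (c.1 j)) = true

/-- The number of assignments satisfying all the clauses `f 0, …, f (m-1)`. -/
def ZC {n k m : ℕ} (f : Fin m → ClauseG n k) : ℕ :=
  (Finset.univ.filter fun x : Fin n → Bool => ∀ a : Fin m, satC x (f a)).card

/-- The probability of drawing the clauses `f 0, …, f (m-1)` when each clause has its `k`
indices i.i.d. uniform in `Fin n` and its clause type drawn from `μ`, independently. -/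
def wG {n k m : ℕ} (μ : CT k → ℝ) (f : Fin m → ClauseG n k) : ℝ :=
  ∏ a : Fin m, ((1 : ℝ) / (n : ℝ) ^ k) * μ (f a).2

/-- `P_n(α, φ, μ) = ℙ{Z(F(α,n,μ)) < 2^{nφ}}` for the ensemble with `⌊αn⌋` clauses. -/
def PnG (k n : ℕ) (α φ : ℝ) (μ : CT k → ℝ) : ℝ :=
  ∑ f : Fin ⌊α * (n : ℝ)⌋₊ → ClauseG n k,
    if (ZC f : ℝ) < (2 : ℝ) ^ ((n : ℝ) * φ) then wG μ f else 0

/-- `α*(μ) = sup{α : P_n(α,0,μ) = O(1/(log n)^{1+ε}) for some ε > 0}`. -/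
def alphaStarG (k : ℕ) (μ : CT k → ℝ) : ℝ :=
  sSup {α : ℝ | ∃ ε : ℝ, 0 < ε ∧ ∃ C : ℝ,
    ∀ᶠ (n : ℕ) in atTop, PnG k n α 0 μ ≤ C / Real.log n ^ (1 + ε)}

/-- `v_θ(x) = ∏ᵢ (1 + xᵢ θ)/2`, the biased product measure on `{-1,1}^k`. -/
def vtheta {k : ℕ} (θ : ℝ) (x : Fin k → Bool) : ℝ :=
  ∏ i : Fin k, (1 + (if x i then (1 : ℝ) else -1) * θ) / 2

/-- `‖φ‖_θ² = ∑_x φ(x)² v_θ(x)`, the `v_θ`-probability that the clause type is satisfied. -/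
def normSq {k : ℕ} (φ : CT k) (θ : ℝ) : ℝ :=
  ∑ x : Fin k → Bool, (if φ x then (1 : ℝ) else 0) * vtheta θ x

/-- Hypothesis H1: (a) dominance of balanced assignments, i.e. for all `θ ∈ [-1,1]`,
`E_φ log ‖φ‖_θ ≤ E_φ log ‖φ‖` with equality only at `θ = 0`; and (b) unsatisfiability of
uniform assignments: for each `s ∈ {-1,+1}` some clause type in the support of `μ`
vanishes at `(s,…,s)`. -/
def H1 (k : ℕ) (μ : CT k → ℝ) : Prop :=
  (∀ θ ∈ Set.Icc (-1 : ℝ) 1,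
    (∑ φ : CT k, μ φ * Real.log (Real.sqrt (normSq φ θ))) ≤
        (∑ φ : CT k, μ φ * Real.log (Real.sqrt (normSq φ 0))) ∧
      ((∑ φ : CT k, μ φ * Real.log (Real.sqrt (normSq φ θ))) =
          (∑ φ : CT k, μ φ * Real.log (Real.sqrt (normSq φ 0))) → θ = 0)) ∧
  (∀ s : Bool, ∃ φ : CT k, 0 < μ φ ∧ φ (fun _ => s) = false)

/-- `Γ_l(ν) = E_φ E ∏_{r=1}^l (1 - φ(Z^{(r)}))`, where `Z_i = (Z_i^{(1)},…,Z_i^{(l)})`,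
`i = 1,…,k`, are i.i.d. with distribution `ν` on `{-1,1}^l` and `φ ~ μ`. -/
def Gam (k : ℕ) (μ : CT k → ℝ) (l : ℕ) (ν : (Fin l → Bool) → ℝ) : ℝ :=
  ∑ φ : CT k, μ φ *
    ∑ z : Fin k → Fin l → Bool,
      (∏ i : Fin k, ν (z i)) * ∏ r : Fin l, (if φ (fun i => z i r) then (0 : ℝ) else 1)

/-- Hypothesis H2: `Γ_l` is convex on the simplex of probability measures on `{-1,1}^l`,
for every `l ≥ 1`. -/
def H2 (k : ℕ) (μ : CT k → ℝ) : Prop :=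
  ∀ l : ℕ, 1 ≤ l → ConvexOn ℝ (stdSimplex ℝ (Fin l → Bool)) (Gam k μ l)

/-- `E[log(1 + Z(F(α,n,μ)))]` for the ensemble with a Poisson(αn) number of clauses. -/
def ElogG (k n : ℕ) (α : ℝ) (μ : CT k → ℝ) : ℝ :=
  ∑' m : ℕ, ProbabilityTheory.poissonPMFReal (Real.toNNReal (α * n)) m *
    ∑ f : Fin m → ClauseG n k, wG μ f * Real.log (1 + (ZC f : ℝ))

/-- `E[log(1 + Z_{n₁} Z_{n₂})]` for two independent Poisson ensembles on disjoint sets of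
`n₁` and `n₂` variables, both with clause density `α` and clause type distribution `μ`. -/
def ElogGprod (k n₁ n₂ : ℕ) (α : ℝ) (μ : CT k → ℝ) : ℝ :=
  ∑' m₁ : ℕ, ∑' m₂ : ℕ,
    ProbabilityTheory.poissonPMFReal (Real.toNNReal (α * n₁)) m₁ *
      ProbabilityTheory.poissonPMFReal (Real.toNNReal (α * n₂)) m₂ *
      ∑ f₁ : Fin m₁ → ClauseG n₁ k, ∑ f₂ : Fin m₂ → ClauseG n₂ k,
        wG μ f₁ * wG μ f₂ * Real.log (1 + (ZC f₁ : ℝ) * (ZC f₂ : ℝ))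

section filterAverage

variable {X C D : Type*} [Fintype X] [Fintype C] [Fintype D]

/-- The operator averaging a function of a set `S` over the random subset `{x ∈ S | p c x}`,
where `c` has weight `w c`. -/
def filterAverage (w : C → ℝ) (p : C → X → Prop) : (Finset X → ℝ) →L[ℝ] (Finset X → ℝ) :=
  LinearMap.toContinuousLinearMap
    { toFun := fun H S => ∑ c, w c * H (S.filter (p c))
      map_add' := fun H H' => by
        ext S
        simp [mul_add, Finset.sum_add_distrib]
      map_smul' := fun r H => by
        ext S
        simp [Finset.mul_sum, mul_left_comm] }

theorem filterAverage_apply (w : C → ℝ) (p : C → X → Prop) (H : Finset X → ℝ) (S : Finset X) :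
    filterAverage w p H S = ∑ c, w c * H (S.filter (p c)) := rfl

theorem filterAverage_pow_apply (w : C → ℝ) (p : C → X → Prop) (m : ℕ) (H : Finset X → ℝ)
    (S : Finset X) :
    (filterAverage w p ^ m) H S =
      ∑ f : Fin m → C, (∏ a, w (f a)) * H (S.filter fun x => ∀ a, p (f a) x) := by
  induction m generalizing S with
  | zero => simp
  | succ m ih =>
    rw [pow_succ', mul_apply_eq_comp, filterAverage_apply,
      ← (Fin.consEquiv fun _ : Fin (m + 1) => C).sum_comp, Fintype.sum_prod_type]
    refine Finset.sum_congr rfl fun c _ => ?_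
    rw [ih, Finset.mul_sum]
    refine Finset.sum_congr rfl fun f _ => ?_
    simp [Fin.consEquiv, Fin.prod_univ_succ, Finset.filter_filter, Fin.forall_fin_succ, mul_assoc]

theorem commute_filterAverage (w : C → ℝ) (p : C → X → Prop) (v : D → ℝ) (q : D → X → Prop) :
    Commute (filterAverage w p) (filterAverage v q) := by
  ext H S
  simp only [mul_apply_eq_comp, filterAverage_apply, Finset.mul_sum,
    Finset.filter_filter]
  rw [Finset.sum_comm]
  refine Finset.sum_congr rfl fun c _ => Finset.sum_congr rfl fun d _ => ?_
  simp only [and_comm, mul_left_comm]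

theorem monotone_filterAverage {w : C → ℝ} (hw : ∀ c, 0 ≤ w c) (p : C → X → Prop) :
    Monotone (filterAverage w p) := fun _ _ h _ =>
  Finset.sum_le_sum fun c _ => mul_le_mul_of_nonneg_left (h _) (hw c)

end filterAverage

theorem Commute.pow_apply_le_pow_apply {E : Type*} [AddCommGroup E] [Module ℝ E]
    [TopologicalSpace E] [Preorder E] {A B : E →L[ℝ] E} (hAB : Commute A B) (hA : Monotone A)
    (hB : Monotone B) {G : E} (hG : B G ≤ A G) (m : ℕ) : (B ^ m) G ≤ (A ^ m) G := by
  induction m with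
  | zero => simp
  | succ m ih =>
    have hAm : Monotone (A ^ m : E →L[ℝ] E) := by
      rw [FunLike.coe_pow_eq_iterate]
      exact hA.iterate m
    calc (B ^ (m + 1)) G = B ((B ^ m) G) := by rw [pow_succ', mul_apply_eq_comp]
      _ ≤ B ((A ^ m) G) := hB ih
      _ = (A ^ m) (B G) := by
        rw [← mul_apply_eq_comp, ← (hAB.pow_left m).eq, mul_apply_eq_comp]
      _ ≤ (A ^ m) (A G) := hAm hG
      _ = (A ^ (m + 1)) G := by rw [pow_succ, mul_apply_eq_comp]

theorem hasSum_poissonPMFReal_smul_pow {R : Type*} [NormedRing R] [NormedAlgebra ℝ R]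
    [CompleteSpace R] (r : NNReal) (T : R) :
    HasSum (fun m => ProbabilityTheory.poissonPMFReal r m • T ^ m)
      (Real.exp (-r) • NormedSpace.exp ((r : ℝ) • T)) := by
  convert (NormedSpace.exp_series_hasSum_exp' (𝕂 := ℝ) ((r : ℝ) • T)).const_smul
    (Real.exp (-r)) using 2 with m
  rw [smul_pow, smul_smul, smul_smul, ProbabilityTheory.poissonPMFReal]
  congr 1
  ring

theorem hasSum_poissonPMFReal_mul_pow_apply {X : Type*} [Fintype X] (r : NNReal)
    (T : (X → ℝ) →L[ℝ] (X → ℝ)) (G : X → ℝ) (S : X) :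
    HasSum (fun m => ProbabilityTheory.poissonPMFReal r m * (T ^ m) G S)
      ((Real.exp (-r) • NormedSpace.exp ((r : ℝ) • T)) G S) :=
  (hasSum_poissonPMFReal_smul_pow r T).mapL
    ((ContinuousLinearMap.proj S).comp (ContinuousLinearMap.apply ℝ (X → ℝ) G))

/-- Poisson thinning. -/
theorem tsum_tsum_poissonPMFReal_mul_pow_apply {X : Type*} [Fintype X] (r₁ r₂ : NNReal)
    {T₁ T₂ T : (X → ℝ) →L[ℝ] (X → ℝ)} (hT : Commute T₁ T₂)
    (h : ((r₁ + r₂ : NNReal) : ℝ) • T = (r₁ : ℝ) • T₁ + (r₂ : ℝ) • T₂) (G : X → ℝ) (S : X) :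
    ∑' m₁, ∑' m₂, ProbabilityTheory.poissonPMFReal r₁ m₁ * ProbabilityTheory.poissonPMFReal r₂ m₂ *
        (T₁ ^ m₁) ((T₂ ^ m₂) G) S =
      ∑' m, ProbabilityTheory.poissonPMFReal (r₁ + r₂) m * (T ^ m) G S := by
  have inner (m₁ : ℕ) :
      HasSum (fun m₂ => ProbabilityTheory.poissonPMFReal r₁ m₁ *
        ProbabilityTheory.poissonPMFReal r₂ m₂ * (T₁ ^ m₁) ((T₂ ^ m₂) G) S)
      (ProbabilityTheory.poissonPMFReal r₁ m₁ *
        (T₁ ^ m₁) ((Real.exp (-r₂) • NormedSpace.exp ((r₂ : ℝ) • T₂)) G) S) := by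
    simp only [mul_assoc]
    refine HasSum.mul_left _ ?_
    simpa using (hasSum_poissonPMFReal_smul_pow r₂ T₂).mapL
      ((ContinuousLinearMap.proj (R := ℝ) (φ := fun _ : X => ℝ) S).comp
        ((T₁ ^ m₁).comp (ContinuousLinearMap.apply ℝ (X → ℝ) G)))
  let : NormedAlgebra ℚ ((X → ℝ) →L[ℝ] (X → ℝ)) := NormedAlgebra.restrictScalars ℚ ℝ _
  rw [tsum_congr fun m₁ => (inner m₁).tsum_eq,
    (hasSum_poissonPMFReal_mul_pow_apply r₁ T₁ _ S).tsum_eq,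
    (hasSum_poissonPMFReal_mul_pow_apply (r₁ + r₂) T G S).tsum_eq, h,
    NormedSpace.exp_add_of_commute ((hT.smul_left _).smul_right _), NNReal.coe_add, neg_add,
    Real.exp_add]
  simp [mul_assoc, mul_left_comm]

section Interpolation

variable {X C : Type*} [Fintype X] [Fintype C]

theorem sum_mul_card_filter_not_pow (w : C → ℝ) (p : C → X → Prop) (S : Finset X) (l : ℕ) :
    ∑ c, w c * ((S.filter fun x => ¬ p c x).card / (1 + S.card : ℝ)) ^ l =
      (1 / (1 + S.card : ℝ)) ^ l * ∑ y : Fin l → X, (∏ r, if y r ∈ S then (1 : ℝ) else 0) *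
        ∑ c, w c * ∏ r, if p c (y r) then (0 : ℝ) else 1 := by
  have hcard (c : C) : ((S.filter fun x => ¬ p c x).card : ℝ) =
      ∑ x, (if x ∈ S then (1 : ℝ) else 0) * if p c x then (0 : ℝ) else 1 := by
    simp only [Finset.natCast_card_filter, ite_mul, one_mul, zero_mul, Finset.sum_ite_mem,
      Finset.univ_inter, ite_not]
  simp only [div_pow, hcard, Fintype.sum_pow, Finset.prod_mul_distrib]
  simp only [Finset.sum_div, Finset.mul_sum]
  rw [Finset.sum_comm]
  refine Finset.sum_congr rfl fun y _ => Finset.sum_congr rfl fun c _ => ?_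
  ring

theorem hasSum_log_sub_filterAverage {w : C → ℝ} (hw : ∑ c, w c = 1) (p : C → X → Prop)
    (S : Finset X) :
    HasSum (fun l : ℕ => (∑ c, w c *
        ((S.filter fun x => ¬ p c x).card / (1 + S.card : ℝ)) ^ (l + 1)) / (l + 1))
      (Real.log (1 + S.card) -
        filterAverage w p (fun S' => Real.log (1 + (S'.card : ℝ))) S) := by
  have hS : (0 : ℝ) < 1 + S.card := by positivity
  have hlog (c : C) : HasSum (fun l : ℕ => w c *
      (((S.filter fun x => ¬ p c x).card / (1 + S.card : ℝ)) ^ (l + 1) / (l + 1)))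
      (w c * (Real.log (1 + S.card) - Real.log (1 + ((S.filter (p c)).card : ℝ)))) := by
    have hcard : (S.card : ℝ) = (S.filter (p c)).card + (S.filter fun x => ¬ p c x).card := by
      exact_mod_cast (Finset.card_filter_add_card_filter_not (s := S) (p c)).symm
    have hlt : |((S.filter fun x => ¬ p c x).card / (1 + S.card : ℝ))| < 1 := by
      rw [abs_of_nonneg (by positivity), div_lt_one hS, hcard]
      linarith [(Nat.cast_nonneg (S.filter (p c)).card : (0 : ℝ) ≤ _)]
    have hsub : 1 - ((S.filter fun x => ¬ p c x).card / (1 + S.card : ℝ)) =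
        (1 + (S.filter (p c)).card) / (1 + S.card) := by
      rw [eq_div_iff hS.ne', sub_mul, div_mul_cancel₀ _ hS.ne', hcard]
      ring
    have h := (Real.hasSum_pow_div_log_of_abs_lt_one hlt).mul_left (w c)
    rwa [hsub, Real.log_div (by positivity) hS.ne', neg_sub] at h
  convert hasSum_sum fun c (_ : c ∈ Finset.univ) => hlog c using 1
  · ext l
    simp only [Finset.sum_div, mul_div_assoc]
  · simp only [mul_sub, Finset.sum_sub_distrib, ← Finset.sum_mul, hw, one_mul,
      filterAverage_apply]

variable {k n : ℕ}

/-- The probability of a single random clause. -/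
def clauseWeight (μ : CT k → ℝ) (c : ClauseG n k) : ℝ := (1 : ℝ) / (n : ℝ) ^ k * μ c.2

theorem clauseWeight_nonneg {μ : CT k → ℝ} (hμ : IsPMF μ) (c : ClauseG n k) :
    0 ≤ clauseWeight μ c := mul_nonneg (by positivity) (hμ.1 _)

theorem sum_clauseWeight {μ : CT k → ℝ} (hμ : IsPMF μ) (hn : 0 < n) :
    ∑ c : ClauseG n k, clauseWeight μ c = 1 := by
  have : (n : ℝ) ≠ 0 := by positivity
  simp [clauseWeight, Fintype.sum_prod_type, ← Finset.mul_sum, hμ.2, this]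

/-- The empirical distribution over the coordinates `i` of the tuples `(y 0 i, …, y (l-1) i)`. -/
def empirical {l : ℕ} (y : Fin l → Fin n → Bool) (b : Fin l → Bool) : ℝ :=
  ∑ i, if b = fun r => y r i then (1 : ℝ) / n else 0

theorem empirical_mem_stdSimplex {l : ℕ} (hn : 0 < n) (y : Fin l → Fin n → Bool) :
    empirical y ∈ stdSimplex ℝ (Fin l → Bool) := by
  refine ⟨fun b => Finset.sum_nonneg fun i _ => by split_ifs <;> positivity, ?_⟩
  have : (n : ℝ) ≠ 0 := by positivity
  simp only [empirical]
  rw [Finset.sum_comm]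
  simp [this]

theorem Gam_empirical (μ : CT k → ℝ) {l : ℕ} (y : Fin l → Fin n → Bool) :
    Gam k μ l (empirical y) =
      ∑ c : ClauseG n k, clauseWeight μ c * ∏ r, if satC (y r) c then (0 : ℝ) else 1 := by
  have hprod (z : Fin k → Fin l → Bool) : ∏ j, empirical y (z j) =
      ∑ i : Fin k → Fin n, if z = fun j r => y r (i j) then (1 : ℝ) / (n : ℝ) ^ k else 0 := by
    simp only [empirical, Fintype.prod_sum, Fintype.prod_ite_zero, funext_iff (f := z)]
    simp
  simp only [Gam, hprod, Fintype.sum_prod_type, clauseWeight, Finset.sum_mul]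
  rw [Finset.sum_comm]
  refine Finset.sum_congr rfl fun φ _ => ?_
  rw [Finset.sum_comm, Finset.mul_sum]
  refine Finset.sum_congr rfl fun i _ => ?_
  rw [Finset.sum_eq_single (fun j r => y r (i j)) (by intro z _ hz; simp [hz]) (by simp)]
  rw [if_pos rfl, ← mul_assoc, mul_comm (μ φ)]
  exact congrArg _ (Finset.prod_congr rfl fun r _ => if_congr Iff.rfl rfl rfl)

theorem empirical_add {n₁ n₂ l : ℕ} (hn₁ : 0 < n₁) (hn₂ : 0 < n₂)
    (y : Fin l → Fin (n₁ + n₂) → Bool) :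
    empirical y =
      ((n₁ : ℝ) / (n₁ + n₂)) • empirical (fun r i => y r (Fin.castAdd n₂ i)) +
        ((n₂ : ℝ) / (n₁ + n₂)) • empirical (fun r i => y r (Fin.natAdd n₁ i)) := by
  ext b
  have : (n₁ : ℝ) ≠ 0 := by positivity
  have : (n₂ : ℝ) ≠ 0 := by positivity
  simp only [empirical, Pi.add_apply, Pi.smul_apply, smul_eq_mul, Fin.sum_univ_add,
    Finset.mul_sum, mul_ite, mul_zero]
  congr 1 <;> refine Finset.sum_congr rfl fun i _ => ?_ <;> congr 1 <;> push_cast <;> field_simp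

theorem H2.sum_clauseWeight_le {μ : CT k → ℝ} (h : H2 k μ) {n₁ n₂ l : ℕ} (hl : 1 ≤ l)
    (hn₁ : 0 < n₁) (hn₂ : 0 < n₂) (y : Fin l → Fin (n₁ + n₂) → Bool) :
    ∑ c : ClauseG (n₁ + n₂) k, clauseWeight μ c * (∏ r, if satC (y r) c then (0 : ℝ) else 1) ≤
      (n₁ : ℝ) / (n₁ + n₂) * (∑ c : ClauseG n₁ k, clauseWeight μ c *
        ∏ r, if satC (fun i => y r (Fin.castAdd n₂ i)) c then (0 : ℝ) else 1) +
      (n₂ : ℝ) / (n₁ + n₂) * (∑ c : ClauseG n₂ k, clauseWeight μ c *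
        ∏ r, if satC (fun i => y r (Fin.natAdd n₁ i)) c then (0 : ℝ) else 1) := by
  rw [← Gam_empirical, ← Gam_empirical μ fun r i => y r (Fin.castAdd n₂ i),
    ← Gam_empirical μ fun r i => y r (Fin.natAdd n₁ i), empirical_add hn₁ hn₂]
  refine (h l hl).2 (empirical_mem_stdSimplex hn₁ _) (empirical_mem_stdSimplex hn₂ _)
    (by positivity) (by positivity) ?_
  have : (0 : ℝ) < n₁ := by positivity
  field_simp

/-- The operator adding one uniformly random clause on the first `n₁` of `n₁ + n₂` variables. -/
def leftAverage (μ : CT k → ℝ) (n₁ n₂ : ℕ) :=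
  filterAverage (clauseWeight (n := n₁) μ)
    fun c (x : Fin (n₁ + n₂) → Bool) => satC (fun i => x (Fin.castAdd n₂ i)) c

/-- The operator adding one uniformly random clause on the last `n₂` of `n₁ + n₂` variables. -/
def rightAverage (μ : CT k → ℝ) (n₁ n₂ : ℕ) :=
  filterAverage (clauseWeight (n := n₂) μ)
    fun c (x : Fin (n₁ + n₂) → Bool) => satC (fun i => x (Fin.natAdd n₁ i)) c

/-- The operator adding one uniformly random clause on `n` variables. -/
def totalAverage (μ : CT k → ℝ) (n : ℕ) :=
  filterAverage (clauseWeight (n := n) μ) fun c (x : Fin n → Bool) => satC x c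

/-- The operator adding one random clause on the first `n₁` or on the last `n₂` variables,
with probabilities proportional to `n₁` and `n₂`. -/
def mixedAverage (μ : CT k → ℝ) (n₁ n₂ : ℕ) :
    (Finset (Fin (n₁ + n₂) → Bool) → ℝ) →L[ℝ] (Finset (Fin (n₁ + n₂) → Bool) → ℝ) :=
  ((n₁ : ℝ) / (n₁ + n₂)) • leftAverage μ n₁ n₂ + ((n₂ : ℝ) / (n₁ + n₂)) • rightAverage μ n₁ n₂

theorem mixedAverage_log_le {μ : CT k → ℝ} (hμ : IsPMF μ) (h : H2 k μ) {n₁ n₂ : ℕ}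
    (hn₁ : 0 < n₁) (hn₂ : 0 < n₂) :
    mixedAverage μ n₁ n₂ (fun S => Real.log (1 + (S.card : ℝ))) ≤
      totalAverage μ (n₁ + n₂) (fun S => Real.log (1 + (S.card : ℝ))) := by
  intro S
  have h₁ := (hasSum_log_sub_filterAverage (sum_clauseWeight hμ hn₁)
    (fun c (x : Fin (n₁ + n₂) → Bool) => satC (fun i => x (Fin.castAdd n₂ i)) c) S).mul_left
    ((n₁ : ℝ) / (n₁ + n₂))
  have h₂ := (hasSum_log_sub_filterAverage (sum_clauseWeight hμ hn₂)
    (fun c (x : Fin (n₁ + n₂) → Bool) => satC (fun i => x (Fin.natAdd n₁ i)) c) S).mul_left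
    ((n₂ : ℝ) / (n₁ + n₂))
  have h₀ := hasSum_log_sub_filterAverage (sum_clauseWeight hμ (Nat.add_pos_left hn₁ n₂))
    (fun c (x : Fin (n₁ + n₂) → Bool) => satC x c) S
  have hle := hasSum_le (fun l => ?_) h₀ (h₁.add h₂)
  · have hsum : (n₁ : ℝ) / (n₁ + n₂) + (n₂ : ℝ) / (n₁ + n₂) = 1 := by
      have : (0 : ℝ) < n₁ := by positivity
      field_simp
    simp only [mixedAverage, leftAverage, rightAverage, totalAverage,
      add_apply, smul_apply, Pi.add_apply,
      Pi.smul_apply, smul_eq_mul]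
    have hlog := congrArg (· * Real.log (1 + (S.card : ℝ))) hsum
    simp only [add_mul, one_mul] at hlog
    linarith
  · rw [← mul_div_assoc, ← mul_div_assoc, ← add_div]
    refine div_le_div_of_nonneg_right ?_ (by positivity)
    simp only [sum_mul_card_filter_not_pow]
    rw [mul_left_comm, mul_left_comm ((n₂ : ℝ) / (n₁ + n₂)), ← mul_add]
    refine mul_le_mul_of_nonneg_left ?_ (by positivity)
    rw [Finset.mul_sum, Finset.mul_sum, ← Finset.sum_add_distrib]
    refine Finset.sum_le_sum fun y _ => ?_
    rw [mul_left_comm, mul_left_comm ((n₂ : ℝ) / (n₁ + n₂)), ← mul_add]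
    refine mul_le_mul_of_nonneg_left (h.sum_clauseWeight_le (by lia) hn₁ hn₂ y) ?_
    exact Finset.prod_nonneg fun r _ => by split_ifs <;> norm_num

theorem commute_leftAverage_rightAverage (μ : CT k → ℝ) (n₁ n₂ : ℕ) :
    Commute (leftAverage μ n₁ n₂) (rightAverage μ n₁ n₂) :=
  commute_filterAverage _ _ _ _

theorem commute_totalAverage_mixedAverage (μ : CT k → ℝ) (n₁ n₂ : ℕ) :
    Commute (totalAverage μ (n₁ + n₂)) (mixedAverage μ n₁ n₂) :=
  ((commute_filterAverage _ _ _ _).smul_right _).add_right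
    ((commute_filterAverage _ _ _ _).smul_right _)

theorem monotone_mixedAverage {μ : CT k → ℝ} (hμ : IsPMF μ) (n₁ n₂ : ℕ) :
    Monotone (mixedAverage μ n₁ n₂) := fun _ _ h S =>
  add_le_add
    (mul_le_mul_of_nonneg_left (monotone_filterAverage (clauseWeight_nonneg hμ) _ h S)
      (by positivity))
    (mul_le_mul_of_nonneg_left (monotone_filterAverage (clauseWeight_nonneg hμ) _ h S)
      (by positivity))

theorem card_filter_append {n₁ n₂ m₁ m₂ : ℕ} (f₁ : Fin m₁ → ClauseG n₁ k)
    (f₂ : Fin m₂ → ClauseG n₂ k) :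
    (Finset.univ.filter fun x : Fin (n₁ + n₂) → Bool =>
      (∀ a, satC (fun i => x (Fin.castAdd n₂ i)) (f₁ a)) ∧
        ∀ a, satC (fun i => x (Fin.natAdd n₁ i)) (f₂ a)).card = ZC f₁ * ZC f₂ := by
  rw [ZC, ZC, ← Finset.card_product]
  symm
  refine Finset.card_equiv (Fin.appendEquiv n₁ n₂) fun x => ?_
  simp [Fin.appendEquiv]

theorem ElogG_eq (n : ℕ) (α : ℝ) (μ : CT k → ℝ) :
    ElogG k n α μ = ∑' m, ProbabilityTheory.poissonPMFReal (Real.toNNReal (α * n)) m *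
      (totalAverage μ n ^ m) (fun S => Real.log (1 + (S.card : ℝ))) Finset.univ := by
  simp only [totalAverage, filterAverage_pow_apply]
  rfl

theorem ElogGprod_eq (n₁ n₂ : ℕ) (α : ℝ) (μ : CT k → ℝ) :
    ElogGprod k n₁ n₂ α μ = ∑' m₁, ∑' m₂,
      ProbabilityTheory.poissonPMFReal (Real.toNNReal (α * n₁)) m₁ *
        ProbabilityTheory.poissonPMFReal (Real.toNNReal (α * n₂)) m₂ *
        (leftAverage μ n₁ n₂ ^ m₁) ((rightAverage μ n₁ n₂ ^ m₂)
          fun S => Real.log (1 + (S.card : ℝ))) Finset.univ := by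
  simp only [leftAverage, rightAverage, filterAverage_pow_apply, Finset.filter_filter,
    card_filter_append, Finset.mul_sum, Nat.cast_mul]
  simp only [ElogGprod, Finset.mul_sum, wG, clauseWeight, mul_assoc]

end Interpolation

/-- **Pseudo-superadditivity of `E log(1+Z)` for general random CSPs** (interpolation):
if `μ` satisfies H2, then for all `n₁, n₂ ≥ k`,
`E[log(1 + Z_{n₁+n₂})] ≥ E[log(1 + Z_{n₁} Z_{n₂})]`. -/
theorem csp_interpolation (k : ℕ) (hk : 2 ≤ k) (μ : CT k → ℝ) (hμ : IsPMF μ)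
    (h2 : H2 k μ) (α : ℝ) (hα : 0 < α) (n₁ n₂ : ℕ) (h₁ : k ≤ n₁) (h₂ : k ≤ n₂) :
    ElogGprod k n₁ n₂ α μ ≤ ElogG k (n₁ + n₂) α μ := by
  have hn₁ : 0 < n₁ := by lia
  have hn₂ : 0 < n₂ := by lia
  have hr : Real.toNNReal (α * (n₁ + n₂ : ℕ)) =
      Real.toNNReal (α * n₁) + Real.toNNReal (α * n₂) := by
    rw [← Real.toNNReal_add (by positivity) (by positivity), Nat.cast_add, mul_add]
  have hmix : ((Real.toNNReal (α * n₁) + Real.toNNReal (α * n₂) : NNReal) : ℝ) •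
      mixedAverage μ n₁ n₂ = (Real.toNNReal (α * n₁) : ℝ) • leftAverage μ n₁ n₂ +
        (Real.toNNReal (α * n₂) : ℝ) • rightAverage μ n₁ n₂ := by
    have : (0 : ℝ) < n₁ := by positivity
    rw [NNReal.coe_add, Real.coe_toNNReal _ (by positivity), Real.coe_toNNReal _ (by positivity),
      mixedAverage, smul_add, smul_smul, smul_smul]
    congr 2 <;> field_simp
  rw [ElogG_eq, ElogGprod_eq, hr,
    tsum_tsum_poissonPMFReal_mul_pow_apply _ _ (commute_leftAverage_rightAverage μ n₁ n₂) hmix]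
  refine (hasSum_poissonPMFReal_mul_pow_apply _ _ _ _).summable.tsum_le_tsum (fun m => ?_)
    (hasSum_poissonPMFReal_mul_pow_apply _ _ _ _).summable
  refine mul_le_mul_of_nonneg_left ?_ ProbabilityTheory.poissonPMFReal_nonneg
  exact (commute_totalAverage_mixedAverage μ n₁ n₂).pow_apply_le_pow_apply
    (monotone_filterAverage (clauseWeight_nonneg hμ) _) (monotone_mixedAverage hμ n₁ n₂)
    (mixedAverage_log_le hμ h2 hn₁ hn₂) m Finset.univ
end
end

section
/- Fix k ≥ 2 and α > 0, and let F_n = F(n,α) be the random k-SAT formula. Define τ(n) := E[ log(1 + Z(F_n)^{-1}) ; Z(F_n) ≥ 1 ] (expectation restricted to the event that F_n is satisfiable). Then there exists ξ > 0 such that τ(n) = O(e^{-ξ n}). -/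
open Filter
open scoped Classical Topology BigOperators

noncomputable section

/-- `τ(n) = E[log(1 + Z(F(n,α))⁻¹) ; Z(F(n,α)) ≥ 1]`, the expectation of
`log(1 + 1/Z)` restricted to the event that the random formula is satisfiable. -/
def tau (k n : ℕ) (α : ℝ) : ℝ :=
  ∑ F : Finset (Clause n k),
    if 1 ≤ Z F then wt n k α F * Real.log (1 + ((Z F : ℝ))⁻¹) else 0

namespace RandomSat

/-- The product formula for binomial random subsets. -/
lemma sum_binomial_mul_prod {ι : Type*} [Fintype ι] (p : ℝ) (h : ι → ℝ) :
    ∑ F : Finset ι, p ^ F.card * (1 - p) ^ (Fintype.card ι - F.card) * ∏ c ∈ F, h c =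
      ∏ c, (p * h c + (1 - p)) := by
  rw [Finset.prod_add, Finset.powerset_univ]
  refine Finset.sum_congr rfl fun F _ => ?_
  rw [Finset.prod_mul_distrib, Finset.prod_const, Finset.prod_const,
    Finset.card_sdiff_of_subset (Finset.subset_univ F), Finset.card_univ]
  ring

lemma prod_ite_avoid {ι κ : Type*} (T : Finset κ) (A : κ → Finset ι) (F : Finset ι)
    (m : ι → ℝ) :
    (∏ v ∈ T, -(if ∀ c ∈ F, c ∉ A v then (1 / 2 : ℝ) else 0)) * ∏ c ∈ F, m c =
      (∏ _v ∈ T, (-(1 / 2) : ℝ)) * ∏ c ∈ F, if c ∈ T.biUnion A then 0 else m c := by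
  by_cases hT : ∀ v ∈ T, ∀ c ∈ F, c ∉ A v
  · congr 1
    · refine Finset.prod_congr rfl fun v hv => ?_
      rw [if_pos (hT v hv)]
    · refine Finset.prod_congr rfl fun c hc => ?_
      rw [if_neg]
      simp only [Finset.mem_biUnion, not_exists, not_and]
      exact fun v hv => hT v hv c hc
  · push Not at hT
    obtain ⟨v, hv, c, hc, hcv⟩ := hT
    have h1 : ∏ v ∈ T, -(if ∀ c ∈ F, c ∉ A v then (1 / 2 : ℝ) else 0) = 0 := by
      refine Finset.prod_eq_zero hv ?_
      rw [if_neg fun h => h c hc hcv, neg_zero]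
    have h2 : (∏ c ∈ F, if c ∈ T.biUnion A then 0 else m c) = 0 := by
      refine Finset.prod_eq_zero hc ?_
      rw [if_pos (Finset.mem_biUnion.2 ⟨v, hv, hcv⟩)]
    rw [h1, h2, zero_mul, mul_zero]

/-- The mixed generating function of a binomial random subset: a factor `1/2` for each of the
disjoint sets `A v` that is avoided, and a factor `a` for each selected element of `M`. -/
lemma sum_binomial_mixed {ι κ : Type*} [Fintype ι] (p a : ℝ) (S : Finset κ) (A : κ → Finset ι)
    (M : Finset ι) (hA : (S : Set κ).PairwiseDisjoint A) (hM : ∀ v ∈ S, Disjoint (A v) M) :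
    ∑ F : Finset ι, p ^ F.card * (1 - p) ^ (Fintype.card ι - F.card) *
        ((∏ v ∈ S, (1 - if ∀ c ∈ F, c ∉ A v then (1 / 2 : ℝ) else 0)) *
          ∏ c ∈ F, if c ∈ M then a else 1) =
      (∏ v ∈ S, (1 - 1 / 2 * (1 - p) ^ (A v).card)) * (1 + p * (a - 1)) ^ M.card := by
  have expand : ∀ y : κ → ℝ, ∏ v ∈ S, (1 - y v) = ∑ T ∈ S.powerset, ∏ v ∈ T, -y v := by
    intro y
    have := Finset.prod_add (fun v => -y v) (fun _ => (1 : ℝ)) S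
    simp only [Finset.prod_const_one, mul_one] at this
    rw [← this]
    exact Finset.prod_congr rfl fun v _ => by ring
  simp only [expand, Finset.sum_mul, Finset.mul_sum]
  rw [Finset.sum_comm]
  refine Finset.sum_congr rfl fun T hT => ?_
  rw [Finset.mem_powerset] at hT
  have hdisj : Disjoint (T.biUnion A) M :=
    (Finset.disjoint_biUnion_left _ _ _).2 fun v hv => hM v (hT hv)
  have factor : ∀ c, p * (if c ∈ T.biUnion A then 0 else if c ∈ M then a else 1) + (1 - p) =
      (if c ∈ T.biUnion A then 1 - p else 1) * (if c ∈ M then 1 + p * (a - 1) else 1) := by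
    intro c
    by_cases h1 : c ∈ T.biUnion A
    · have h2 : c ∉ M := Finset.disjoint_left.1 hdisj h1
      simp [h1, h2]
    · by_cases h2 : c ∈ M
      · rw [if_neg h1, if_neg h1, if_pos h2, if_pos h2]
        ring
      · rw [if_neg h1, if_neg h1, if_neg h2, if_neg h2]
        ring
  calc _ = (∏ _v ∈ T, (-(1 / 2) : ℝ)) *
        ∑ F : Finset ι, p ^ F.card * (1 - p) ^ (Fintype.card ι - F.card) *
          ∏ c ∈ F, (if c ∈ T.biUnion A then 0 else if c ∈ M then a else 1) := by
        rw [Finset.mul_sum]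
        refine Finset.sum_congr rfl fun F _ => ?_
        rw [mul_left_comm (∏ _v ∈ T, (-(1 / 2) : ℝ))]
        congr 1
        convert prod_ite_avoid T A F fun c => if c ∈ M then a else 1
    _ = _ := by
        rw [sum_binomial_mul_prod, Finset.prod_congr rfl fun c _ => factor c,
          Finset.prod_mul_distrib, Finset.prod_ite_mem, Finset.prod_ite_mem, Finset.univ_inter,
          Finset.univ_inter, Finset.prod_const (1 - p), Finset.prod_const (1 + p * (a - 1)),
          Finset.card_biUnion (fun u hu v hv huv => hA (hT hu) (hT hv) huv),
          ← Finset.prod_pow_eq_pow_sum, ← mul_assoc, ← Finset.prod_mul_distrib]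
        congr 1
        exact Finset.prod_congr rfl fun v _ => by ring

variable {n k : ℕ}

/-- The variables occurring in a clause. -/
def vars (c : Clause n k) : Finset (Fin n) := c.1.image Prod.fst

lemma card_vars (c : Clause n k) : (vars c).card = k := c.2.2

/-- Freeing a set of unused variables multiplies the number of solutions. -/
lemma two_pow_le_Z (F : Finset (Clause n k)) (hZ : 1 ≤ Z F) (V : Finset (Fin n))
    (hV : ∀ v ∈ V, ∀ c ∈ F, v ∉ vars c) : 2 ^ V.card ≤ Z F := by
  obtain ⟨x, hx⟩ := Finset.card_pos.1 hZ
  rw [Finset.mem_filter] at hx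
  rw [← Finset.card_powerset]
  refine Finset.card_le_card_of_injOn (fun T v => if v ∈ V then decide (v ∈ T) else x v) ?_ ?_
  · intro T _
    simp only [Finset.coe_filter, Finset.mem_univ, true_and, Set.mem_ofPred_eq]
    intro c hc
    obtain ⟨l, hl, hxl⟩ := hx.2 c hc
    refine ⟨l, hl, ?_⟩
    beta_reduce
    rw [if_neg]
    · exact hxl
    · exact fun h => hV _ h c hc (Finset.mem_image_of_mem _ hl)
  · intro T hT U hU hTU
    have hT := Finset.mem_powerset.1 (Finset.mem_coe.1 hT)
    have hU := Finset.mem_powerset.1 (Finset.mem_coe.1 hU)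
    ext v
    by_cases hv : v ∈ V
    · have := congrFun hTU v
      simpa [hv] using this
    · exact ⟨fun h => absurd (hT h) hv, fun h => absurd (hU h) hv⟩

/-- The clauses containing at least two variables of `S`. -/
def multi (k : ℕ) (S : Finset (Fin n)) : Finset (Clause n k) :=
  Finset.univ.filter fun c => ∃ u ∈ S, ∃ v ∈ S, u ≠ v ∧ u ∈ vars c ∧ v ∈ vars c

/-- The clauses containing `v` and no other variable of `S`. -/
def single (k : ℕ) (S : Finset (Fin n)) (v : Fin n) : Finset (Clause n k) :=
  Finset.univ.filter fun c => v ∈ vars c ∧ c ∉ multi k S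

lemma inv_Z_le (S : Finset (Fin n)) (F : Finset (Clause n k)) (hZ : 1 ≤ Z F) :
    ((Z F : ℝ))⁻¹ ≤
      (∏ v ∈ S, (1 - if ∀ c ∈ F, c ∉ single k S v then (1 / 2 : ℝ) else 0)) *
        ∏ c ∈ F, if c ∈ multi k S then (2 ^ k : ℝ) else 1 := by
  set V := S.filter fun v => ∀ c ∈ F, v ∉ vars c with hVdef
  set B := S.filter fun v => ∀ c ∈ F, c ∉ single k S v with hBdef
  set G := F.filter fun c => c ∈ multi k S with hGdef
  have hB : B ⊆ V ∪ G.biUnion vars := by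
    intro v hv
    rw [hBdef, Finset.mem_filter] at hv
    by_cases h : ∀ c ∈ F, v ∉ vars c
    · exact Finset.mem_union_left _ (Finset.mem_filter.2 ⟨hv.1, h⟩)
    · push Not at h
      obtain ⟨c, hc, hvc⟩ := h
      refine Finset.mem_union_right _ (Finset.mem_biUnion.2 ⟨c, Finset.mem_filter.2 ⟨hc, ?_⟩, hvc⟩)
      by_contra hm
      exact hv.2 c hc (Finset.mem_filter.2 ⟨Finset.mem_univ _, hvc, hm⟩)
  have hcard : B.card ≤ V.card + G.card * k :=
    (Finset.card_le_card hB).trans ((Finset.card_union_le _ _).trans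
      (Nat.add_le_add_left (Finset.card_biUnion_le_card_mul _ _ _ fun c _ => (card_vars c).le) _))
  have hZV : (2 : ℝ) ^ V.card ≤ Z F := by
    exact_mod_cast two_pow_le_Z F hZ V fun v hv => (Finset.mem_filter.1 hv).2
  have h1 : (∏ v ∈ S, (1 - if ∀ c ∈ F, c ∉ single k S v then (1 / 2 : ℝ) else 0)) =
      ((2 : ℝ) ^ B.card)⁻¹ := by
    rw [← inv_pow, hBdef, ← Finset.prod_const, Finset.prod_filter]
    refine Finset.prod_congr rfl fun v _ => ?_
    split_ifs <;> norm_num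
  have h2 : (∏ c ∈ F, if c ∈ multi k S then (2 ^ k : ℝ) else 1) = 2 ^ (G.card * k) := by
    rw [mul_comm, pow_mul, hGdef, ← Finset.prod_const, Finset.prod_filter]
  rw [h1, h2]
  calc ((Z F : ℝ))⁻¹ ≤ ((2 : ℝ) ^ V.card)⁻¹ := inv_anti₀ (by positivity) hZV
    _ ≤ _ := by
      rw [inv_mul_eq_div, inv_eq_one_div, div_le_div_iff₀ (by positivity) (by positivity), one_mul,
        ← pow_add]
      exact pow_le_pow_right₀ (by norm_num) (by omega)

/-- Renaming the variables of a clause. -/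
def rename (σ : Equiv.Perm (Fin n)) (c : Clause n k) : Clause n k :=
  ⟨c.1.image (Prod.map σ id), by
    rw [Finset.card_image_of_injective _ (σ.injective.prodMap Function.injective_id)]
    exact c.2.1, by
    rw [Finset.image_image]
    have : (Prod.fst ∘ Prod.map σ id : Fin n × Bool → Fin n) = σ ∘ Prod.fst := by
      ext; simp
    rw [this, ← Finset.image_image, Finset.card_image_of_injective _ σ.injective]
    exact c.2.2⟩

lemma vars_rename (σ : Equiv.Perm (Fin n)) (c : Clause n k) :
    vars (rename σ c) = (vars c).image σ := by
  simp only [vars, rename, Finset.image_image]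
  congr 1

lemma mem_vars_rename (σ : Equiv.Perm (Fin n)) (c : Clause n k) (v : Fin n) :
    σ v ∈ vars (rename σ c) ↔ v ∈ vars c := by
  rw [vars_rename, Finset.mem_image]
  simp

lemma rename_injective (σ : Equiv.Perm (Fin n)) :
    Function.Injective (rename σ : Clause n k → Clause n k) := by
  intro c d h
  exact Subtype.ext (Finset.image_injective (σ.injective.prodMap Function.injective_id)
    (congrArg Subtype.val h))

/-- The clauses containing `v`. -/
def containing (k : ℕ) (v : Fin n) : Finset (Clause n k) :=
  Finset.univ.filter fun c => v ∈ vars c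

/-- The clauses containing `u` and `v`. -/
def containingPair (k : ℕ) (u v : Fin n) : Finset (Clause n k) :=
  Finset.univ.filter fun c => u ∈ vars c ∧ v ∈ vars c

lemma card_containing_le (u v : Fin n) : (containing k u).card ≤ (containing k v).card := by
  refine Finset.card_le_card_of_injOn (rename (Equiv.swap u v)) ?_ (rename_injective _).injOn
  intro c hc
  have hc : u ∈ vars c := by simpa [containing] using hc
  have := (mem_vars_rename (Equiv.swap u v) c u).2 hc
  rw [Equiv.swap_apply_left] at this
  simpa [containing] using this

lemma card_containingPair_le {u v w : Fin n} (hv : u ≠ v) (hw : u ≠ w) :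
    (containingPair k u v).card ≤ (containingPair k u w).card := by
  refine Finset.card_le_card_of_injOn (rename (Equiv.swap v w)) ?_ (rename_injective _).injOn
  intro c hc
  have hc : u ∈ vars c ∧ v ∈ vars c := by simpa [containingPair] using hc
  have h1 := (mem_vars_rename (Equiv.swap v w) c u).2 hc.1
  have h2 := (mem_vars_rename (Equiv.swap v w) c v).2 hc.2
  rw [Equiv.swap_apply_left] at h2
  rw [Equiv.swap_apply_of_ne_of_ne hv hw] at h1
  simpa [containingPair] using ⟨h1, h2⟩

lemma mul_card_containing (v : Fin n) :
    n * (containing k v).card ≤ k * Fintype.card (Clause n k) := by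
  have h : ∑ u : Fin n, (containing k u).card = ∑ c : Clause n k, (vars c).card := by
    have := Finset.sum_card_bipartiteAbove_eq_sum_card_bipartiteBelow
      (s := (Finset.univ : Finset (Fin n))) (t := (Finset.univ : Finset (Clause n k)))
      (fun u c => u ∈ vars c)
    simpa [Finset.bipartiteAbove, Finset.bipartiteBelow, containing] using this
  calc n * (containing k v).card = ∑ _u : Fin n, (containing k v).card := by simp
    _ ≤ ∑ u : Fin n, (containing k u).card := Finset.sum_le_sum fun u _ => card_containing_le v u
    _ = k * Fintype.card (Clause n k) := by
      rw [h, Finset.sum_congr rfl fun c _ => card_vars c]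
      simp [mul_comm]

lemma mul_card_containingPair {u v : Fin n} (huv : u ≠ v) :
    (n - 1) * (containingPair k u v).card ≤ k * (containing k u).card := by
  have h : ∑ w ∈ Finset.univ.erase u, (containingPair k u w).card ≤
      ∑ c ∈ containing k u, (vars c).card := by
    have := Finset.sum_card_bipartiteAbove_eq_sum_card_bipartiteBelow
      (s := (Finset.univ.erase u : Finset (Fin n))) (t := containing k u)
      (fun w c => w ∈ vars c)
    calc ∑ w ∈ Finset.univ.erase u, (containingPair k u w).card
        = ∑ c ∈ containing k u, ((Finset.univ.erase u).filter fun w => w ∈ vars c).card := by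
          simpa [Finset.bipartiteAbove, Finset.bipartiteBelow, containing, containingPair,
            Finset.filter_filter] using this
      _ ≤ _ := Finset.sum_le_sum fun c _ => Finset.card_le_card fun w hw =>
          (Finset.mem_filter.1 hw).2
  calc (n - 1) * (containingPair k u v).card
      = ∑ _w ∈ Finset.univ.erase u, (containingPair k u v).card := by
        rw [Finset.sum_const, Finset.card_erase_of_mem (Finset.mem_univ u)]
        simp
    _ ≤ ∑ w ∈ Finset.univ.erase u, (containingPair k u w).card :=
        Finset.sum_le_sum fun w hw => card_containingPair_le huv (Finset.ne_of_mem_erase hw).symm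
    _ ≤ _ := h
    _ = k * (containing k u).card := by
      rw [Finset.sum_congr rfl fun c _ => card_vars c, Finset.sum_const, smul_eq_mul, mul_comm]

lemma card_multi_le (S : Finset (Fin n)) :
    n * (n - 1) * (multi k S).card ≤ S.card ^ 2 * (k ^ 2 * Fintype.card (Clause n k)) := by
  have hsub : multi k S ⊆ S.offDiag.biUnion fun e => containingPair k e.1 e.2 := by
    intro c hc
    obtain ⟨-, u, hu, v, hv, huv, huc, hvc⟩ := Finset.mem_filter.1 hc
    exact Finset.mem_biUnion.2 ⟨(u, v), Finset.mem_offDiag.2 ⟨hu, hv, huv⟩,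
      Finset.mem_filter.2 ⟨Finset.mem_univ _, huc, hvc⟩⟩
  calc n * (n - 1) * (multi k S).card
      ≤ n * (n - 1) * ∑ e ∈ S.offDiag, (containingPair k e.1 e.2).card :=
        Nat.mul_le_mul_left _ ((Finset.card_le_card hsub).trans Finset.card_biUnion_le)
    _ = ∑ e ∈ S.offDiag, n * ((n - 1) * (containingPair k e.1 e.2).card) := by
        rw [Finset.mul_sum]
        exact Finset.sum_congr rfl fun e _ => by ring
    _ ≤ ∑ _e ∈ S.offDiag, k ^ 2 * Fintype.card (Clause n k) := by
        refine Finset.sum_le_sum fun e he => ?_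
        calc n * ((n - 1) * (containingPair k e.1 e.2).card)
            ≤ n * (k * (containing k e.1).card) :=
              Nat.mul_le_mul_left _ (mul_card_containingPair (Finset.mem_offDiag.1 he).2.2)
          _ = k * (n * (containing k e.1).card) := by ring
          _ ≤ k * (k * Fintype.card (Clause n k)) :=
              Nat.mul_le_mul_left _ (mul_card_containing _)
          _ = _ := by ring
    _ = S.offDiag.card * (k ^ 2 * Fintype.card (Clause n k)) := by simp
    _ ≤ _ := by
        refine Nat.mul_le_mul_right _ ?_
        rw [Finset.offDiag_card, sq]
        exact Nat.sub_le _ _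

lemma choose_le_card_clause (n k : ℕ) : n.choose k ≤ Fintype.card (Clause n k) := by
  have hinj : Function.Injective fun v : Fin n => (v, true) := fun a b h => (Prod.ext_iff.1 h).1
  have himage : ∀ T : Finset (Fin n), (T.image fun v => (v, true)).image Prod.fst = T := by
    intro T
    rw [Finset.image_image]
    exact Finset.image_id
  have : Fintype.card {T : Finset (Fin n) // T.card = k} ≤ Fintype.card (Clause n k) := by
    refine Fintype.card_le_of_injective (fun T => (⟨T.1.image fun v => (v, true), by
      rw [Finset.card_image_of_injective _ hinj]; exact T.2, by
      rw [himage]; exact T.2⟩ : Clause n k)) fun T U h => Subtype.ext ?_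
    exact Finset.image_injective hinj (congrArg Subtype.val h)
  simpa [Fintype.card_finset_len] using this

lemma sq_le_card_clause (hk : 2 ≤ k) (hn : 2 * k ≤ n) :
    (n : ℝ) ^ 2 ≤ 4 * k.factorial * Fintype.card (Clause n k) := by
  have h1 : ((n + 1 - k : ℕ) : ℝ) ^ k / k.factorial ≤ n.choose k := Nat.pow_le_choose k n
  have h2 : (n : ℝ) / 2 ≤ ((n + 1 - k : ℕ) : ℝ) := by
    rw [Nat.cast_sub (by omega)]
    have : (2 * k : ℝ) ≤ n := by exact_mod_cast hn
    push_cast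
    linarith
  have h3 : (1 : ℝ) ≤ ((n + 1 - k : ℕ) : ℝ) := by exact_mod_cast (by omega : 1 ≤ n + 1 - k)
  have h4 : (n.choose k : ℝ) ≤ Fintype.card (Clause n k) := by
    exact_mod_cast choose_le_card_clause n k
  have hf : (0 : ℝ) < k.factorial := by exact_mod_cast k.factorial_pos
  rw [div_le_iff₀ hf] at h1
  calc (n : ℝ) ^ 2 = 4 * ((n : ℝ) / 2) ^ 2 := by ring
    _ ≤ 4 * ((n + 1 - k : ℕ) : ℝ) ^ 2 := by gcongr
    _ ≤ 4 * ((n + 1 - k : ℕ) : ℝ) ^ k := by gcongr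
    _ ≤ 4 * (n.choose k * k.factorial) := by gcongr
    _ ≤ 4 * (Fintype.card (Clause n k) * k.factorial) := by gcongr
    _ = _ := by ring

lemma tau_le {α : ℝ} (hp0 : 0 ≤ α * n / (Fintype.card (Clause n k) : ℝ))
    (hp1 : α * n / (Fintype.card (Clause n k) : ℝ) ≤ 1) (S : Finset (Fin n)) :
    tau k n α ≤
      (∏ v ∈ S, (1 - 1 / 2 *
        (1 - α * n / (Fintype.card (Clause n k) : ℝ)) ^ (single k S v).card)) *
      (1 + α * n / (Fintype.card (Clause n k) : ℝ) * (2 ^ k - 1)) ^ (multi k S).card := by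
  have hA : (S : Set (Fin n)).PairwiseDisjoint (single k S) := by
    intro u hu v hv huv
    refine Finset.disjoint_left.2 fun c hc hc' => ?_
    obtain ⟨-, huc, hm⟩ := Finset.mem_filter.1 hc
    obtain ⟨-, hvc, -⟩ := Finset.mem_filter.1 hc'
    exact hm (Finset.mem_filter.2 ⟨Finset.mem_univ _, u, hu, v, hv, huv, huc, hvc⟩)
  have hM : ∀ v ∈ S, Disjoint (single k S v) (multi k S) := fun v _ =>
    Finset.disjoint_left.2 fun c hc => (Finset.mem_filter.1 hc).2.2
  rw [← sum_binomial_mixed _ _ S _ _ hA hM]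
  refine Finset.sum_le_sum fun F _ => ?_
  have hw : 0 ≤ wt n k α F := mul_nonneg (pow_nonneg hp0 _) (pow_nonneg (sub_nonneg.2 hp1) _)
  split_ifs with hZ
  · refine mul_le_mul_of_nonneg_left (le_trans ?_ (inv_Z_le S F hZ)) hw
    have hpos : (0 : ℝ) < 1 + ((Z F : ℝ))⁻¹ := by positivity
    linarith [Real.log_le_sub_one_of_pos hpos]
  · refine mul_nonneg hw (mul_nonneg (Finset.prod_nonneg fun v _ => ?_)
      (Finset.prod_nonneg fun c _ => ?_))
    · split_ifs <;> norm_num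
    · split_ifs <;> positivity

lemma exp_neg_two_mul_le {p : ℝ} (hp0 : 0 ≤ p) (hp : p ≤ 1 / 2) : Real.exp (-(2 * p)) ≤ 1 - p := by
  have h : (1 + 2 * p) * (1 - p) ≥ 1 := by nlinarith
  have h1 : 1 + 2 * p ≤ Real.exp (2 * p) := by linarith [Real.add_one_le_exp (2 * p)]
  rw [Real.exp_neg, inv_le_iff_one_le_mul₀ (Real.exp_pos _)]
  nlinarith

lemma tau_le_exp {α : ℝ} (hα : 0 < α) (hn : 2 ≤ n)
    (hp : α * n / (Fintype.card (Clause n k) : ℝ) ≤ 1 / 2)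
    (hN : 0 < Fintype.card (Clause n k)) (S : Finset (Fin n)) :
    tau k n α ≤ Real.exp (-(Real.exp (-(2 * α * k)) / 2 * S.card) +
      2 ^ (k + 1) * α * k ^ 2 * (S.card ^ 2 / n)) := by
  have hN' : (0 : ℝ) < Fintype.card (Clause n k) := by exact_mod_cast hN
  have hn' : (2 : ℝ) ≤ n := by exact_mod_cast hn
  have hn0 : (0 : ℝ) < n := by linarith
  have hp0 : 0 ≤ α * n / (Fintype.card (Clause n k) : ℝ) := by positivity
  refine (tau_le hp0 (by linarith) S).trans ?_
  set N : ℝ := (Fintype.card (Clause n k) : ℝ) with hNdef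
  set p : ℝ := α * n / N with hpdef
  set q : ℝ := Real.exp (-(2 * α * k)) with hq
  have hpN : p * N = α * n := div_mul_cancel₀ _ hN'.ne'
  have hsingle : ∀ v, q ≤ (1 - p) ^ (single k S v).card := by
    intro v
    have h1 : (n : ℝ) * (single k S v).card ≤ k * N := by
      have hle : (single k S v).card ≤ (containing k v).card :=
        Finset.card_le_card fun c hc =>
          Finset.mem_filter.2 ⟨Finset.mem_univ _, (Finset.mem_filter.1 hc).2.1⟩
      rw [hNdef]
      exact_mod_cast (Nat.mul_le_mul_left n hle).trans (mul_card_containing v)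
    have h2 : p * (single k S v).card ≤ α * k := by
      rw [hpdef, div_mul_eq_mul_div, div_le_iff₀ hN']
      nlinarith
    calc q ≤ Real.exp ((single k S v).card * -(2 * p)) := by
          rw [hq]; exact Real.exp_le_exp.2 (by linarith)
      _ = Real.exp (-(2 * p)) ^ (single k S v).card := Real.exp_nat_mul _ _
      _ ≤ _ := pow_le_pow_left₀ (Real.exp_pos _).le (exp_neg_two_mul_le hp0 hp) _
  have hleft : ∏ v ∈ S, (1 - 1 / 2 * (1 - p) ^ (single k S v).card) ≤
      Real.exp (-(q / 2 * S.card)) := by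
    calc _ ≤ ∏ _v ∈ S, Real.exp (-(q / 2)) := by
          refine Finset.prod_le_prod (fun v _ => ?_) fun v _ => ?_
          · have : (1 - p) ^ (single k S v).card ≤ 1 :=
              pow_le_one₀ (by linarith) (by linarith)
            linarith
          · linarith [hsingle v, Real.add_one_le_exp (-(q / 2))]
      _ = _ := by
          rw [Finset.prod_const, ← Real.exp_nat_mul]
          ring_nf
  have hmulti : p * (multi k S).card ≤ 2 * α * k ^ 2 * (S.card ^ 2 / n) := by
    have h1 : (n : ℝ) * (n - 1) * (multi k S).card ≤ S.card ^ 2 * (k ^ 2 * N) := by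
      have := card_multi_le (k := k) S
      have : ((n * (n - 1) * (multi k S).card : ℕ) : ℝ) ≤
        ((S.card ^ 2 * (k ^ 2 * Fintype.card (Clause n k)) : ℕ) : ℝ) := by exact_mod_cast this
      push_cast [Nat.cast_sub (by omega : 1 ≤ n)] at this
      exact this
    have h2 : (n : ℝ) * (n / 2) * (multi k S).card ≤ S.card ^ 2 * (k ^ 2 * N) := by
      refine le_trans ?_ h1
      gcongr
      linarith
    rw [hpdef, div_mul_eq_mul_div, div_le_iff₀ hN']
    have h3 : 2 * α * k ^ 2 * ((S.card : ℝ) ^ 2 / n) * N =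
        2 * α / n * (S.card ^ 2 * (k ^ 2 * N)) := by ring
    have h4 : α * n * (multi k S).card = 2 * α / n * (n * (n / 2) * (multi k S).card) := by
      field_simp
    rw [h3, h4]
    gcongr
  have h2k : (1 : ℝ) ≤ 2 ^ k := one_le_pow₀ (by norm_num)
  have hright : (1 + p * (2 ^ k - 1)) ^ (multi k S).card ≤
      Real.exp (2 ^ (k + 1) * α * k ^ 2 * (S.card ^ 2 / n)) := by
    have hnn : 0 ≤ p * (2 ^ k - 1) := mul_nonneg hp0 (by linarith)
    calc _ ≤ Real.exp (p * (2 ^ k - 1)) ^ (multi k S).card :=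
          pow_le_pow_left₀ (by linarith) (by linarith [Real.add_one_le_exp (p * (2 ^ k - 1))]) _
      _ = Real.exp ((multi k S).card * (p * (2 ^ k - 1))) := (Real.exp_nat_mul _ _).symm
      _ ≤ _ := by
          refine Real.exp_le_exp.2 ?_
          have hM0 : (0 : ℝ) ≤ p * (multi k S).card := by positivity
          calc (multi k S).card * (p * (2 ^ k - 1))
              = (p * (multi k S).card) * (2 ^ k - 1) := by ring
            _ ≤ (p * (multi k S).card) * 2 ^ k := by gcongr; linarith
            _ ≤ (2 * α * k ^ 2 * (S.card ^ 2 / n)) * 2 ^ k := by gcongr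
            _ = _ := by ring
  rw [Real.exp_add]
  exact mul_le_mul hleft hright
    (pow_nonneg (by linarith [mul_nonneg hp0 (sub_nonneg.2 h2k)]) _) (Real.exp_pos _).le

end RandomSat

/-- **Exponential decay of the correction term `τ(n)`:**
there is `ξ > 0` with `τ(n) = O(e^{-ξ n})`. -/
theorem tau_exponentially_small (k : ℕ) (hk : 2 ≤ k) (α : ℝ) (hα : 0 < α) :
    ∃ ξ : ℝ, 0 < ξ ∧ ∃ K : ℝ,
      ∀ᶠ (n : ℕ) in atTop, tau k n α ≤ K * Real.exp (-ξ * n) := by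
  set q : ℝ := Real.exp (-(2 * α * k)) with hq
  have hq0 : 0 < q := Real.exp_pos _
  have hk0 : (0 : ℝ) < k := by exact_mod_cast (by omega : 0 < k)
  set D : ℝ := 2 ^ (k + 1) * α * k ^ 2 with hD
  have hD0 : 0 < D := by positivity
  set δ : ℝ := min 1 (q / (4 * D)) with hδ
  have hδ0 : 0 < δ := lt_min one_pos (by positivity)
  have hδ1 : δ ≤ 1 := min_le_left _ _
  have hδD : D * δ ≤ q / 4 := by
    have h : δ ≤ q / (4 * D) := min_le_right _ _
    rw [le_div_iff₀ (by positivity)] at h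
    linarith
  refine ⟨q * δ / 4, by positivity, Real.exp (q / 2), ?_⟩
  filter_upwards [eventually_ge_atTop (2 * k),
    eventually_ge_atTop ⌈8 * k.factorial * α⌉₊] with n hn hnα
  have hn2 : 2 ≤ n := by omega
  have hn0 : (0 : ℝ) < n := by exact_mod_cast (by omega : 0 < n)
  have hnα : 8 * k.factorial * α ≤ n := Nat.ceil_le.1 hnα
  have hsq := RandomSat.sq_le_card_clause hk hn
  have hf : (0 : ℝ) < k.factorial := by exact_mod_cast k.factorial_pos
  have hN : (0 : ℝ) < Fintype.card (Clause n k) := by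
    have : 0 < 4 * (k.factorial : ℝ) * Fintype.card (Clause n k) :=
      lt_of_lt_of_le (by positivity) hsq
    exact pos_of_mul_pos_right this (by positivity)
  have hp : α * n / (Fintype.card (Clause n k) : ℝ) ≤ 1 / 2 := by
    rw [div_le_iff₀ hN]
    have h1 : 8 * k.factorial * α * n ≤ 4 * k.factorial * Fintype.card (Clause n k) :=
      le_trans (by nlinarith) hsq
    have h2 : 4 * (k.factorial : ℝ) * (2 * (α * n)) ≤
        4 * k.factorial * Fintype.card (Clause n k) := by linarith
    linarith [le_of_mul_le_mul_left h2 (by positivity)]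
  have hfloor : ⌊δ * n⌋₊ ≤ n := by
    refine Nat.floor_le_of_le ?_
    nlinarith
  obtain ⟨S, -, hS⟩ := Finset.exists_subset_card_eq
    (s := (Finset.univ : Finset (Fin n))) (n := ⌊δ * n⌋₊) (by simpa using hfloor)
  have hSle : (S.card : ℝ) ≤ δ * n := by
    rw [hS]; exact Nat.floor_le (by positivity)
  have hSge : δ * n - 1 ≤ (S.card : ℝ) := by
    rw [hS]; linarith [Nat.lt_floor_add_one (δ * n)]
  refine (RandomSat.tau_le_exp hα hn2 hp (by exact_mod_cast hN) S).trans ?_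
  rw [← Real.exp_add]
  refine Real.exp_le_exp.2 ?_
  have h1 : (S.card : ℝ) ^ 2 / n ≤ δ ^ 2 * n := by
    rw [div_le_iff₀ hn0]
    calc (S.card : ℝ) ^ 2 ≤ (δ * n) ^ 2 := by gcongr
      _ = _ := by ring
  have h2 : D * ((S.card : ℝ) ^ 2 / n) ≤ q / 4 * (δ * n) := by
    calc D * ((S.card : ℝ) ^ 2 / n) ≤ D * (δ ^ 2 * n) := by gcongr
      _ = D * δ * (δ * n) := by ring
      _ ≤ _ := by gcongr
  have h3 : q / 2 * (δ * n - 1) ≤ q / 2 * S.card := by gcongr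
  linarith
end
end

section
/- Fix k ≥ 2, α > 0 and φ ∈ [0,1). There exist an increasing function g(n) and, for every τ > 0, an N such that for all n ≥ N: P_{n-1}(α, φ) ≤ P_n(α + g(n)/n, φ) + τ, where g(n)/n → 0. That is, decreasing the number of variables by one can be compensated, up to an additive τ, by a vanishing increase of the clause density. -/
open Filter
open scoped Classical Topology BigOperators

noncomputable section

/-- The expectation of `f F`, where `F ⊆ s` contains each element of `s` independently with
probability `p`. -/
def bernoulliSum {C : Type*} (s : Finset C) (p : ℝ) (f : Finset C → ℝ) : ℝ :=
  ∑ F ∈ s.powerset, p ^ F.card * (1 - p) ^ (s.card - F.card) * f F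

section bernoulliSum

variable {C D : Type*} {s : Finset C} {p : ℝ} {f f₁ f₂ : Finset C → ℝ}

@[simp]
lemma bernoulliSum_empty : bernoulliSum ∅ p f = f ∅ := by
  simp [bernoulliSum]

lemma bernoulliSum_insert [DecidableEq C] {a : C} (ha : a ∉ s) :
    bernoulliSum (insert a s) p f =
      p * bernoulliSum s p (fun F => f (insert a F)) + (1 - p) * bernoulliSum s p f := by
  unfold bernoulliSum
  rw [Finset.sum_powerset_insert ha, add_comm, Finset.mul_sum, Finset.mul_sum]
  congr 1
  · refine Finset.sum_congr rfl fun F hF => ?_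
    have haF : a ∉ F := fun h => ha (Finset.mem_powerset.1 hF h)
    rw [Finset.card_insert_of_notMem ha, Finset.card_insert_of_notMem haF,
      Nat.add_sub_add_right]
    ring
  · refine Finset.sum_congr rfl fun F hF => ?_
    have hle := Finset.card_le_card (Finset.mem_powerset.1 hF)
    rw [Finset.card_insert_of_notMem ha, Nat.sub_add_comm hle]
    ring

lemma bernoulliSum_add :
    bernoulliSum s p (fun F => f₁ F + f₂ F) = bernoulliSum s p f₁ + bernoulliSum s p f₂ := by
  simp [bernoulliSum, mul_add, Finset.sum_add_distrib]

lemma bernoulliSum_const_mul (c : ℝ) :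
    bernoulliSum s p (fun F => c * f F) = c * bernoulliSum s p f := by
  simp only [bernoulliSum, Finset.mul_sum]
  exact Finset.sum_congr rfl fun F _ => by ring

lemma bernoulliSum_sum {ι : Type*} (t : Finset ι) (h : ι → Finset C → ℝ) :
    bernoulliSum s p (fun F => ∑ i ∈ t, h i F) = ∑ i ∈ t, bernoulliSum s p (h i) := by
  simp only [bernoulliSum, Finset.mul_sum]
  exact Finset.sum_comm

lemma bernoulliSum_const (c : ℝ) : bernoulliSum s p (fun _ => c) = c := by
  classical
  induction s using Finset.induction_on with
  | empty => simp
  | insert a s ha ih => rw [bernoulliSum_insert ha, ih]; ring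

lemma bernoulliSum_mono (hp0 : 0 ≤ p) (hp1 : p ≤ 1) (h : ∀ F, f₁ F ≤ f₂ F) :
    bernoulliSum s p f₁ ≤ bernoulliSum s p f₂ := by
  have : 0 ≤ 1 - p := by linarith
  refine Finset.sum_le_sum fun F _ => ?_
  have := h F
  gcongr

/-- Sprinkling: the union of independent random sets of densities `p` and `q` is a random set
whose complement has density `(1 - p) * (1 - q)`. -/
lemma bernoulliSum_union [DecidableEq C] {q r : ℝ} (hr : 1 - r = (1 - p) * (1 - q)) :
    bernoulliSum s r f =
      bernoulliSum s p (fun F => bernoulliSum s q (fun G => f (F ∪ G))) := by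
  obtain rfl : r = 1 - (1 - p) * (1 - q) := by linarith
  induction s using Finset.induction_on generalizing f with
  | empty => simp
  | insert a s ha ih =>
    simp only [bernoulliSum_insert ha, Finset.insert_union, Finset.union_insert,
      Finset.insert_idem, bernoulliSum_add, bernoulliSum_const_mul]
    rw [← ih, ← ih (f := fun F => f (insert a F))]
    ring

lemma bernoulliSum_preimage [DecidableEq C] {ι : D → C} (hι : Function.Injective ι)
    (h : Finset D → ℝ) :
    bernoulliSum s p (fun F => h (F.preimage ι hι.injOn)) =
      bernoulliSum (s.preimage ι hι.injOn) p h := by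
  classical
  induction s using Finset.induction_on generalizing h with
  | empty => simp
  | insert a s ha ih =>
    rw [bernoulliSum_insert ha]
    by_cases hb : ∃ b, ι b = a
    · obtain ⟨b, rfl⟩ := hb
      have key (F : Finset C) :
          (insert (ι b) F).preimage ι hι.injOn = insert b (F.preimage ι hι.injOn) := by
        ext x
        simp [hι.eq_iff]
      simp only [key]
      rw [bernoulliSum_insert (by simpa using ha), ih, ih (fun F => h (insert b F))]
    · have key (F : Finset C) :
          (insert a F).preimage ι hι.injOn = F.preimage ι hι.injOn := by
        ext x
        have : ι x ≠ a := fun e => hb ⟨x, e⟩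
        simp [this]
      simp only [key]
      rw [ih]
      ring

lemma bernoulliSum_forall_notMem [DecidableEq C] (A : Finset C) :
    bernoulliSum s p (fun F => if ∀ c ∈ F, c ∉ A then 1 else 0) = (1 - p) ^ (s ∩ A).card := by
  induction s using Finset.induction_on with
  | empty => simp
  | insert a s ha ih =>
    rw [bernoulliSum_insert ha, ih]
    by_cases haA : a ∈ A
    · rw [Finset.insert_inter_of_mem haA, Finset.card_insert_of_notMem (by simp [ha])]
      simp only [Finset.mem_insert, forall_eq_or_imp, haA, not_true_eq_false, false_and, if_false,
        bernoulliSum_const]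
      ring
    · rw [Finset.insert_inter_of_notMem haA]
      simp only [Finset.mem_insert, forall_eq_or_imp, haA, not_false_eq_true, true_and, ih]
      ring

end bernoulliSum

lemma Pn_eq_bernoulliSum (k n : ℕ) (α φ : ℝ) :
    Pn k n α φ = bernoulliSum Finset.univ (α * n / (Fintype.card (Clause n k) : ℝ))
      (fun F : Finset (Clause n k) => if (Z F : ℝ) < (2 : ℝ) ^ ((n : ℝ) * φ) then 1 else 0) := by
  simp [Pn, bernoulliSum, wt]

section Clause

variable {n k : ℕ}

lemma Clause.injOn_fst (c : Clause n k) : Set.InjOn Prod.fst (c.1 : Set (Fin n × Bool)) :=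
  Finset.card_image_iff.1 (c.2.2.trans c.2.1.symm)

lemma choose_le_card_not_sat (x : Fin n → Bool) :
    n.choose k ≤ (Finset.univ.filter fun c : Clause n k => ¬ sat x c).card := by
  have h : (Finset.univ.powersetCard k : Finset (Finset (Fin n))).card = n.choose k := by simp
  rw [← h]
  refine Finset.card_le_card_of_surjOn (fun c => c.1.image Prod.fst) fun S hS => ?_
  have hS : S.card = k := by simpa using hS
  refine ⟨⟨S.image fun i => (i, !x i), ?_, ?_⟩, ?_, ?_⟩
  · rw [Finset.card_image_of_injective _ fun i j h => (Prod.ext_iff.1 h).1, hS]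
  · simpa [Finset.image_image, Function.comp_def] using hS
  · simp only [Finset.coe_filter, Finset.mem_univ, true_and]
    rintro ⟨l, hl, hxl⟩
    obtain ⟨i, -, rfl⟩ := Finset.mem_image.1 hl
    simp at hxl
  · simp [Finset.image_image, Function.comp_def]

/-- A clause on the first `n` of `n + 1` variables. -/
def Clause.castSucc (c : Clause n k) : Clause (n + 1) k :=
  ⟨c.1.image (Prod.map Fin.castSucc id), by
    rw [Finset.card_image_of_injective _
      ((Fin.castSucc_injective n).prodMap Function.injective_id), c.2.1], by
    have : (c.1.image (Prod.map Fin.castSucc id)).image Prod.fst =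
        (c.1.image Prod.fst).image Fin.castSucc := by
      simp [Finset.image_image, Function.comp_def]
    rw [this, Finset.card_image_of_injective _ (Fin.castSucc_injective n), c.2.2]⟩

lemma Clause.castSucc_injective :
    Function.Injective (Clause.castSucc : Clause n k → Clause (n + 1) k) := by
  intro c d h
  exact Subtype.ext (Finset.image_injective
    ((Fin.castSucc_injective n).prodMap Function.injective_id) (Subtype.ext_iff.1 h))

lemma sat_castSucc (x : Fin (n + 1) → Bool) (c : Clause n k) :
    sat x c.castSucc ↔ sat (x ∘ Fin.castSucc) c := by
  simp only [sat, Clause.castSucc, Finset.exists_mem_image]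
  rfl

lemma Z_le_two_mul_Z_preimage (F : Finset (Clause (n + 1) k)) :
    Z F ≤ 2 * Z (F.preimage Clause.castSucc Clause.castSucc_injective.injOn) := by
  have h : (2 : ℕ) = (Finset.univ : Finset Bool).card := by simp
  unfold Z
  rw [h, mul_comm, ← Finset.card_product]
  refine Finset.card_le_card_of_injOn (fun x => (x ∘ Fin.castSucc, x (Fin.last n))) ?_ ?_
  · intro x hx
    simp only [Finset.coe_filter, Finset.mem_univ, true_and, Set.mem_ofPred_eq] at hx
    simp only [Finset.coe_product, Set.mem_prod, Finset.coe_filter, Finset.mem_univ, true_and,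
      Set.mem_ofPred_eq, Finset.coe_univ, Set.mem_univ, and_true, Finset.mem_preimage]
    exact fun c hc => (sat_castSucc x c).1 (hx _ hc)
  · intro x _ y _ hxy
    obtain ⟨h1, h2⟩ := Prod.ext_iff.1 hxy
    funext i
    refine Fin.lastCases h2 (fun j => ?_) i
    exact congrFun h1 j

lemma bernoulliSum_Z_union_le {q : ℝ} (hq0 : 0 ≤ q) (hq1 : q ≤ 1) (F : Finset (Clause n k)) :
    bernoulliSum Finset.univ q (fun G => (Z (F ∪ G) : ℝ)) ≤ Z F * (1 - q) ^ n.choose k := by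
  have hZ (G : Finset (Clause n k)) : (Z (F ∪ G) : ℝ) =
      ∑ x ∈ Finset.univ.filter fun x : Fin n → Bool => ∀ c ∈ F, sat x c,
        if ∀ c ∈ G, c ∉ Finset.univ.filter (fun c : Clause n k => ¬ sat x c) then 1 else 0 := by
    rw [Finset.sum_boole, Finset.filter_filter, Z]
    simp only [Finset.mem_union, or_imp, forall_and, Finset.mem_filter, Finset.mem_univ, true_and,
      not_not]
  simp only [hZ]
  rw [bernoulliSum_sum, Z, ← nsmul_eq_mul]
  refine Finset.sum_le_card_nsmul _ _ _ fun x _ => ?_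
  have h := bernoulliSum_forall_notMem (s := Finset.univ) (p := q)
    (Finset.univ.filter fun c : Clause n k => ¬ sat x c)
  rw [Finset.univ_inter] at h
  refine Eq.trans_le ?_
    (pow_le_pow_of_le_one (by linarith) (by linarith) (choose_le_card_not_sat x))
  convert h

end Clause

/-- If the density grows from `p` to `r` by sprinkling with density `q`, the effect of the
additional variable is compensated up to `2 * (1 - q) ^ (n + 1).choose k`. -/
lemma Pn_le_Pn_succ_add {k n : ℕ} {α β φ q : ℝ} (hφ : 0 ≤ φ) (hq0 : 0 ≤ q) (hq1 : q ≤ 1)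
    (hp0 : 0 ≤ α * n / (Fintype.card (Clause n k) : ℝ))
    (hp1 : α * n / (Fintype.card (Clause n k) : ℝ) ≤ 1)
    (hr : 1 - β * (n + 1 : ℕ) / (Fintype.card (Clause (n + 1) k) : ℝ) =
      (1 - α * n / (Fintype.card (Clause n k) : ℝ)) * (1 - q)) :
    Pn k n α φ ≤ Pn k (n + 1) β φ + 2 * (1 - q) ^ (n + 1).choose k := by
  rw [Pn_eq_bernoulliSum, Pn_eq_bernoulliSum, bernoulliSum_union hr]
  set p := α * n / (Fintype.card (Clause n k) : ℝ)
  have huniv : (Finset.univ : Finset (Clause n k)) =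
      Finset.univ.preimage Clause.castSucc Clause.castSucc_injective.injOn := by
    ext; simp
  rw [huniv,
    ← bernoulliSum_preimage Clause.castSucc_injective,
    ← bernoulliSum_const (s := (Finset.univ : Finset (Clause (n + 1) k))) (p := p)
      (2 * (1 - q) ^ (n + 1).choose k),
    ← bernoulliSum_add]
  refine bernoulliSum_mono hp0 hp1 fun F => ?_
  set T : ℝ := (2 : ℝ) ^ (((n + 1 : ℕ) : ℝ) * φ)
  have hTpos : 0 < T := by positivity
  have hq : 0 ≤ 1 - q := by linarith
  have hnonneg : 0 ≤ bernoulliSum Finset.univ q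
      (fun G => if (Z (F ∪ G) : ℝ) < T then (1 : ℝ) else 0) := by
    refine (bernoulliSum_const (p := q) 0).symm.trans_le
      (bernoulliSum_mono hq0 hq1 fun G => ?_)
    split_ifs <;> norm_num
  split_ifs with hF
  · have hZF : (Z F : ℝ) ≤ 2 * T := by
      have h1 : (Z F : ℝ) ≤
          2 * Z (F.preimage Clause.castSucc Clause.castSucc_injective.injOn) := by
        exact_mod_cast Z_le_two_mul_Z_preimage F
      have h2 : (2 : ℝ) ^ ((n : ℝ) * φ) ≤ T := by
        apply Real.rpow_le_rpow_of_exponent_le one_le_two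
        push_cast
        nlinarith
      linarith
    have markov : (1 : ℝ) ≤ bernoulliSum Finset.univ q
        (fun G => if (Z (F ∪ G) : ℝ) < T then (1 : ℝ) else 0) +
          T⁻¹ * bernoulliSum Finset.univ q (fun G => (Z (F ∪ G) : ℝ)) := by
      rw [← bernoulliSum_const_mul, ← bernoulliSum_add]
      nth_rw 1 [← bernoulliSum_const (s := (Finset.univ : Finset (Clause (n + 1) k))) (p := q) 1]
      refine bernoulliSum_mono hq0 hq1 fun G => ?_
      split_ifs with hG
      · have : 0 ≤ T⁻¹ * (Z (F ∪ G) : ℝ) := by positivity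
        linarith
      · rw [zero_add, inv_mul_eq_div, one_le_div hTpos]
        exact not_lt.1 hG
    have bound : T⁻¹ * bernoulliSum Finset.univ q (fun G => (Z (F ∪ G) : ℝ)) ≤
        2 * (1 - q) ^ (n + 1).choose k := by
      rw [inv_mul_le_iff₀ hTpos]
      calc _ ≤ Z F * (1 - q) ^ (n + 1).choose k := bernoulliSum_Z_union_le hq0 hq1 F
        _ ≤ 2 * T * (1 - q) ^ (n + 1).choose k := by gcongr
        _ = _ := by ring
    linarith
  · have := pow_nonneg hq ((n + 1).choose k)
    linarith

/-- For `k ≥ 2` the number of clauses eventually exceeds any linear function. -/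
lemma eventually_mul_lt_card_clause {k : ℕ} (hk : 2 ≤ k) (c : ℝ) :
    ∀ᶠ n : ℕ in atTop, c * n < (Fintype.card (Clause n k) : ℝ) := by
  have hlarge : ∀ᶠ n : ℕ in atTop, 4 * (k.factorial : ℝ) * |c| < n :=
    tendsto_natCast_atTop_atTop.eventually_gt_atTop _
  filter_upwards [hlarge, eventually_ge_atTop (2 * k + 2)] with n hn hnk
  have hn0 : (0 : ℝ) < n := by exact_mod_cast (by omega : 0 < n)
  have hchoose : ((n + 1 - k : ℕ) : ℝ) ^ k ≤ k.factorial * n.choose k := by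
    rw [mul_comm, ← div_le_iff₀ (by positivity)]
    exact Nat.pow_le_choose k n
  have hhalf : (n : ℝ) / 2 ≤ ((n + 1 - k : ℕ) : ℝ) := by
    rw [div_le_iff₀ two_pos]
    exact_mod_cast (by omega : n ≤ (n + 1 - k) * 2)
  have hone : (1 : ℝ) ≤ ((n + 1 - k : ℕ) : ℝ) := by
    exact_mod_cast (by omega : 1 ≤ n + 1 - k)
  have hsq : ((n : ℝ) / 2) ^ 2 ≤ k.factorial * n.choose k :=
    (pow_le_pow_left₀ (by positivity) hhalf 2).trans ((pow_le_pow_right₀ hone hk).trans hchoose)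
  have hcard : (n.choose k : ℝ) ≤ Fintype.card (Clause n k) := by
    rw [card_clause]
    exact_mod_cast Nat.le_mul_of_pos_right _ (by positivity)
  have hfac : (0 : ℝ) < k.factorial := by positivity
  have h1 : k.factorial * (|c| * n) < k.factorial * (n.choose k : ℝ) := by nlinarith
  have h2 := lt_of_mul_lt_mul_left h1 hfac.le
  have h3 : c * n ≤ |c| * n := by gcongr; exact le_abs_self c
  linarith

lemma card_clause_succ_mul {n k : ℕ} (h : k ≤ n) :
    (Fintype.card (Clause (n + 1) k) : ℝ) * (n + 1 - k) =
      (n + 1) * Fintype.card (Clause n k) := by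
  have := Nat.choose_mul_succ_eq n k
  have hcast : ((n + 1 - k : ℕ) : ℝ) = n + 1 - k := by
    rw [Nat.cast_sub (by omega)]; push_cast; ring
  rw [card_clause, card_clause, ← hcast]
  exact_mod_cast (by rw [mul_right_comm, ← this]; ring)

/-- **Removing one variable is compensated by a vanishing increase of the density:**
there is an increasing function `g` with `g(n)/n → 0` such that for every `τ > 0` and all
`n` large enough, `P_{n-1}(α,φ) ≤ P_n(α + g(n)/n, φ) + τ`. -/
theorem remove_one_variable (k : ℕ) (hk : 2 ≤ k) (α : ℝ) (hα : 0 < α) (φ : ℝ)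
    (hφ : φ ∈ Set.Ico (0 : ℝ) 1) :
    ∃ g : ℕ → ℝ, Monotone g ∧ Tendsto (fun n : ℕ => g n / n) atTop (𝓝 0) ∧
      ∀ τ : ℝ, 0 < τ → ∃ N : ℕ, ∀ n ≥ N,
        Pn k (n - 1) α φ ≤ Pn k n (α + g n / n) φ + τ := by
  have hsqrt : Tendsto (fun n : ℕ => √(n : ℝ)) atTop atTop :=
    Real.tendsto_sqrt_atTop.comp tendsto_natCast_atTop_atTop
  refine ⟨fun n => √n, fun a b hab => Real.sqrt_le_sqrt (by exact_mod_cast hab), ?_, ?_⟩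
  · simp only [Real.sqrt_div_self]
    exact (tendsto_inv_atTop_zero.comp hsqrt :)
  intro τ hτ
  have hexp : Tendsto (fun n : ℕ => 2 * Real.exp (-((√(n : ℝ) - 2 * α * k) / 2 ^ k)))
      atTop (𝓝 0) := by
    have h1 : Tendsto (fun n : ℕ => (√(n : ℝ) - 2 * α * k) / 2 ^ k) atTop atTop :=
      (tendsto_atTop_add_const_right _ _ hsqrt).atTop_div_const (by positivity)
    simpa using (Real.tendsto_exp_neg_atTop_nhds_zero.comp h1).const_mul 2
  obtain ⟨N, hN⟩ := eventually_atTop.1 (((hexp.eventually_lt_const hτ).and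
    (hsqrt.eventually_gt_atTop (2 * α * k))).and ((eventually_mul_lt_card_clause hk (α + 1)).and
    (eventually_ge_atTop (2 * k + 2))))
  refine ⟨N, fun n hn => ?_⟩
  obtain ⟨⟨hsmall, hgrow⟩, hcard, hnk⟩ := hN n hn
  obtain ⟨m, rfl⟩ : ∃ m, n = m + 1 := ⟨n - 1, by omega⟩
  rw [Nat.add_sub_cancel]
  set g := √((m + 1 : ℕ) : ℝ) with hg
  have hkm : k ≤ m := by omega
  have hsucc := card_clause_succ_mul hkm
  have hMpos : (0 : ℝ) < Fintype.card (Clause m k) := by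
    rw [card_clause]; exact_mod_cast Nat.mul_pos (Nat.choose_pos hkm) (by positivity)
  have hNeq : (Fintype.card (Clause (m + 1) k) : ℝ) = (m + 1).choose k * 2 ^ k := by
    rw [card_clause]; push_cast; ring
  have hNpos : (0 : ℝ) < Fintype.card (Clause (m + 1) k) := by
    rw [card_clause]; exact_mod_cast Nat.mul_pos (Nat.choose_pos (by omega)) (by positivity)
  set M : ℝ := (Fintype.card (Clause m k) : ℝ)
  set L : ℝ := (Fintype.card (Clause (m + 1) k) : ℝ)
  have hm : 2 * (k : ℝ) + 1 ≤ m := by exact_mod_cast (by omega : 2 * k + 1 ≤ m)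
  have hk0 : (2 : ℝ) ≤ k := by exact_mod_cast hk
  have hcast : ((m + 1 : ℕ) : ℝ) = m + 1 := by push_cast; ring
  have hg1 : g ≤ m + 1 := by
    rw [hg, hcast]
    exact Real.sqrt_le_iff.2 ⟨by linarith, by nlinarith⟩
  have hr : (α + g / (m + 1 : ℕ)) * (m + 1 : ℕ) = α * (m + 1) + g := by
    rw [hcast]; field_simp
  set p := α * m / M with hp
  set r := (α + g / (m + 1 : ℕ)) * (m + 1 : ℕ) / L with hrdef
  have hLr : L * r = α * (m + 1) + g := by rw [hrdef, hr]; field_simp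
  have hLp : L * p * (m + 1 - k) = α * m * (m + 1) := by
    rw [hp, show L * (α * m / M) * (m + 1 - k) = L * (m + 1 - k) * (α * m / M) by ring, hsucc]
    field_simp
  have hp0 : 0 ≤ p := by positivity
  have hLp_le : L * p ≤ α * (m + 1) + 2 * α * k := by
    refine le_of_mul_le_mul_right ?_ (by linarith : (0 : ℝ) < m + 1 - k)
    rw [hLp]
    have h : (m : ℝ) * (m + 1) ≤ (m + 1 + 2 * k) * (m + 1 - k) := by nlinarith
    nlinarith
  have hdiff : g - 2 * α * k ≤ L * (r - p) := by rw [mul_sub, hLr]; linarith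
  have hpr : p < r := by
    have : 0 < L * (r - p) := by linarith
    linarith [pos_of_mul_pos_right this hNpos.le]
  have hr1 : r ≤ 1 := by
    refine le_of_mul_le_mul_left ?_ hNpos
    rw [hLr, mul_one]
    rw [hcast] at hcard
    linarith
  have hp1 : 0 < 1 - p := by linarith
  set q := (r - p) / (1 - p) with hq
  have hq0 : 0 ≤ q := div_nonneg (by linarith) hp1.le
  have hq1 : q ≤ 1 := by rw [hq, div_le_one hp1]; linarith
  have hqge : r - p ≤ q := by
    rw [hq, le_div_iff₀ hp1]
    nlinarith
  have hsprinkle : 1 - r = (1 - p) * (1 - q) := by rw [hq]; field_simp; ring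
  refine (Pn_le_Pn_succ_add hφ.1 hq0 hq1 hp0 (by linarith) hsprinkle).trans ?_
  have hpow : (1 - q) ^ (m + 1).choose k ≤ Real.exp (-((g - 2 * α * k) / 2 ^ k)) := by
    calc (1 - q) ^ (m + 1).choose k ≤ Real.exp (-q) ^ (m + 1).choose k :=
          pow_le_pow_left₀ (by linarith) (Real.one_sub_le_exp_neg q) _
      _ = Real.exp (-((m + 1).choose k * q)) := by rw [← Real.exp_nat_mul]; ring_nf
      _ ≤ _ := by
        rw [Real.exp_le_exp, neg_le_neg_iff, div_le_iff₀ (by positivity)]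
        calc _ ≤ L * (r - p) := hdiff
          _ ≤ L * q := by gcongr
          _ = _ := by rw [hNeq]; ring
  linarith
end
end
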